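/- Let (X_n) be a regular sequence of compact length surfaces, each with q > 0 boundary components and reduced connectivity number c, converging in the Gromov-Hausdorff sense to a compact metric space X, such that the boundaries (∂X_n) converge to a subset ∂∞X of X. If b is a connected component of ∂∞X, then b is a 1-cactoid. -/

import Mathlib

open Filter Topology Metric Set GromovHausdorff
open scoped ENNReal unitInterval

noncomputable section

/-! ## Model spaces -/

/-- The closed upper half plane in `ℝ × ℝ` (used for topological charts). -/
def HalfPlane : Set (ℝ × ℝ) := {p | 0 ≤ p.2}

/-- The closed upper half plane in the Euclidean plane (used for metric charts). -/
def EHalfPlane : Set (EuclideanSpace ℝ (Fin 2)) := {p | 0 ≤ p 1}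

/-- The unit circle (the 1-sphere). -/
def Circle1 : Set (EuclideanSpace ℝ (Fin 2)) := Metric.sphere 0 1

/-- The 2-sphere. -/
def Sphere2 : Set (EuclideanSpace ℝ (Fin 3)) := Metric.sphere 0 1

/-- The closed 2-disc. -/
def Disc2 : Set (EuclideanSpace ℝ (Fin 2)) := Metric.closedBall 0 1

/-- The relation on the unit square generating the Möbius identification
`(0, y) ∼ (1, 1 - y)`. -/
def mobiusRel (p q : I × I) : Prop :=
  ((p.1 : ℝ) = 0 ∧ (q.1 : ℝ) = 1 ∧ (p.2 : ℝ) = 1 - (q.2 : ℝ)) ∨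
  ((p.1 : ℝ) = 1 ∧ (q.1 : ℝ) = 0 ∧ (p.2 : ℝ) = 1 - (q.2 : ℝ))

/-- The Möbius band, as a quotient of the unit square. -/
def MobiusBand : Type := Quot mobiusRel

instance : TopologicalSpace MobiusBand :=
  inferInstanceAs (TopologicalSpace (Quot mobiusRel))

/-! ## Surfaces -/

/-- A topological 2-manifold with (possibly empty) boundary: every point has an open
neighborhood homeomorphic to an open subset of the closed half plane. -/
def IsSurface (X : Type*) [TopologicalSpace X] : Prop :=
  ∀ x : X, ∃ (U : Set X) (V : Set HalfPlane),
    IsOpen U ∧ x ∈ U ∧ IsOpen V ∧ Nonempty (↥U ≃ₜ ↥V)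

/-- A compact surface: a compact connected (Hausdorff) topological 2-manifold with
possibly empty boundary. -/
def IsCompactSurface (X : Type*) [TopologicalSpace X] : Prop :=
  CompactSpace X ∧ ConnectedSpace X ∧ T2Space X ∧ IsSurface X

/-- The (manifold) boundary of a surface: the set of points having no open neighborhood
homeomorphic to an open subset of the plane. -/
def surfaceBoundary (X : Type*) [TopologicalSpace X] : Set X :=
  {x | ¬ ∃ (U : Set X) (V : Set (ℝ × ℝ)), IsOpen U ∧ x ∈ U ∧ IsOpen V ∧ Nonempty (↥U ≃ₜ ↥V)}

/-- The set of boundary components of a surface, i.e. the connected components of the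
boundary. -/
def surfaceBoundaryComponents (X : Type*) [TopologicalSpace X] : Set (Set X) :=
  {b | ∃ x ∈ surfaceBoundary X, b = connectedComponentIn (surfaceBoundary X) x}

/-- A surface is orientable iff it contains no subset homeomorphic to the Möbius band. -/
def SurfOrientable (X : Type*) [TopologicalSpace X] : Prop :=
  ¬ ∃ A : Set X, Nonempty (↥A ≃ₜ MobiusBand)

/-- The free rank of the first homology (the abelianized fundamental group). -/
noncomputable def h1Rank (X : Type*) [TopologicalSpace X] : ℕ :=
  ⨆ x : X, (Module.rank ℤ (Additive (Abelianization (FundamentalGroup X x)))).toNat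

open Classical in
/-- The connectivity number of a compact surface `S`, i.e. `2 - χ(S)`.  By the
classification of compact surfaces this equals the free rank of the first homology,
plus one unless the surface is closed and orientable. -/
noncomputable def connNum (X : Type*) [TopologicalSpace X] : ℕ :=
  h1Rank X + (if surfaceBoundary X = ∅ ∧ SurfOrientable X then 0 else 1)

/-- The reduced connectivity number: the connectivity number minus the number of
boundary components. -/
noncomputable def redConnNum (X : Type*) [TopologicalSpace X] : ℤ :=
  (connNum X : ℤ) - ((surfaceBoundaryComponents X).ncard : ℤ)

/-! ## Length and geodesic spaces -/

/-- The length of a path, as the total variation of the parametrization. -/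
noncomputable def pathLength {X : Type*} [MetricSpace X] {x y : X} (γ : Path x y) : ℝ≥0∞ :=
  eVariationOn (fun t => γ t) Set.univ

/-- A metric space is a length space if the distance between any two points is the
infimum of the lengths of paths joining them. -/
def IsLengthSpace (X : Type*) [MetricSpace X] : Prop :=
  ∀ x y : X, edist x y = ⨅ γ : Path x y, pathLength γ

/-- A metric space is geodesic if any two points are joined by a path whose length
realizes the distance. -/
def IsGeodesicSpace (X : Type*) [MetricSpace X] : Prop :=
  ∀ x y : X, ∃ γ : Path x y, pathLength γ = edist x y

/-! ## Peano spaces, Jordan curves and cyclic elements -/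

/-- A Peano space: a compact connected locally connected metric space. -/
def IsPeano (X : Type*) [MetricSpace X] : Prop :=
  CompactSpace X ∧ ConnectedSpace X ∧ LocallyConnectedSpace X

/-- A Jordan curve: a subset homeomorphic to the 1-sphere. -/
def IsJordanCurve {X : Type*} [TopologicalSpace X] (J : Set X) : Prop :=
  Nonempty (↥J ≃ₜ ↥Circle1)

/-- A set is cyclicly connected if every pair of distinct points of it lies on a common
Jordan curve contained in it. -/
def CycliclyConnected {X : Type*} [TopologicalSpace X] (A : Set X) : Prop :=
  ∀ x ∈ A, ∀ y ∈ A, x ≠ y → ∃ J : Set X, J ⊆ A ∧ IsJordanCurve J ∧ x ∈ J ∧ y ∈ J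

/-- A maximal cyclic subset: a nondegenerate cyclicly connected subset which is not a
proper subset of any cyclicly connected subset. -/
def IsMaximalCyclic {X : Type*} [TopologicalSpace X] (A : Set X) : Prop :=
  A.Nontrivial ∧ CycliclyConnected A ∧ ∀ B : Set X, CycliclyConnected B → A ⊆ B → A = B

/-- A subcontinuum: a compact connected (hence nonempty) subset. -/
def IsSubcontinuum {X : Type*} [TopologicalSpace X] (C : Set X) : Prop :=
  IsCompact C ∧ IsConnected C

/-- `b` is a boundary component of the subset `T` (viewed as a subspace). -/
def IsBoundaryComponentOf {X : Type*} [TopologicalSpace X] (T b : Set X) : Prop :=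
  ∃ b' ∈ surfaceBoundaryComponents ↥T, b = Subtype.val '' b'

/-- An admissible subcontinuum: it meets every maximal cyclic subset `T` in at most a
point or in a boundary component of `T`. -/
def IsAdmissible {X : Type*} [TopologicalSpace X] (C : Set X) : Prop :=
  IsSubcontinuum C ∧
    ∀ T : Set X, IsMaximalCyclic T →
      ((T ∩ C).Subsingleton ∨ IsBoundaryComponentOf T (T ∩ C))

/-- A 1-cactoid: a Peano space all of whose maximal cyclic subsets are homeomorphic to
the 1-sphere. -/
def IsOneCactoid (X : Type*) [MetricSpace X] : Prop :=
  IsPeano X ∧ ∀ T : Set X, IsMaximalCyclic T → Nonempty (↥T ≃ₜ ↥Circle1)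

/-- A subset homeomorphic to the 2-sphere or the closed 2-disc. -/
def SphereOrDisc {X : Type*} [TopologicalSpace X] (T : Set X) : Prop :=
  Nonempty (↥T ≃ₜ ↥Sphere2) ∨ Nonempty (↥T ≃ₜ ↥Disc2)

/-! ## Generalized cactoids -/

/-- A generalized cactoid. -/
def IsGeneralizedCactoid (X : Type*) [MetricSpace X] : Prop :=
  IsPeano X ∧ (∀ T : Set X, IsMaximalCyclic T → IsCompactSurface ↥T) ∧
  {T : Set X | IsMaximalCyclic T ∧ ¬ SphereOrDisc T}.Finite ∧
  ∃ (n : ℕ) (C : Fin n → Set X),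
    (∀ i, IsAdmissible (C i)) ∧ (Pairwise fun i j => Disjoint (C i) (C j)) ∧
    ∀ T b : Set X, IsMaximalCyclic T → IsBoundaryComponentOf T b → b ⊆ ⋃ i, C i

/-- A pre-boundary consisting of `n` disjoint admissible subcontinua, each containing a
boundary component of some maximal cyclic subset, which together cover all boundary
components of all maximal cyclic subsets. -/
def IsPreBoundaryOfSize {X : Type*} [TopologicalSpace X] (n : ℕ) (P : Set X) : Prop :=
  ∃ C : Fin n → Set X,
    (∀ i, IsAdmissible (C i)) ∧ (Pairwise fun i j => Disjoint (C i) (C j)) ∧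
    (∀ i, ∃ T b : Set X, IsMaximalCyclic T ∧ IsBoundaryComponentOf T b ∧ b ⊆ C i) ∧
    (∀ T b : Set X, IsMaximalCyclic T → IsBoundaryComponentOf T b → b ⊆ ⋃ i, C i) ∧
    P = ⋃ i, C i

def IsPreBoundary {X : Type*} [TopologicalSpace X] (P : Set X) : Prop :=
  ∃ n, IsPreBoundaryOfSize n P

/-- A minimal pre-boundary: one with the minimal possible number of pieces. -/
def IsMinimalPreBoundary {X : Type*} [TopologicalSpace X] (P : Set X) : Prop :=
  ∃ n, IsPreBoundaryOfSize n P ∧ ∀ (m : ℕ) (Q : Set X), IsPreBoundaryOfSize m Q → n ≤ m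

/-- The boundary of a generalized cactoid: the union of all minimal pre-boundaries. -/
def cactoidBoundary (X : Type*) [TopologicalSpace X] : Set X :=
  ⋃₀ {P : Set X | IsMinimalPreBoundary P}

/-- The boundary components of a generalized cactoid: the connected components of its
boundary. -/
def cactoidBoundaryComponents (X : Type*) [TopologicalSpace X] : Set (Set X) :=
  {b | ∃ x ∈ cactoidBoundary X, b = connectedComponentIn (cactoidBoundary X) x}

/-- The connectivity number of a generalized cactoid: the sum of the reduced
connectivity numbers of its maximal cyclic subsets plus the number of its boundary
components. -/
noncomputable def cactoidConnNum (X : Type*) [TopologicalSpace X] : ℤ :=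
  (∑ᶠ T ∈ {T : Set X | IsMaximalCyclic T}, redConnNum ↥T) +
    ((cactoidBoundaryComponents X).ncard : ℤ)

/-! ## Bundled spaces -/

structure BundledMet where
  carrier : Type
  [str : MetricSpace carrier]

attribute [instance] BundledMet.str

structure BundledTop where
  carrier : Type
  [str : TopologicalSpace carrier]

attribute [instance] BundledTop.str

/-! ## Metric two-point identifications -/

/-- `p : A → B` is (the projection of) a metric 2-point identification: it glues exactly
two distinct points `x₁, x₂` of `A` and carries the corresponding quotient metric. -/
def IsTwoPointIdentification {A B : Type*} [MetricSpace A] [MetricSpace B] (p : A → B) : Prop :=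
  Function.Surjective p ∧ ∃ x₁ x₂ : A, x₁ ≠ x₂ ∧
    (∀ a b : A, p a = p b ↔ (a = b ∨ (a = x₁ ∧ b = x₂) ∨ (a = x₂ ∧ b = x₁))) ∧
    ∀ a b : A, dist (p a) (p b) =
      min (dist a b) (min (dist a x₁ + dist x₂ b) (dist a x₂ + dist x₁ b))

/-- `Y` is obtained from `X` by a successive application of `k` metric 2-point
identifications, exactly `k₀` of which are boundary identifications with respect to the
subset `B ⊆ X`. -/
def ObtainedByIdentifications (X : Type) [MetricSpace X] (B : Set X) (k k0 : ℕ)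
    (Y : Type) [MetricSpace Y] : Prop :=
  ∃ (Z : ℕ → BundledMet) (p : ∀ i : ℕ, (Z i).carrier → (Z (i + 1)).carrier)
    (e : X ≃ᵢ (Z 0).carrier) (f : (Z k).carrier ≃ᵢ Y) (q : ∀ i : ℕ, X → (Z i).carrier),
    (∀ i, i < k → IsTwoPointIdentification (p i)) ∧
    (∀ x, q 0 x = e x) ∧ (∀ i x, q (i + 1) x = p i (q i x)) ∧
    {i : ℕ | i < k ∧ ∃ a b : (Z i).carrier,
        a ∈ q i '' B ∧ b ∈ q i '' B ∧ a ≠ b ∧ p i a = p i b}.ncard = k0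

/-! ## Gromov–Hausdorff sequences of surfaces -/

/-- A sequence of (isometry classes of) compact length surfaces with connectivity
number `c`. -/
def IsSurfaceGHSeq (c : ℕ) (K : ℕ → GHSpace) : Prop :=
  ∀ n, IsCompactSurface (K n).Rep ∧ IsLengthSpace (K n).Rep ∧ connNum (K n).Rep = c

/-- The structural description of the limit spaces in the Main Theorem: `X` is obtained
from a geodesic generalized cactoid `Y` by `k` successive metric 2-point
identifications, `k₀` of them boundary identifications, where the connectivity number
of `Y` is at most `c + k₀ - 2k`. -/
def MainThmRHS (c : ℕ) (X : Type) [MetricSpace X] : Prop :=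
  ∃ (k k0 : ℕ) (Y : BundledMet),
    IsGeneralizedCactoid Y.carrier ∧ IsGeodesicSpace Y.carrier ∧
    ObtainedByIdentifications Y.carrier (cactoidBoundary Y.carrier) k k0 X ∧
    cactoidConnNum Y.carrier ≤ (c : ℤ) + (k0 : ℤ) - 2 * (k : ℤ)

/-! ## Covering dimension -/

/-- `X` has covering dimension at most `n`: every open cover admits an open refinement
of order at most `n + 1`. -/
def CoveringDimLE (X : Type*) [TopologicalSpace X] (n : ℕ) : Prop :=
  ∀ U : Set (Set X), (∀ u ∈ U, IsOpen u) → ⋃₀ U = Set.univ →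
    ∃ V : Set (Set X), (∀ v ∈ V, IsOpen v) ∧ ⋃₀ V = Set.univ ∧
      (∀ v ∈ V, ∃ u ∈ U, v ⊆ u) ∧
      ∀ x : X, {v | v ∈ V ∧ x ∈ v}.encard ≤ (n : ℕ∞) + 1

/-! ## Curves in surfaces -/

/-- A continuous map from the circle is nullhomotopic if it is homotopic to a constant. -/
def IsNullhomotopic {X : Type*} [TopologicalSpace X] (f : C(↥Circle1, X)) : Prop :=
  ∃ y : X, f.Homotopic (ContinuousMap.const _ y)

/-- A contractible Jordan curve. -/
def IsContractibleJordanCurve {X : Type*} [TopologicalSpace X] (J : Set X) : Prop :=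
  IsJordanCurve J ∧
    ∀ f : C(↥Circle1, X), Function.Injective f → Set.range f = J → IsNullhomotopic f

/-- A non-contractible Jordan curve. -/
def IsNonContractibleJordanCurve {X : Type*} [TopologicalSpace X] (J : Set X) : Prop :=
  IsJordanCurve J ∧
    ∀ f : C(↥Circle1, X), Function.Injective f → Set.range f = J → ¬ IsNullhomotopic f

/-- A simple arc in a surface: an injective path whose endpoints lie on the boundary and
whose interior does not. -/
def IsSimpleArc {X : Type*} [TopologicalSpace X] (γ : C(I, X)) : Prop :=
  Function.Injective γ ∧ γ 0 ∈ surfaceBoundary X ∧ γ 1 ∈ surfaceBoundary X ∧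
    ∀ t : I, t ≠ 0 → t ≠ 1 → γ t ∉ surfaceBoundary X

/-- A subset separates the space if its complement is disconnected. -/
def SeparatesSpace {X : Type*} [TopologicalSpace X] (A : Set X) : Prop :=
  ¬ IsPreconnected Aᶜ

/-- The arc `γ` forms a contractible Jordan curve together with a subarc of some
boundary component. -/
def FormsContractibleJordanWithBoundary {X : Type*} [TopologicalSpace X]
    (γ : C(I, X)) : Prop :=
  ∃ β : C(I, X), Function.Injective β ∧ Set.range β ⊆ surfaceBoundary X ∧
    β 0 = γ 0 ∧ β 1 = γ 1 ∧ IsContractibleJordanCurve (Set.range γ ∪ Set.range β)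

/-- `z` separates `x` and `y` inside the subset `A`: both lie in `A \ {z}` and no
connected subset of `A \ {z}` contains both. -/
def SeparatesIn {X : Type*} [TopologicalSpace X] (A : Set X) (z x y : X) : Prop :=
  x ∈ A \ {z} ∧ y ∈ A \ {z} ∧
    ∀ C : Set X, C ⊆ A \ {z} → IsPreconnected C → ¬ (x ∈ C ∧ y ∈ C)

/-! ## Metric doubles -/

/-- `D` together with the two canonical maps `ip, im : X → D` is the metric double of
`X` along the subset `B`. -/
structure IsMetricDouble (X : Type*) [MetricSpace X] (B : Set X) (D : Type*)
    [MetricSpace D] (ip im : X → D) : Prop where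
  isom_p : Isometry ip
  isom_m : Isometry im
  surj : Set.range ip ∪ Set.range im = Set.univ
  agree : ∀ z ∈ B, ip z = im z
  dist_mix : ∀ a b : X, dist (ip a) (im b) = ⨅ z : ↥B, (dist a (z : X) + dist (z : X) b)

/-- Regularity of a sequence of doubles: there is no sequence of non-contractible
Jordan curves in the doubles with vanishing diameters. -/
def RegularDoubleSeq (D : ℕ → Type) [∀ n, MetricSpace (D n)] : Prop :=
  ∀ J : ∀ n, Set (D n), (∀ n, IsNonContractibleJordanCurve (J n)) →
    0 < ⨅ n, Metric.diam (J n)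

/-- The copy `A^+` (or `A^-`) in the double limit corresponding to a subset `A` of the
limit `X`, via the isometric identification `j` of `X` with `X^+` (resp. `X^-`). -/
def plusCopy {Z D : Type*} {X : Set Z} {Xp : Set D} (j : ↥X → ↥Xp) (A : Set Z) :
    Set D :=
  (fun x => ((j x : ↥Xp) : D)) '' {x : ↥X | (x : Z) ∈ A}

/-! ## Riemannian and polyhedral surfaces -/

/-- The Riemannian length integrand `√(g_{γ(t)}(γ'(t), γ'(t)))`. -/
noncomputable def riemLengthIntegrand (g : (ℝ × ℝ) → (ℝ × ℝ) → (ℝ × ℝ) → ℝ)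
    (γ : ℝ → ℝ × ℝ) (t : ℝ) : ℝ :=
  Real.sqrt (g (γ t) (deriv γ t) (deriv γ t))

/-- A compact connected smooth Riemannian 2-manifold, as a metric space: a compact
length surface such that around every point there is a chart in which the length of
every C¹ curve is computed by a smooth positive definite symmetric bilinear metric. -/
def IsSmoothRiemannianSurface (X : Type*) [MetricSpace X] : Prop :=
  IsCompactSurface X ∧ IsLengthSpace X ∧
  ∀ x : X, ∃ (U : Set X) (V : Set (ℝ × ℝ)) (φ : X → ℝ × ℝ) (ψ : ℝ × ℝ → X)
      (g : (ℝ × ℝ) → (ℝ × ℝ) → (ℝ × ℝ) → ℝ),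
    IsOpen U ∧ x ∈ U ∧ (∃ V' : Set (ℝ × ℝ), IsOpen V' ∧ V = V' ∩ HalfPlane) ∧
    ContinuousOn φ U ∧ φ '' U = V ∧ ContinuousOn ψ V ∧
    (∀ y ∈ U, ψ (φ y) = y) ∧ (∀ v ∈ V, φ (ψ v) = v) ∧
    (∀ m : ℕ, ContDiffOn ℝ m
      (fun pq : (ℝ × ℝ) × (ℝ × ℝ) × (ℝ × ℝ) => g pq.1 pq.2.1 pq.2.2)
      (V ×ˢ ((Set.univ : Set (ℝ × ℝ)) ×ˢ (Set.univ : Set (ℝ × ℝ))))) ∧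
    (∀ p u v, g p u v = g p v u) ∧
    (∀ p (a : ℝ) u u' v, g p (a • u + u') v = a * g p u v + g p u' v) ∧
    (∀ p ∈ V, ∀ u : ℝ × ℝ, u ≠ 0 → 0 < g p u u) ∧
    ∀ (cur : ℝ → X) (a b : ℝ), a ≤ b → Set.MapsTo cur (Set.Icc a b) U →
      ContDiffOn ℝ 1 (φ ∘ cur) (Set.Icc a b) →
      eVariationOn cur (Set.Icc a b) =
        ENNReal.ofReal (∫ t in a..b, riemLengthIntegrand g (φ ∘ cur) t)

/-- A polyhedral surface: a compact length surface which is flat (locally isometric to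
a subset of the Euclidean half plane) away from finitely many singular points. -/
def IsPolyhedralSurface (X : Type*) [MetricSpace X] : Prop :=
  IsCompactSurface X ∧ IsLengthSpace X ∧
  ∃ F : Set X, F.Finite ∧ ∀ x : X, x ∉ F →
    ∃ (U : Set X) (W : Set (EuclideanSpace ℝ (Fin 2))),
      IsOpen U ∧ x ∈ U ∧ W ⊆ EHalfPlane ∧ Nonempty (↥U ≃ᵢ ↥W)

end

/-! ### Continuous logarithms -/

/-- `f` has a continuous logarithm on `S`. -/
def HasLogOn {A : Type*} [TopologicalSpace A] (f : A → ℂ) (S : Set A) : Prop :=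
  ∃ g : A → ℂ, ContinuousOn g S ∧ ∀ x ∈ S, f x = Complex.exp (g x)

theorem exists_log_homotopy {A : Type*} [TopologicalSpace A] {H : I × A → ℂ}
    (hH : Continuous H) (h0 : ∀ p, H p ≠ 0) {g : A → ℂ} (hg : Continuous g)
    (hgH : ∀ a, H (0, a) = Complex.exp (g a)) :
    ∃ G : I × A → ℂ, Continuous G ∧ ∀ p, H p = Complex.exp (G p) := by
  let K : C(I × A, {z : ℂ // z ≠ 0}) := ⟨fun p => ⟨H p, h0 p⟩, by fun_prop⟩
  refine ⟨Complex.isCoveringMap_exp.liftHomotopy K ⟨g, hg⟩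
    (fun a => Subtype.ext (hgH a)), map_continuous _, fun p => ?_⟩
  have := congr_fun (Complex.isCoveringMap_exp.liftHomotopy_lifts K ⟨g, hg⟩
    (fun a => Subtype.ext (hgH a))) p
  exact (congr_arg Subtype.val this).symm

theorem HasLogOn.of_starConvex {E : Type*} [NormedAddCommGroup E] [NormedSpace ℝ E]
    {S : Set E} {a : E} (hS : StarConvex ℝ a S) (ha : a ∈ S) {f : E → ℂ}
    (hf : ContinuousOn f S) (h0 : ∀ x ∈ S, f x ≠ 0) : HasLogOn f S := by
  classical
  let m : I × S → S := fun p => ⟨a + (p.1 : ℝ) • ((p.2 : E) - a),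
    hS.add_smul_sub_mem p.2.2 p.1.2.1 p.1.2.2⟩
  have hm : Continuous m := by
    apply Continuous.subtype_mk; fun_prop
  have hfS : Continuous (fun x : S => f x) := continuousOn_iff_continuous_domRestrict.1 hf
  obtain ⟨G, hG, hGe⟩ := exists_log_homotopy (H := fun p => f (m p))
    (hfS.comp hm) (fun p => h0 _ (m p).2) (g := fun _ => Complex.log (f a)) continuous_const
    (fun x => by simp [m, Complex.exp_log (h0 a ha)])
  refine ⟨fun x => if hx : x ∈ S then G (1, ⟨x, hx⟩) else 0, ?_, fun x hx => ?_⟩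
  · rw [continuousOn_iff_continuous_domRestrict]
    have : Continuous fun x : S => G (1, x) := by fun_prop
    refine this.congr fun x => ?_
    simp
  · have := hGe (1, ⟨x, hx⟩)
    simpa [m, hx] using this

theorem HasLogOn.of_convex {E : Type*} [NormedAddCommGroup E] [NormedSpace ℝ E]
    {S : Set E} (hS : Convex ℝ S) {f : E → ℂ}
    (hf : ContinuousOn f S) (h0 : ∀ x ∈ S, f x ≠ 0) : HasLogOn f S := by
  rcases S.eq_empty_or_nonempty with rfl | ⟨a, ha⟩
  · exact ⟨0, by simp, by simp⟩
  · exact .of_starConvex (hS.starConvex ha) ha hf h0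

theorem log_unique {A : Type*} [TopologicalSpace A] {S : Set A} (hS : IsPreconnected S)
    {g₁ g₂ : A → ℂ} (h₁ : ContinuousOn g₁ S) (h₂ : ContinuousOn g₂ S)
    (h : ∀ x ∈ S, Complex.exp (g₁ x) = Complex.exp (g₂ x)) {x y : A} (hx : x ∈ S) (hy : y ∈ S) :
    g₁ x - g₂ x = g₁ y - g₂ y := by
  have : PreconnectedSpace S := isPreconnected_iff_preconnectedSpace.1 hS
  have key := Complex.isCoveringMap_exp.eq_of_comp_eq
    (g₁ := fun z : S => g₁ z) (g₂ := fun z : S => g₂ z + (g₁ x - g₂ x))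
    (continuousOn_iff_continuous_domRestrict.1 h₁)
    ((continuousOn_iff_continuous_domRestrict.1 h₂).add continuous_const)
    (by
      funext z
      apply Subtype.ext
      simp [Complex.exp_add, Complex.exp_sub, h x hx, h z z.2]) ⟨x, hx⟩ (by simp)
  have := congr_fun key ⟨y, hy⟩
  simp at this
  rw [this]; ring

/-- The punctured disc of radius `R`. -/
def pball (R : ℝ) : Set ℂ := {z | z ≠ 0 ∧ ‖z‖ < R}

theorem isOpen_pball (R : ℝ) : IsOpen (pball R) :=
  isOpen_ne.inter (isOpen_lt continuous_norm continuous_const)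

theorem exp_mem_pball {R : ℝ} (hR : 0 < R) {z : ℂ} :
    Complex.exp z ∈ pball R ↔ z.re < Real.log R := by
  simp [pball, Complex.norm_exp, Real.lt_log_iff_exp_lt hR]

theorem exists_degree {R : ℝ} (hR : 0 < R) {f : ℂ → ℂ} (hf : ContinuousOn f (pball R))
    (h0 : ∀ z ∈ pball R, f z ≠ 0) :
    ∃ (d : ℤ) (g : ℂ → ℂ), ContinuousOn g (pball R) ∧
      ∀ z ∈ pball R, f z = z ^ d * Complex.exp (g z) := by
  let S : Set ℂ := {z | z.re < Real.log R}
  have hSc : Convex ℝ S := convex_halfSpace_re_lt _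
  have hSe : MapsTo Complex.exp S (pball R) := fun z hz => (exp_mem_pball hR).2 hz
  obtain ⟨G, hG, hGe⟩ := HasLogOn.of_convex hSc
    (hf.comp Complex.continuous_exp.continuousOn hSe) (fun z hz => h0 _ (hSe hz))
  have hSp : ∀ (n : ℤ) z, z ∈ S → z + n * (2 * Real.pi * Complex.I) ∈ S := by
    intro n z hz
    simpa [S] using hz
  let c : ℂ := Real.log R - 1
  have hc : c ∈ S := by simp [S, c]
  have hper : ∀ z ∈ S, G (z + (2 * Real.pi * Complex.I)) - G z
      = G (c + (2 * Real.pi * Complex.I)) - G c := by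
    intro z hz
    refine log_unique (g₁ := fun z => G (z + (2 * Real.pi * Complex.I))) (g₂ := G)
      hSc.isPreconnected ?_ hG ?_ hz hc
    · exact hG.comp (by fun_prop) (fun z hz => by simpa using hSp 1 z hz)
    · intro w hw
      have h1 := hGe w hw
      have h2 := hGe _ (by simpa using hSp 1 w hw)
      simp only [Function.comp, Complex.exp_add, Complex.exp_two_pi_mul_I, mul_one] at h1 h2
      rw [← h1, ← h2]
  obtain ⟨d, hd⟩ : ∃ d : ℤ, G (c + (2 * Real.pi * Complex.I)) - G c
      = d * (2 * Real.pi * Complex.I) := by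
    have h1 := hGe c hc
    have h2 := hGe _ (by simpa using hSp 1 c hc)
    simp only [Function.comp, Complex.exp_add, Complex.exp_two_pi_mul_I, mul_one] at h1 h2
    have : Complex.exp (G (c + (2 * Real.pi * Complex.I)) - G c) = 1 := by
      rw [Complex.exp_sub, ← h1, ← h2, div_self (h0 _ (hSe hc))]
    exact (Complex.exp_eq_one_iff).1 this
  let F : ℂ → ℂ := fun z => G z - d * z
  have hF : ContinuousOn F S := hG.sub (by fun_prop)
  have hF1 : ∀ z ∈ S, F (z + (2 * Real.pi * Complex.I)) = F z := by
    intro z hz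
    have := hper z hz
    rw [hd] at this
    simp only [F]
    linear_combination this
  have hFnat : ∀ (n : ℕ) z, z ∈ S → F (z + n * (2 * Real.pi * Complex.I)) = F z := by
    intro n
    induction n with
    | zero => intro z _; simp
    | succ n ih =>
      intro z hz
      have h1 := hF1 _ (by simpa using hSp n z hz)
      rw [ih z hz] at h1
      rw [← h1]; congr 1; push_cast; ring
  have hFint : ∀ z w, z ∈ S → w ∈ S → Complex.exp z = Complex.exp w → F z = F w := by
    intro z w hz hw h
    obtain ⟨n, hn⟩ := Complex.exp_eq_exp_iff_exists_int.1 h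
    rcases Int.eq_nat_or_neg n with ⟨k, rfl | rfl⟩
    · rw [hn]; exact_mod_cast hFnat k w hw
    · have : w = z + k * (2 * Real.pi * Complex.I) := by rw [hn]; push_cast; ring
      rw [this]; exact (hFnat k z hz).symm
  have hlog : ∀ z ∈ pball R, Complex.log z ∈ S := fun z hz =>
    (exp_mem_pball hR).1 (by rwa [Complex.exp_log hz.1])
  refine ⟨d, fun z => F (Complex.log z), ?_, ?_⟩
  · intro z hz
    apply ContinuousAt.continuousWithinAt
    have e1 : ∀ᶠ w in 𝓝 z, F (Complex.log w) = F (Complex.log z + Complex.log (w / z)) := by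
      filter_upwards [(isOpen_pball R).mem_nhds hz] with w hw
      have hwz : w / z ≠ 0 := div_ne_zero hw.1 hz.1
      have he : Complex.exp (Complex.log z + Complex.log (w / z)) = w := by
        rw [Complex.exp_add, Complex.exp_log hz.1, Complex.exp_log hwz, mul_div_cancel₀ _ hz.1]
      refine hFint _ _ (hlog w hw) ((exp_mem_pball hR).1 (by rw [he]; exact hw)) ?_
      rw [Complex.exp_log hw.1, he]
    have e2 : ContinuousAt (fun w => F (Complex.log z + Complex.log (w / z))) z := by
      have hFa : ContinuousAt F (Complex.log z + Complex.log (z / z)) := by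
        rw [div_self hz.1, Complex.log_one, add_zero]
        exact hF.continuousAt ((isOpen_lt Complex.continuous_re continuous_const).mem_nhds
          (hlog z hz))
      refine hFa.comp (f := fun w => Complex.log z + Complex.log (w / z)) ?_
      refine continuousAt_const.add (ContinuousAt.clog (by fun_prop) ?_)
      rw [div_self hz.1]; exact Complex.one_mem_slitPlane
    exact e2.congr (e1.mono fun _ h => h.symm)
  · intro z hz
    have h1 := hGe _ (hlog z hz)
    simp only [Function.comp, Complex.exp_log hz.1] at h1
    rw [h1]
    simp only [F, Complex.exp_sub, Complex.exp_int_mul, Complex.exp_log hz.1]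
    field_simp [zpow_ne_zero d hz.1]

theorem zpow_eq_exp {R : ℝ} (hR : 0 < R) {k : ℤ} {g : ℂ → ℂ} (hg : ContinuousOn g (pball R))
    (h : ∀ z ∈ pball R, z ^ k = Complex.exp (g z)) : k = 0 := by
  let S : Set ℂ := {z | z.re < Real.log R}
  have hSc : Convex ℝ S := convex_halfSpace_re_lt _
  have hSe : MapsTo Complex.exp S (pball R) := fun z hz => (exp_mem_pball hR).2 hz
  let c : ℂ := Real.log R - 1
  have hc : c ∈ S := by simp [S, c]
  have hc' : c + (2 * Real.pi * Complex.I) ∈ S := by simp [S, c]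
  have := log_unique (g₁ := fun z => k * z) (g₂ := fun z => g (Complex.exp z))
      hSc.isPreconnected (by fun_prop) (hg.comp Complex.continuous_exp.continuousOn hSe)
      (fun z hz => by rw [Complex.exp_int_mul, h _ (hSe hz)]) hc hc'
  simp only [Complex.exp_add, Complex.exp_two_pi_mul_I, mul_one] at this
  have h2 : (k : ℂ) * (2 * Real.pi * Complex.I) = 0 := by linear_combination -this
  have := (mul_eq_zero.1 h2).resolve_right Complex.two_pi_I_ne_zero
  exact_mod_cast this

/-- A local homeomorphism of the plane fixing the origin has degree `1` or `-1` there. -/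
theorem degree_local_homeo {R R' r : ℝ} (hR' : 0 < R') (hr : 0 < r)
    {h h' : ℂ → ℂ} (hc : ContinuousOn h (pball R)) (hc' : ContinuousOn h' (pball R'))
    (h0 : ∀ z ∈ pball R, h z ≠ 0) (h0' : ∀ z ∈ pball R', h' z ≠ 0) (hR : 0 < R) (hrR : r ≤ R)
    (hm : ∀ z ∈ pball r, h z ∈ pball R' ∧ h' (h z) = z) :
    ∃ (d : ℤ) (g : ℂ → ℂ), (d = 1 ∨ d = -1) ∧ ContinuousOn g (pball R) ∧
      ∀ z ∈ pball R, h z = z ^ d * Complex.exp (g z) := by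
  obtain ⟨d, g, hg, hd⟩ := exists_degree hR hc h0
  obtain ⟨d', g', hg', hd'⟩ := exists_degree hR' hc' h0'
  have hsub : pball r ⊆ pball R := fun z hz => ⟨hz.1, hz.2.trans_le hrR⟩
  refine ⟨d, g, ?_, hg, hd⟩
  have : 1 - d * d' = 0 := by
    refine zpow_eq_exp hr (g := fun z => d' * g z + g' (h z)) ?_ ?_
    · exact (continuousOn_const.mul (hg.mono hsub)).add
        (hg'.comp (hc.mono hsub) fun z hz => (hm z hz).1)
    · intro z hz
      have h1 := hd' _ (hm z hz).1
      rw [(hm z hz).2, hd z (hsub hz), mul_zpow, ← zpow_mul, ← hd z (hsub hz),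
        ← Complex.exp_int_mul, mul_assoc, ← Complex.exp_add] at h1
      rw [zpow_sub₀ hz.1, zpow_one]
      nth_rewrite 1 [h1]
      field_simp [zpow_ne_zero (d * d') hz.1]
  have : d * d' = 1 := by linarith
  rcases Int.eq_one_or_neg_one_of_mul_eq_one this with h | h <;> simp [h]

/-! ### Patches -/

/-- The closed upper half plane of `ℂ`. -/
def cHalf : Set ℂ := {z | 0 ≤ z.im}

/-- The part of the closed unit disc lying in `S`. -/
def pdisc (S : Set ℂ) : Set ℂ := closedBall 0 1 ∩ S

/-- A patch: an embedding of `pdisc S` (a disc or a half disc) whose interior is open. -/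
structure IsPatch {X : Type*} [TopologicalSpace X] (S : Set ℂ) (k : ℂ → X) : Prop where
  closed : IsClosed S
  cont : ContinuousOn k (pdisc S)
  inj : InjOn k (pdisc S)
  opn : ∀ B : Set ℂ, IsOpen B → B ⊆ ball 0 1 → IsOpen (k '' (B ∩ S))

/-- An affine map from `ℂ` to `ℝ × ℝ`. -/
def planeMap (p : ℝ × ℝ) (r : ℝ) (z : ℂ) : ℝ × ℝ := (p.1 + r * z.re, p.2 + r * z.im)

theorem exists_patch {X Y : Type*} [TopologicalSpace X] [TopologicalSpace Y]
    {ι : Y → ℝ × ℝ} (hι : IsEmbedding ι) {U : Set X} (hU : IsOpen U) {V : Set Y} (hV : IsOpen V)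
    (φ : U ≃ₜ V) {x : X} (hx : x ∈ U) {O : Set X} (hO : IsOpen O) (hxO : x ∈ O) {S : Set ℂ}
    (hSc : IsClosed S) (h0 : (0 : ℂ) ∈ S)
    (hS : ∀ᶠ r in 𝓝[>] (0 : ℝ), ∀ z ∈ closedBall (0 : ℂ) 1,
      planeMap (ι (φ ⟨x, hx⟩)) r z ∈ range ι ↔ z ∈ S) :
    ∃ k : ℂ → X, IsPatch S k ∧ k 0 = x ∧ k '' pdisc S ⊆ O := by
  classical
  let p : ℝ × ℝ := ι (φ ⟨x, hx⟩)
  have hp : p = ι (φ ⟨x, hx⟩) := rfl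
  rw [← hp] at hS
  let j : V → ℝ × ℝ := fun v => ι v
  have hj : IsEmbedding j := hι.comp IsEmbedding.subtypeVal
  obtain ⟨W₁, hW₁, hW₁V⟩ := (hι.isOpen_iff).1 hV
  have hO' : IsOpen {v : V | ((φ.symm v : U) : X) ∈ O} :=
    hO.preimage (continuous_subtype_val.comp φ.symm.continuous)
  obtain ⟨W₂, hW₂, hW₂V⟩ := hj.isOpen_iff.1 hO'
  have hpW : p ∈ W₁ ∩ W₂ := by
    constructor
    · have : ((φ ⟨x, hx⟩ : V) : Y) ∈ ι ⁻¹' W₁ := hW₁V ▸ (φ ⟨x, hx⟩).2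
      exact this
    · have : (φ ⟨x, hx⟩ : V) ∈ j ⁻¹' W₂ := by rw [hW₂V]; simpa using hxO
      exact this
  have hW : ∀ᶠ r in 𝓝[>] (0 : ℝ), ∀ z ∈ closedBall (0 : ℂ) 1, planeMap p r z ∈ W₁ ∩ W₂ := by
    obtain ⟨ε, hε, hb⟩ := Metric.isOpen_iff.1 (hW₁.inter hW₂) p hpW
    have : ∀ᶠ r in 𝓝[>] (0 : ℝ), r < ε := nhdsWithin_le_nhds (gt_mem_nhds hε)
    filter_upwards [this, self_mem_nhdsWithin] with r hr hr0 z hz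
    apply hb
    simp only [mem_Ioi] at hr0
    have hz1 : ‖z‖ ≤ 1 := by simpa using hz
    have h1 : |z.re| ≤ 1 := (Complex.abs_re_le_norm z).trans hz1
    have h2 : |z.im| ≤ 1 := (Complex.abs_im_le_norm z).trans hz1
    rw [mem_ball, Prod.dist_eq, max_lt_iff, Real.dist_eq, Real.dist_eq]
    simp only [planeMap, add_sub_cancel_left, abs_mul, abs_of_pos hr0]
    constructor <;> nlinarith
  obtain ⟨r, ⟨hSr, hWr⟩, hr0⟩ := ((hS.and hW).and self_mem_nhdsWithin).exists
  replace hr0 : 0 < r := by simpa using hr0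
  have hA : Continuous (planeMap p r) := by unfold planeMap; fun_prop
  let A' : ℝ × ℝ → ℂ := fun q => ⟨(q.1 - p.1) / r, (q.2 - p.2) / r⟩
  have hA' : Continuous A' := by
    have : A' = fun q => Complex.equivRealProdCLM.symm ((q.1 - p.1) / r, (q.2 - p.2) / r) := by
      funext q; apply Complex.ext <;> simp [A']
    rw [this]
    exact Complex.equivRealProdCLM.symm.continuous.comp (by fun_prop)
  have hA'A : ∀ z, A' (planeMap p r z) = z := by
    intro z; apply Complex.ext <;> simp [A', planeMap] <;> field_simp
  have hAA' : ∀ q, planeMap p r (A' q) = q := by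
    intro z; apply Prod.ext <;> simp [A', planeMap] <;> field_simp <;> ring
  have hex : ∀ z : pdisc S, ∃ v : V, j v = planeMap p r z := by
    rintro ⟨z, hz, hzS⟩
    obtain ⟨y, hy⟩ := (hSr z hz).2 hzS
    have : y ∈ V := by rw [← hW₁V]; rw [mem_preimage, hy]; exact (hWr z hz).1
    exact ⟨⟨y, this⟩, hy⟩
  choose l hl using hex
  have hlc : Continuous l := by
    rw [hj.continuous_iff]
    have : j ∘ l = fun z : pdisc S => planeMap p r z := funext hl
    rw [this]; exact hA.comp continuous_subtype_val
  let k : ℂ → X := fun z => if hz : z ∈ pdisc S then (φ.symm (l ⟨z, hz⟩) : U) else x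
  have hk : ∀ z (hz : z ∈ pdisc S), k z = (φ.symm (l ⟨z, hz⟩) : U) := fun z hz => by
    simp only [k, dif_pos hz]
  have h0S : (0 : ℂ) ∈ pdisc S := ⟨by simp, h0⟩
  refine ⟨k, ⟨hSc, ?_, ?_, ?_⟩, ?_, ?_⟩
  · rw [continuousOn_iff_continuous_domRestrict]
    have : Continuous fun z : pdisc S => ((φ.symm (l z) : U) : X) :=
      continuous_subtype_val.comp (φ.symm.continuous.comp hlc)
    refine this.congr fun z => ?_
    exact (hk z z.2).symm
  · intro z hz w hw h
    rw [hk z hz, hk w hw] at h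
    have h1 := φ.symm.injective (Subtype.ext h)
    have h2 := hl ⟨z, hz⟩
    rw [h1, hl] at h2
    simpa [hA'A] using (congr_arg A' h2).symm
  · intro B hB hB1
    have hBS : ∀ z ∈ B ∩ S, z ∈ pdisc S := fun z hz => ⟨ball_subset_closedBall (hB1 hz.1), hz.2⟩
    have : k '' (B ∩ S) = Subtype.val '' (φ ⁻¹' {v : V | A' (j v) ∈ B}) := by
      ext y
      constructor
      · rintro ⟨z, hz, rfl⟩
        rw [hk z (hBS z hz)]
        refine ⟨_, ?_, rfl⟩
        simp [hl, hA'A, hz.1]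
      · rintro ⟨u, hu, rfl⟩
        simp only [mem_preimage, mem_ofPred_eq] at hu
        have hzS : A' (j (φ u)) ∈ S := by
          rw [← hSr _ (ball_subset_closedBall (hB1 hu)), hAA']
          exact ⟨_, rfl⟩
        refine ⟨A' (j (φ u)), ⟨hu, hzS⟩, ?_⟩
        rw [hk _ (hBS _ ⟨hu, hzS⟩)]
        congr 1
        rw [φ.symm_apply_eq]
        apply hj.injective
        rw [hl, hAA']
    rw [this]
    refine hU.isOpenMap_subtype_val _ ?_
    exact (hB.preimage (hA'.comp hj.continuous)).preimage φ.continuous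
  · rw [hk 0 h0S]
    have : l ⟨0, h0S⟩ = φ ⟨x, hx⟩ := by
      apply hj.injective
      rw [hl]; simp [planeMap, j, hp]
    rw [this]; simp
  · rintro _ ⟨z, hz, rfl⟩
    rw [hk z hz]
    have : l ⟨z, hz⟩ ∈ j ⁻¹' W₂ := by rw [mem_preimage, hl]; exact (hWr z hz.1).2
    rw [hW₂V] at this
    exact this

namespace IsPatch

variable {X : Type*} [TopologicalSpace X] {S : Set ℂ} {k : ℂ → X}

theorem isCompact_pdisc (hS : IsClosed S) : IsCompact (pdisc S) :=
  (isCompact_closedBall 0 1).inter_right hS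

theorem isCompact_image (h : IsPatch S k) : IsCompact (k '' pdisc S) :=
  (isCompact_pdisc h.closed).image_of_continuousOn h.cont

theorem exists_inv [T2Space X] (h : IsPatch S k) :
    ∃ k' : X → ℂ, ContinuousOn k' (k '' pdisc S) ∧ ∀ z ∈ pdisc S, k' (k z) = z := by
  refine ⟨Function.invFunOn k (pdisc S), ?_, fun z hz => h.inj.leftInvOn_invFunOn hz⟩
  rw [continuousOn_iff_isClosed]
  intro C hC
  refine ⟨k '' (pdisc S ∩ C), ((isCompact_pdisc h.closed).inter_right hC
    |>.image_of_continuousOn (h.cont.mono inter_subset_left)).isClosed, ?_⟩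
  ext x
  constructor
  · rintro ⟨hx, z, hz, rfl⟩
    rw [mem_preimage, h.inj.leftInvOn_invFunOn hz] at hx
    exact ⟨⟨z, ⟨hz, hx⟩, rfl⟩, z, hz, rfl⟩
  · rintro ⟨⟨z, hz, rfl⟩, hx⟩
    refine ⟨?_, hx⟩
    rw [mem_preimage, h.inj.leftInvOn_invFunOn hz.1]
    exact hz.2

theorem isOpen_interior (h : IsPatch S k) : IsOpen (k '' (ball 0 1 ∩ S)) :=
  h.opn _ isOpen_ball Subset.rfl

/-- A planar patch inside a patch. -/
theorem rescale (h : IsPatch S k) {z : ℂ} {δ : ℝ} (hδ : 0 < δ) (hz : closedBall z δ ⊆ ball 0 1)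
    (hzS : closedBall z δ ⊆ S) : IsPatch univ (fun w => k (z + δ * w)) := by
  have hm : ∀ w ∈ closedBall (0 : ℂ) 1, z + δ * w ∈ closedBall z δ := by
    intro w hw
    have : ‖w‖ ≤ 1 := by simpa using hw
    simp only [mem_closedBall, dist_eq_norm, add_sub_cancel_left, norm_mul, Complex.norm_real,
      Real.norm_eq_abs, abs_of_pos hδ]
    nlinarith
  have hδ' : (δ : ℂ) ≠ 0 := by exact_mod_cast hδ.ne'
  refine ⟨isClosed_univ, ?_, ?_, ?_⟩
  · refine h.cont.comp (by fun_prop) fun w hw => ?_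
    have := hm w hw.1
    exact ⟨ball_subset_closedBall (hz this), hzS this⟩
  · intro w hw w' hw' he
    have h1 := hm w hw.1
    have h2 := hm w' hw'.1
    have := h.inj ⟨ball_subset_closedBall (hz h1), hzS h1⟩
      ⟨ball_subset_closedBall (hz h2), hzS h2⟩ he
    have := add_left_cancel this
    exact mul_left_cancel₀ hδ' this
  · intro B hB hB1
    have : (fun w => k (z + δ * w)) '' (B ∩ univ)
        = k '' (((fun w => (w - z) / δ) ⁻¹' B) ∩ S) := by
      ext x
      constructor
      · rintro ⟨w, ⟨hw, -⟩, rfl⟩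
        refine ⟨z + δ * w, ⟨?_, hzS (hm w (ball_subset_closedBall (hB1 hw)))⟩, rfl⟩
        simpa [hδ'] using hw
      · rintro ⟨w, ⟨hw, -⟩, rfl⟩
        refine ⟨_, ⟨hw, trivial⟩, ?_⟩
        simp only
        congr 1
        field_simp
        ring
    rw [this]
    refine h.opn _ (hB.preimage (by fun_prop)) ?_
    intro w hw
    have := hm _ (ball_subset_closedBall (hB1 hw))
    have e : z + δ * ((w - z) / δ) = w := by field_simp; ring
    rw [e] at this
    exact hz this

theorem notMem_boundary (h : IsPatch univ k) : k 0 ∉ surfaceBoundary X := by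
  let V : Set (ℝ × ℝ) := {p | ‖Complex.equivRealProdCLM.symm p‖ < 1}
  have hV : IsOpen V := isOpen_lt (by fun_prop) continuous_const
  let f : V → X := fun p => k (Complex.equivRealProdCLM.symm p)
  have hV1 : ∀ p : V, Complex.equivRealProdCLM.symm p ∈ pdisc univ := fun p =>
    ⟨by simpa using p.2.le, trivial⟩
  have hf : Continuous f := h.cont.comp_continuous (by fun_prop) hV1
  have hfi : Function.Injective f := fun p q hpq => by
    have := h.inj (hV1 p) (hV1 q) hpq
    exact Subtype.ext (Complex.equivRealProdCLM.symm.injective this)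
  have hfo : IsOpenMap f := by
    intro B hB
    have h1 : IsOpen (Subtype.val '' B : Set (ℝ × ℝ)) := hV.isOpenMap_subtype_val _ hB
    have h2 := h.opn (Complex.equivRealProdCLM ⁻¹' (Subtype.val '' B))
      (h1.preimage Complex.equivRealProdCLM.continuous) ?_
    · convert h2 using 1
      ext x
      constructor
      · rintro ⟨p, hp, rfl⟩
        exact ⟨Complex.equivRealProdCLM.symm p, ⟨by simpa using hp, trivial⟩, rfl⟩
      · rintro ⟨z, ⟨⟨p, hp, hpz⟩, -⟩, rfl⟩
        refine ⟨p, hp, ?_⟩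
        simp only [f]
        rw [hpz, ContinuousLinearEquiv.symm_apply_apply]
    · rintro z ⟨p, hp, hpz⟩
      have := p.2
      simp only [V, mem_ofPred_eq] at this
      rw [hpz, ContinuousLinearEquiv.symm_apply_apply] at this
      simpa using this
  have he : IsOpenEmbedding f := .of_continuous_injective_isOpenMap hf hfi hfo
  intro hx
  refine hx ⟨range f, V, he.isOpen_range, ⟨⟨0, by simp [V]⟩, by simp [f]⟩, hV,
    ⟨he.toIsEmbedding.toHomeomorph.symm⟩⟩

theorem starConvex_half (r : ℝ) (hr : 0 < r) :
    StarConvex ℝ (((r / 2 : ℝ) : ℂ) * Complex.I) (pball r ∩ cHalf) := by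
  intro z hz a b ha hb hab
  have him : 0 ≤ z.im := hz.2
  have hn : ‖((r / 2 : ℝ) : ℂ) * Complex.I‖ < r := by
    rw [norm_mul, Complex.norm_I, mul_one, Complex.norm_real, Real.norm_eq_abs,
      abs_of_pos (by positivity)]
    linarith
  have him' : (a • (((r / 2 : ℝ) : ℂ) * Complex.I) + b • z).im = a * (r / 2) + b * z.im := by
    simp
  refine ⟨⟨?_, ?_⟩, ?_⟩
  · intro h0
    rw [h0] at him'
    simp only [Complex.zero_im] at him'
    have h1 : a * (r / 2) = 0 := by nlinarith [mul_nonneg ha hr.le, mul_nonneg hb him]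
    have ha0 : a = 0 := by
      rcases mul_eq_zero.1 h1 with h | h
      · exact h
      · linarith
    have hb1 : b = 1 := by linarith
    rw [ha0, hb1] at h0
    simp at h0
    exact hz.1.1 h0
  · have := convex_ball (0 : ℂ) r (x := ((r / 2 : ℝ) : ℂ) * Complex.I) (by simpa using hn)
      (y := z) (by simpa using hz.1.2) ha hb hab
    simpa using this
  · show 0 ≤ (a • (((r / 2 : ℝ) : ℂ) * Complex.I) + b • z).im
    rw [him']
    have := mul_nonneg ha hr.le
    have := mul_nonneg hb him
    linarith

end IsPatch

theorem isClosed_cHalf : IsClosed cHalf := isClosed_le continuous_const Complex.continuous_im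

/-- Points on the straight side of a half disc patch are not interior points. -/
theorem not_planar_of_half {X : Type*} [TopologicalSpace X] [T2Space X] {k κ : ℂ → X}
    (hk : IsPatch cHalf k) (hκ : IsPatch univ κ) {t : ℝ} (ht : |t| < 1) (h : κ 0 = k t) :
    False := by
  obtain ⟨k', hk'c, hk'⟩ := hk.exists_inv
  obtain ⟨κ', hκ'c, hκ'⟩ := hκ.exists_inv
  have htS : (t : ℂ) ∈ pdisc cHalf := ⟨by simpa using ht.le, by simp [cHalf]⟩
  -- a small half disc mapped into the planar patch
  have hopen : IsOpen (κ '' (ball 0 1 ∩ univ)) := hκ.isOpen_interior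
  have h1 : k ⁻¹' (κ '' (ball 0 1 ∩ univ)) ∈ 𝓝[pdisc cHalf] (t : ℂ) :=
    (hk.cont t htS).preimage_mem_nhdsWithin (hopen.mem_nhds ⟨0, by simp, h⟩)
  obtain ⟨δ, hδ, hδs⟩ := Metric.mem_nhdsWithin_iff.1 h1
  obtain ⟨δ', hδ'0, hδ'δ, hδ'1⟩ : ∃ δ' > 0, δ' ≤ δ ∧ ball (t : ℂ) δ' ⊆ ball 0 1 := by
    refine ⟨min δ (1 - |t|), by simp [hδ, ht], min_le_left _ _, ?_⟩
    apply ball_subset_ball'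
    have := min_le_right δ (1 - |t|)
    simp only [dist_zero_right, Complex.norm_real, Real.norm_eq_abs]
    linarith
  have hsub : ∀ w ∈ ball (0 : ℂ) δ' ∩ cHalf, (t + w) ∈ pdisc cHalf ∧
      ∃ v ∈ ball (0 : ℂ) 1, κ v = k (t + w) := by
    intro w hw
    have hb : (t + w) ∈ ball (t : ℂ) δ' := by simpa using hw.1
    have hp : (t + w) ∈ pdisc cHalf :=
      ⟨ball_subset_closedBall (hδ'1 hb), by simpa [cHalf] using hw.2⟩
    obtain ⟨v, hv, hve⟩ := hδs ⟨ball_subset_ball hδ'δ hb, hp⟩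
    exact ⟨hp, v, hv.1, hve⟩
  have hpb : ∀ w ∈ pball δ' ∩ cHalf, w ∈ ball (0 : ℂ) δ' ∩ cHalf :=
    fun w hw => ⟨by simpa using hw.1.2, hw.2⟩
  -- logarithm on the punctured half disc
  obtain ⟨G, hG, hGe⟩ : HasLogOn (fun w : ℂ => κ' (k (t + w))) (pball δ' ∩ cHalf) := by
    refine .of_starConvex (IsPatch.starConvex_half δ' hδ'0) ?_ ?_ ?_
    · refine ⟨⟨?_, ?_⟩, ?_⟩
      · simp [hδ'0.ne']
      · rw [norm_mul, Complex.norm_I, mul_one, Complex.norm_real, Real.norm_eq_abs,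
          abs_of_pos (by positivity)]
        linarith
      · simpa [cHalf] using (half_pos hδ'0).le
    · refine hκ'c.comp (hk.cont.comp (by fun_prop) fun w hw => (hsub w (hpb w hw)).1) ?_
      intro w hw
      obtain ⟨v, hv, hve⟩ := (hsub w (hpb w hw)).2
      exact ⟨v, ⟨ball_subset_closedBall hv, trivial⟩, hve⟩
    · intro w hw h0
      obtain ⟨hp, v, hv, hve⟩ := hsub w (hpb w hw)
      rw [← hve, hκ' v ⟨ball_subset_closedBall hv, trivial⟩] at h0
      rw [h0, h] at hve
      have := hk.inj htS hp hve
      exact hw.1.1 (by simpa using this)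
  -- transfer to the planar patch
  have hopen2 : IsOpen (k '' (ball (t : ℂ) δ' ∩ cHalf)) := hk.opn _ isOpen_ball hδ'1
  have h2 : κ ⁻¹' (k '' (ball (t : ℂ) δ' ∩ cHalf)) ∈ 𝓝[pdisc univ] (0 : ℂ) :=
    (hκ.cont 0 ⟨by simp, trivial⟩).preimage_mem_nhdsWithin
      (hopen2.mem_nhds ⟨t, ⟨by simp [hδ'0], htS.2⟩, h.symm⟩)
  obtain ⟨r, hr, hrs⟩ := Metric.mem_nhdsWithin_iff.1 h2
  have hr1 : 0 < min r 1 := by simp [hr]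
  have hback : ∀ v ∈ pball (min r 1), v ∈ pdisc univ ∧
      ∃ w ∈ pball δ' ∩ cHalf, k (t + w) = κ v := by
    intro v hv
    have hvp : v ∈ pdisc univ := ⟨by simpa using hv.2.le.trans (min_le_right _ _), trivial⟩
    obtain ⟨w, hw, hwe⟩ := hrs ⟨by simpa using hv.2.trans_le (min_le_left _ _), hvp⟩
    refine ⟨hvp, w - t, ⟨⟨?_, by simpa [dist_eq_norm] using hw.1⟩, by simpa [cHalf] using hw.2⟩,
      by simpa using hwe⟩
    intro h0
    rw [sub_eq_zero] at h0
    rw [h0, ← h] at hwe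
    exact hv.1 (hκ.inj hvp ⟨by simp, trivial⟩ hwe.symm)
  have := zpow_eq_exp hr1 (k := 1) (g := fun v => G (k' (κ v) - t)) ?_ ?_
  · exact one_ne_zero this
  · refine hG.comp ((hk'c.comp (hκ.cont.mono fun v hv => (hback v hv).1) ?_).sub
      continuousOn_const) ?_
    · intro v hv
      obtain ⟨w, hw, hwe⟩ := (hback v hv).2
      exact ⟨_, (hsub w (hpb w hw)).1, hwe⟩
    · intro v hv
      obtain ⟨w, hw, hwe⟩ := (hback v hv).2
      simp only [← hwe, hk' _ (hsub w (hpb w hw)).1]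
      simpa using hw
  · intro v hv
    obtain ⟨hvp, w, hw, hwe⟩ := hback v hv
    have e1 : k' (κ v) - t = w := by rw [← hwe, hk' _ (hsub w (hpb w hw)).1]; ring
    have e2 := hGe w hw
    simp only [hwe, hκ' v hvp] at e2
    rw [e1, ← e2, zpow_one]

theorem exists_planar_patch {X : Type*} [TopologicalSpace X] {x : X} (hx : x ∉ surfaceBoundary X)
    {O : Set X} (hO : IsOpen O) (hxO : x ∈ O) :
    ∃ k : ℂ → X, IsPatch univ k ∧ k 0 = x ∧ k '' pdisc univ ⊆ O := by
  simp only [surfaceBoundary, mem_ofPred_eq, not_not] at hx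
  obtain ⟨U, V, hU, hxU, hV, ⟨φ⟩⟩ := hx
  exact exists_patch IsEmbedding.id hU hV φ hxU hO hxO isClosed_univ trivial
    (Eventually.of_forall fun r z _ => by simp)

theorem mem_boundary_of_half {X : Type*} [TopologicalSpace X] [T2Space X] {k : ℂ → X}
    (hk : IsPatch cHalf k) {t : ℝ} (ht : |t| < 1) : k t ∈ surfaceBoundary X := by
  by_contra h
  obtain ⟨κ, hκ, h0, -⟩ := exists_planar_patch h isOpen_univ trivial
  exact not_planar_of_half hk hκ ht h0

theorem IsPatch.notMem_boundary' {X : Type*} [TopologicalSpace X] {S : Set ℂ} {k : ℂ → X}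
    (hk : IsPatch S k) {z : ℂ} (hz : z ∈ ball (0 : ℂ) 1) (hzS : S ∈ 𝓝 z) :
    k z ∉ surfaceBoundary X := by
  have : ball (0 : ℂ) 1 ∩ S ∈ 𝓝 z := inter_mem (isOpen_ball.mem_nhds hz) hzS
  obtain ⟨δ, hδ, hs⟩ := Metric.nhds_basis_closedBall.mem_iff.1 this
  have := (hk.rescale hδ (hs.trans inter_subset_left) (hs.trans inter_subset_right)).notMem_boundary
  simpa using this

theorem half_mem_boundary_iff {X : Type*} [TopologicalSpace X] [T2Space X] {k : ℂ → X}
    (hk : IsPatch cHalf k) {z : ℂ} (hz : z ∈ ball (0 : ℂ) 1) (hzH : z ∈ cHalf) :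
    k z ∈ surfaceBoundary X ↔ z.im = 0 := by
  constructor
  · intro h
    by_contra h0
    have hpos : 0 < z.im := lt_of_le_of_ne hzH (Ne.symm h0)
    exact hk.notMem_boundary' hz (Filter.mem_of_superset
      ((isOpen_lt continuous_const Complex.continuous_im).mem_nhds hpos)
      (fun w (hw : 0 < w.im) => hw.le)) h
  · intro h
    have e : z = (z.re : ℂ) := by apply Complex.ext <;> simp [h]
    rw [e]
    refine mem_boundary_of_half hk ?_
    exact (Complex.abs_re_le_norm z).trans_lt (by simpa using hz)

theorem exists_half_patch {X : Type*} [TopologicalSpace X] (hX : IsSurface X) {x : X}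
    (hx : x ∈ surfaceBoundary X) {O : Set X} (hO : IsOpen O) (hxO : x ∈ O) :
    ∃ k : ℂ → X, IsPatch cHalf k ∧ k 0 = x ∧ k '' pdisc cHalf ⊆ O := by
  obtain ⟨U, V, hU, hxU, hV, ⟨φ⟩⟩ := hX x
  obtain ⟨p, hp⟩ : ∃ p : HalfPlane, p = φ ⟨x, hxU⟩ := ⟨_, rfl⟩
  have hp0 : 0 ≤ (p : ℝ × ℝ).2 := p.2
  have hran : range (Subtype.val : HalfPlane → ℝ × ℝ) = HalfPlane := Subtype.range_coe
  rw [hp] at hp0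
  rcases hp0.eq_or_lt with h | h
  · refine exists_patch IsEmbedding.subtypeVal hU hV φ hxU hO hxO isClosed_cHalf (by simp [cHalf]) ?_
    filter_upwards [self_mem_nhdsWithin] with r hr z _
    rw [hran]
    have hr' : 0 < r := by simpa using hr
    change 0 ≤ ((φ ⟨x, hxU⟩ : HalfPlane) : ℝ × ℝ).2 + r * z.im ↔ 0 ≤ z.im
    rw [← h, zero_add]
    exact mul_nonneg_iff_of_pos_left hr'
  · exfalso
    obtain ⟨k, hk, hk0, -⟩ := exists_patch IsEmbedding.subtypeVal hU hV φ hxU hO hxO isClosed_univ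
      trivial (by
        have : ∀ᶠ r in 𝓝[>] (0 : ℝ), r < ((φ ⟨x, hxU⟩ : HalfPlane) : ℝ × ℝ).2 := nhdsWithin_le_nhds (gt_mem_nhds h)
        filter_upwards [this, self_mem_nhdsWithin] with r hr hr0 z hz
        rw [hran]
        simp only [mem_univ, iff_true]
        change 0 ≤ ((φ ⟨x, hxU⟩ : HalfPlane) : ℝ × ℝ).2 + r * z.im
        have hz1 : ‖z‖ ≤ 1 := by simpa using hz
        have := (abs_le.1 ((Complex.abs_im_le_norm z).trans hz1)).1
        simp only [mem_Ioi] at hr0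
        nlinarith)
    exact hk.notMem_boundary (hk0 ▸ hx)

open Classical in
/-- Transport of a function on a patch to the surface, extended by `1`. -/
noncomputable def patchExt {X : Type*} (S : Set ℂ) (k : ℂ → X) (u : ℂ → ℂ) (x : X) : ℂ :=
  if x ∈ k '' pdisc S then u (Function.invFunOn k (pdisc S) x) else 1

theorem patchExt_apply {X : Type*} [TopologicalSpace X] {S : Set ℂ} {k : ℂ → X}
    (hk : IsPatch S k) (u : ℂ → ℂ) {z : ℂ} (hz : z ∈ pdisc S) : patchExt S k u (k z) = u z := by
  rw [patchExt, if_pos ⟨z, hz, rfl⟩, hk.inj.leftInvOn_invFunOn hz]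

theorem patchExt_of_notMem {X : Type*} {S : Set ℂ} {k : ℂ → X} (u : ℂ → ℂ) {x : X}
    (hx : x ∉ k '' pdisc S) : patchExt S k u x = 1 := if_neg hx

theorem patchExt_continuousOn {X : Type*} [TopologicalSpace X] [T2Space X] {S : Set ℂ} {k : ℂ → X}
    (hk : IsPatch S k) {u : ℂ → ℂ} {A : Set ℂ}
    (hu : ContinuousOn u (pdisc S \ A)) (hu1 : ∀ z ∈ pdisc S, ‖z‖ = 1 → u z = 1) :
    ContinuousOn (patchExt S k u) (k '' A)ᶜ := by
  obtain ⟨k', hk'c, hk'⟩ := hk.exists_inv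
  have hK : IsClosed (k '' pdisc S) := hk.isCompact_image.isClosed
  have c1 : ContinuousOn (patchExt S k u) (k '' pdisc S \ k '' A) := by
    have : ContinuousOn (u ∘ k') (k '' pdisc S \ k '' A) := by
      refine hu.comp (hk'c.mono sdiff_subset) ?_
      rintro _ ⟨⟨z, hz, rfl⟩, hzA⟩
      rw [hk' z hz]
      exact ⟨hz, fun h => hzA ⟨z, h, rfl⟩⟩
    refine this.congr ?_
    rintro _ ⟨⟨z, hz, rfl⟩, hzA⟩
    rw [patchExt_apply hk u hz, Function.comp, hk' z hz]
  have hL : IsClosed (k '' (ball 0 1 ∩ S))ᶜ := hk.isOpen_interior.isClosed_compl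
  have c2 : ContinuousOn (patchExt S k u) (k '' (ball 0 1 ∩ S))ᶜ := by
    refine (continuousOn_const (c := (1 : ℂ))).congr ?_
    intro x hx
    by_cases h : x ∈ k '' pdisc S
    · obtain ⟨z, hz, rfl⟩ := h
      rw [patchExt_apply hk u hz]
      refine hu1 z hz ?_
      have h1 : ‖z‖ ≤ 1 := by simpa using hz.1
      refine h1.antisymm (not_lt.1 fun h2 => hx ⟨z, ⟨by simpa using h2, hz.2⟩, rfl⟩)
    · exact patchExt_of_notMem u h
  intro x hx
  have w1 : ContinuousWithinAt (patchExt S k u) (k '' pdisc S \ k '' A) x := by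
    by_cases h : x ∈ k '' pdisc S
    · exact c1 x ⟨h, hx⟩
    · exact continuousWithinAt_of_notMem_closure fun hc =>
        h (hK.closure_subset (closure_mono sdiff_subset hc))
  have w2 : ContinuousWithinAt (patchExt S k u) (k '' (ball 0 1 ∩ S))ᶜ x := by
    by_cases h : x ∈ (k '' (ball 0 1 ∩ S))ᶜ
    · exact c2 x h
    · exact continuousWithinAt_of_notMem_closure fun hc => h (hL.closure_subset hc)
  refine (w1.union w2).mono ?_
  intro y hy
  by_cases h : y ∈ k '' pdisc S
  · exact Or.inl ⟨h, hy⟩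
  · refine Or.inr fun h' => h ?_
    obtain ⟨z, hz, rfl⟩ := h'
    exact ⟨z, ⟨ball_subset_closedBall hz.1, hz.2⟩, rfl⟩

/-! ### Local degrees on surfaces -/

/-- `w` is continuous and nonzero at `x`. -/
def Reg {X : Type*} [TopologicalSpace X] (w : X → ℂ) (x : X) : Prop := ContinuousAt w x ∧ w x ≠ 0

/-- `w` has degree `d` around the centre of the patch `k`. -/
def HasDegAt {X : Type*} (w : X → ℂ) (k : ℂ → X) (d : ℤ) : Prop :=
  ∃ R > 0, ∃ g : ℂ → ℂ, ContinuousOn g (pball R) ∧ ∀ z ∈ pball R, w (k z) = z ^ d * Complex.exp (g z)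

section
variable {X : Type*} [TopologicalSpace X]

theorem Reg.mul {w v : X → ℂ} {x : X} (hw : Reg w x) (hv : Reg v x) : Reg (fun y => w y * v y) x :=
  ⟨hw.1.mul hv.1, mul_ne_zero hw.2 hv.2⟩

theorem Reg.zpow {w : X → ℂ} {x : X} (hw : Reg w x) (n : ℤ) : Reg (fun y => w y ^ n) x :=
  ⟨hw.1.zpow₀ n (Or.inl hw.2), zpow_ne_zero n hw.2⟩

theorem Reg.congr {w v : X → ℂ} {x : X} (hw : Reg w x) (h : v =ᶠ[𝓝 x] w) : Reg v x :=
  ⟨hw.1.congr h.symm, by rw [h.self_of_nhds]; exact hw.2⟩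

theorem HasDegAt.mono_radius {w : X → ℂ} {k : ℂ → X} {d : ℤ} (h : HasDegAt w k d) {r : ℝ} (hr : 0 < r) :
    ∃ R > 0, R ≤ r ∧ ∃ g : ℂ → ℂ, ContinuousOn g (pball R) ∧
      ∀ z ∈ pball R, w (k z) = z ^ d * Complex.exp (g z) := by
  obtain ⟨R, hR, g, hg, h⟩ := h
  have hs : pball (min R r) ⊆ pball R := fun z hz => ⟨hz.1, hz.2.trans_le (min_le_left _ _)⟩
  exact ⟨min R r, lt_min hR hr, min_le_right _ _, g, hg.mono hs, fun z hz => h z (hs hz)⟩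

theorem HasDegAt.mul {w v : X → ℂ} {k : ℂ → X} {d e : ℤ} (hw : HasDegAt w k d) (hv : HasDegAt v k e) :
    HasDegAt (fun y => w y * v y) k (d + e) := by
  obtain ⟨R, hR, g, hg, h⟩ := hv
  obtain ⟨R', hR', hle, g', hg', h'⟩ := hw.mono_radius hR
  have hs : pball R' ⊆ pball R := fun z hz => ⟨hz.1, hz.2.trans_le hle⟩
  refine ⟨R', hR', fun z => g' z + g z, hg'.add (hg.mono hs), fun z hz => ?_⟩
  simp only [h z (hs hz), h' z hz, zpow_add₀ hz.1, Complex.exp_add]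
  ring

theorem HasDegAt.zpow {w : X → ℂ} {k : ℂ → X} {d : ℤ} (hw : HasDegAt w k d) (n : ℤ) :
    HasDegAt (fun y => w y ^ n) k (d * n) := by
  obtain ⟨R, hR, g, hg, h⟩ := hw
  refine ⟨R, hR, fun z => n * g z, continuousOn_const.mul hg, fun z hz => ?_⟩
  simp only [h z hz, mul_zpow, zpow_mul, Complex.exp_int_mul]

theorem HasDegAt.of_eq {w : X → ℂ} {k : ℂ → X} {d : ℤ} {f : ℂ → ℂ} {R : ℝ} (hR : 0 < R)
    (hf : ContinuousOn f (ball 0 R)) (h0 : ∀ z ∈ ball (0 : ℂ) R, f z ≠ 0)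
    (h : ∀ z ∈ pball R, w (k z) = z ^ d * f z) : HasDegAt w k d := by
  obtain ⟨g, hg, hgf⟩ := HasLogOn.of_convex (convex_ball 0 R) hf h0
  have hs : pball R ⊆ ball 0 R := fun z hz => by simpa using hz.2
  exact ⟨R, hR, g, hg.mono hs, fun z hz => by rw [h z hz, hgf z (hs hz)]⟩

theorem IsPatch.continuousAt {k : ℂ → X} (hk : IsPatch univ k) {z : ℂ} (hz : z ∈ ball (0 : ℂ) 1) :
    ContinuousAt k z :=
  hk.cont.continuousAt (by
    rw [pdisc, inter_univ]; exact Filter.mem_of_superset (isOpen_ball.mem_nhds hz) ball_subset_closedBall)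

theorem HasDegAt.congr {w v : X → ℂ} {k : ℂ → X} {d : ℤ} (hk : IsPatch univ k) (hw : HasDegAt w k d)
    (h : v =ᶠ[𝓝 (k 0)] w) : HasDegAt v k d := by
  have := (hk.continuousAt (mem_ball_self one_pos)).eventually h
  obtain ⟨r, hr, hb⟩ := Metric.eventually_nhds_iff_ball.1 this
  obtain ⟨R', hR', hle, g', hg', h'⟩ := hw.mono_radius hr
  refine ⟨R', hR', g', hg', fun z hz => ?_⟩
  rw [← h' z hz]
  exact hb z (by simpa using hz.2.trans_le hle)

theorem Reg.hasDegAt {w : X → ℂ} {k : ℂ → X} (hk : IsPatch univ k)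
    (h : ∀ᶠ x in 𝓝 (k 0), Reg w x) : HasDegAt w k 0 := by
  have := (hk.continuousAt (mem_ball_self one_pos)).eventually h
  obtain ⟨r, hr, hb⟩ := Metric.eventually_nhds_iff_ball.1 this
  have hs1 : ball (0 : ℂ) (min r 1) ⊆ ball 0 r := ball_subset_ball (min_le_left _ _)
  have hs2 : ball (0 : ℂ) (min r 1) ⊆ ball 0 1 := ball_subset_ball (min_le_right _ _)
  refine .of_eq (f := fun z => w (k z)) (lt_min hr one_pos) ?_ ?_ (by simp)
  · intro z hz
    exact (ContinuousAt.comp (f := k) (g := w) (hb z (hs1 hz)).1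
      (hk.continuousAt (hs2 hz))).continuousWithinAt
  · exact fun z hz => (hb z (hs1 hz)).2

theorem HasDegAt.change_patch [T2Space X] {w : X → ℂ} {k k' : ℂ → X} {d : ℤ} (hk : IsPatch univ k)
    (hk' : IsPatch univ k') (h0 : k 0 = k' 0) (hw : HasDegAt w k d) :
    ∃ d', (d' = d ∨ d' = -d) ∧ HasDegAt w k' d' := by
  obtain ⟨i, hic, hi⟩ := hk.exists_inv
  obtain ⟨i', hic', hi'⟩ := hk'.exists_inv
  have hpd : pdisc univ = closedBall (0 : ℂ) 1 := by simp [pdisc]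
  have hop : ∀ {κ : ℂ → X}, IsPatch univ κ → ∀ {r : ℝ}, r ≤ 1 → IsOpen (κ '' ball 0 r) := by
    intro κ hκ r hr
    simpa using hκ.opn (ball 0 r) isOpen_ball (ball_subset_ball hr)
  have hO' : k' '' ball 0 1 ∈ 𝓝 (k 0) :=
    (hop hk' le_rfl).mem_nhds ⟨0, mem_ball_self one_pos, h0.symm⟩
  obtain ⟨r', hr', hb'⟩ := Metric.mem_nhds_iff.1
    ((hk.continuousAt (mem_ball_self one_pos)).preimage_mem_nhds hO')
  obtain ⟨R, hR, hRle, g, hg, hd⟩ := hw.mono_radius (lt_min hr' one_pos)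
  have hR1 : R ≤ 1 := hRle.trans (min_le_right _ _)
  have hRr' : R ≤ r' := hRle.trans (min_le_left _ _)
  have hO : k '' ball 0 R ∈ 𝓝 (k' 0) :=
    (hop hk hR1).mem_nhds ⟨0, mem_ball_self hR, h0⟩
  obtain ⟨r₀, hr₀, hb₀⟩ := Metric.mem_nhds_iff.1
    ((hk'.continuousAt (mem_ball_self one_pos)).preimage_mem_nhds hO)
  obtain ⟨r, hr, hr1, hb⟩ : ∃ r > 0, r ≤ 1 ∧ ball 0 r ⊆ k' ⁻¹' (k '' ball 0 R) :=
    ⟨min r₀ 1, lt_min hr₀ one_pos, min_le_right _ _, (ball_subset_ball (min_le_left _ _)).trans hb₀⟩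
  have mk : ∀ {z : ℂ} {s : ℝ}, s ≤ 1 → z ∈ ball (0 : ℂ) s → z ∈ pdisc univ := fun hs hz => by
    rw [hpd]; exact ball_subset_closedBall (ball_subset_ball hs hz)
  have pb : ∀ {z : ℂ} {s : ℝ}, z ∈ pball s → z ∈ ball (0 : ℂ) s := fun hz => by simpa using hz.2
  have hki : ∀ z ∈ ball (0 : ℂ) r, i (k' z) ∈ ball (0 : ℂ) R ∧ k (i (k' z)) = k' z := by
    intro z hz
    obtain ⟨y, hy, hyz⟩ := hb hz
    rw [← hyz, hi y (mk hR1 hy)]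
    exact ⟨hy, rfl⟩
  have hm : ∀ z ∈ pball r, i (k' z) ∈ pball R ∧ i' (k (i (k' z))) = z := by
    intro z hz
    obtain ⟨h1, h2⟩ := hki z (pb hz)
    refine ⟨⟨fun h => ?_, by simpa using h1⟩, ?_⟩
    · rw [h, h0] at h2
      exact hz.1 (hk'.inj (mk le_rfl (mem_ball_self one_pos)) (mk hr1 (pb hz)) h2).symm
    · rw [h2, hi' z (mk hr1 (pb hz))]
  have hc : ContinuousOn (fun z => i (k' z)) (pball r) := by
    refine hic.comp (hk'.cont.mono fun z hz => mk hr1 (pb hz)) fun z hz => ?_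
    obtain ⟨y, hy, hyz⟩ := hb (pb hz)
    exact ⟨y, mk hR1 hy, hyz⟩
  have hc' : ContinuousOn (fun z => i' (k z)) (pball R) := by
    refine hic'.comp (hk.cont.mono fun z hz => mk hR1 (pb hz)) fun z hz => ?_
    obtain ⟨y, hy, hyz⟩ := hb' (ball_subset_ball hRr' (pb hz))
    exact ⟨y, mk le_rfl hy, hyz⟩
  obtain ⟨e, g₁, he, hg₁, hhe⟩ := degree_local_homeo hR hr hc hc' (fun z hz => (hm z hz).1.1)
    (by
      intro z hz h
      obtain ⟨y, hy, hyz⟩ := hb' (ball_subset_ball hRr' (pb hz))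
      rw [← hyz, hi' y (mk le_rfl hy)] at h
      rw [h, ← h0] at hyz
      exact hz.1 (hk.inj (mk le_rfl (mem_ball_self one_pos)) (mk hR1 (pb hz)) hyz).symm)
    hr le_rfl (fun z hz => hm z hz)
  refine ⟨e * d, by rcases he with rfl | rfl <;> simp, r, hr, fun z => d * g₁ z + g (i (k' z)),
    (continuousOn_const.mul hg₁).add (hg.comp hc fun z hz => (hm z hz).1), fun z hz => ?_⟩
  have := hd _ (hm z hz).1
  rw [(hki z (pb hz)).2, hhe z hz, mul_zpow, ← zpow_mul, ← Complex.exp_int_mul] at this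
  rw [this, Complex.exp_add, hhe z hz]
  ring

/-- A singularity of degree zero can be removed. -/
theorem HasDegAt.fill [T2Space X] {w : X → ℂ} {k : ℂ → X} (hk : IsPatch univ k) (hw : HasDegAt w k 0)
    {O : Set X} (hO : IsOpen O) (hkO : k 0 ∈ O) :
    ∃ w' : X → ℂ, (∀ x ∉ O, w' x = w x) ∧ (∀ x ∈ surfaceBoundary X, w' x = w x) ∧ Reg w' (k 0) ∧
      (∀ x, Reg w x → Reg w' x) ∧
      ∃ C : Set X, IsClosed C ∧ C ⊆ O ∧ ∀ x ∉ C, w' x = w x := by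
  classical
  obtain ⟨r₀, hr₀, hb⟩ := Metric.mem_nhds_iff.1
    ((hk.continuousAt (mem_ball_self one_pos)).preimage_mem_nhds (hO.mem_nhds hkO))
  obtain ⟨R, hR, hRle, g, hg, hd⟩ := hw.mono_radius (lt_min hr₀ one_pos)
  have hR1 : R ≤ 1 := hRle.trans (min_le_right _ _)
  have hRr : R ≤ r₀ := hRle.trans (min_le_left _ _)
  obtain ⟨i, hic, hi⟩ := hk.exists_inv
  have hpd : pdisc univ = closedBall (0 : ℂ) 1 := by simp [pdisc]
  have hB : IsOpen (k '' ball 0 R) := by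
    simpa using hk.opn (ball 0 R) isOpen_ball (ball_subset_ball hR1)
  have mk : ∀ {z : ℂ}, z ∈ ball (0 : ℂ) R → z ∈ pdisc univ := fun hz => by
    rw [hpd]; exact ball_subset_closedBall (ball_subset_ball hR1 hz)
  let χ : ℂ → ℝ := fun z => max 0 (min 1 (4 * ‖z‖ / R - 1))
  have hχ : Continuous χ := by fun_prop
  let G : ℂ → ℂ := fun z => χ z * g z
  have hG : ContinuousOn G (ball 0 R) := by
    intro z hz
    by_cases hz0 : z = 0
    · have : G =ᶠ[𝓝 z] fun _ => 0 := by
        have : ∀ᶠ y in 𝓝 z, ‖y‖ < R / 4 :=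
          (continuous_norm.continuousAt).eventually (gt_mem_nhds (by simp [hz0]; positivity))
        filter_upwards [this] with y hy
        have h1 : 4 * ‖y‖ / R - 1 ≤ 0 := by
          rw [sub_nonpos, div_le_one hR]; linarith
        simp [G, χ, h1]
      exact (continuousAt_const.congr this.symm).continuousWithinAt
    · have hz' : z ∈ pball R := ⟨hz0, by simpa using hz⟩
      exact ((Complex.continuous_ofReal.comp hχ).continuousAt.mul
        (hg.continuousAt ((isOpen_pball R).mem_nhds hz'))).continuousWithinAt
  let w' : X → ℂ := fun x => if x ∈ k '' ball 0 R then Complex.exp (G (i x)) else w x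
  have hw'k : ∀ z ∈ ball (0 : ℂ) R, w' (k z) = Complex.exp (G z) := by
    intro z hz
    simp only [w']
    rw [if_pos ⟨z, hz, rfl⟩, hi z (mk hz)]
  have hreg : ∀ x ∈ k '' ball 0 R, Reg w' x := by
    intro x hx
    have hc : ContinuousOn (fun x => Complex.exp (G (i x))) (k '' ball 0 R) := by
      refine Complex.continuous_exp.comp_continuousOn (hG.comp (hic.mono (image_mono fun z hz => mk hz)) ?_)
      rintro _ ⟨z, hz, rfl⟩
      rwa [hi z (mk hz)]
    have h1 := hc.continuousAt (hB.mem_nhds hx)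
    refine Reg.congr (w := fun x => Complex.exp (G (i x))) ⟨h1, Complex.exp_ne_zero _⟩ ?_
    filter_upwards [hB.mem_nhds hx] with y hy
    simp only [w']
    rw [if_pos hy]
  have hC : IsClosed (k '' closedBall 0 (R / 2)) :=
    ((isCompact_closedBall _ _).image_of_continuousOn (hk.cont.mono (fun z hz => mk (by
      have : ‖z‖ ≤ R / 2 := by simpa using hz
      simp; linarith)))).isClosed
  have hw'w : ∀ x ∉ k '' closedBall 0 (R / 2), w' x = w x := by
    intro x hx
    by_cases hxB : x ∈ k '' ball 0 R
    · obtain ⟨z, hz, rfl⟩ := hxB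
      have hz2 : R / 2 < ‖z‖ := by
        by_contra h
        exact hx ⟨z, by simpa using not_lt.1 h, rfl⟩
      have hz0 : z ≠ 0 := by
        rintro rfl
        simp at hz2; linarith
      rw [hw'k z hz, hd z ⟨hz0, by simpa using hz⟩]
      have h1 : 1 ≤ 4 * ‖z‖ / R - 1 := by
        rw [le_sub_iff_add_le, le_div_iff₀ hR]; linarith
      simp [G, χ, h1]
    · simp only [w']
      rw [if_neg hxB]
  have hall : ∀ x, Reg w x → Reg w' x := by
    intro x hx
    by_cases hxC : x ∈ k '' closedBall 0 (R / 2)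
    · refine hreg x ?_
      obtain ⟨z, hz, rfl⟩ := hxC
      refine ⟨z, ?_, rfl⟩
      have : ‖z‖ ≤ R / 2 := by simpa using hz
      simp; linarith
    · refine hx.congr ?_
      filter_upwards [hC.isOpen_compl.mem_nhds hxC] with y hy using hw'w y hy
  have hCO : k '' closedBall 0 (R / 2) ⊆ O := by
    rintro _ ⟨z, hz, rfl⟩
    have : ‖z‖ ≤ R / 2 := by simpa using hz
    exact hb (by simp; linarith)
  refine ⟨w', fun x hx => hw'w x fun h => hx (hCO h), fun x hx => hw'w x ?_,
    hreg _ ⟨0, mem_ball_self hR, rfl⟩, hall, _, hC, hCO, hw'w⟩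
  rintro ⟨z, hz, rfl⟩
  have : ‖z‖ ≤ R / 2 := by simpa using hz
  exact hk.notMem_boundary' (by simp; linarith) univ_mem hx

end

/-! ### Moving zeros -/

/-- A cutoff: `1` on the half disc, `0` on the unit circle. -/
noncomputable def cutoff (z : ℂ) : ℝ := min 1 (2 - 2 * ‖z‖)

theorem continuous_cutoff : Continuous cutoff := by unfold cutoff; fun_prop

theorem cutoff_of_le {z : ℂ} (h : ‖z‖ ≤ 1 / 2) : cutoff z = 1 := min_eq_left (by linarith)

theorem cutoff_of_eq {z : ℂ} (h : ‖z‖ = 1) : cutoff z = 0 := by simp [cutoff, h]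

theorem cutoff_nonneg {z : ℂ} (h : ‖z‖ ≤ 1) : 0 ≤ cutoff z := le_min zero_le_one (by linarith)

theorem cutoff_le {z : ℂ} : cutoff z ≤ 1 := min_le_left _ _

/-- The shifted coordinate `z - ζ`, deformed to `z` at the unit circle. -/
noncomputable def shift (ζ z : ℂ) : ℂ := z - ζ * cutoff z

theorem continuous_shift (ζ : ℂ) : Continuous (shift ζ) := by
  have := continuous_cutoff
  unfold shift; fun_prop

theorem shift_ne_zero {ζ z : ℂ} (hζ : ‖ζ‖ < 1 / 2) (hz : ‖z‖ ≤ 1) (hne : z ≠ ζ) : shift ζ z ≠ 0 := by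
  intro h
  have h1 : z = ζ * cutoff z := sub_eq_zero.1 h
  have h2 : ‖z‖ = ‖ζ‖ * cutoff z := by
    conv_lhs => rw [h1]
    rw [norm_mul, Complex.norm_real, Real.norm_of_nonneg (cutoff_nonneg hz)]
  have h3 : ‖z‖ ≤ 1 / 2 := by nlinarith [cutoff_le (z := z), norm_nonneg ζ]
  rw [cutoff_of_le h3] at h1
  exact hne (by simpa using h1)

theorem shift_of_le {ζ z : ℂ} (hz : ‖z‖ ≤ 1 / 2) : shift ζ z = z - ζ := by
  simp [shift, cutoff_of_le hz]

theorem shift_of_eq {ζ z : ℂ} (hz : ‖z‖ = 1) : shift ζ z = z := by simp [shift, cutoff_of_eq hz]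

/-- The deformed Cayley transform on the half disc. -/
noncomputable def cay (z : ℂ) : ℂ := shift (Complex.I / 4) z / shift (-Complex.I / 4) z

theorem cay_den {z : ℂ} (hz : ‖z‖ ≤ 1) (hz' : z ∈ cHalf) : shift (-Complex.I / 4) z ≠ 0 := by
  refine shift_ne_zero (by simp; norm_num) hz ?_
  rintro rfl
  have : (0 : ℝ) ≤ (-Complex.I / 4).im := hz'
  norm_num at this

theorem cay_of_eq {z : ℂ} (hz : ‖z‖ = 1) : cay z = 1 := by
  have : z ≠ 0 := by rintro rfl; simp at hz
  rw [cay, shift_of_eq hz, shift_of_eq hz, div_self this]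

section
variable {X : Type*} [TopologicalSpace X]

theorem patchExt_reg [T2Space X] {S : Set ℂ} {k : ℂ → X} (hk : IsPatch S k) {u : ℂ → ℂ} {A : Set ℂ}
    (hA : A.Finite) (hu : ContinuousOn u (pdisc S \ A)) (hu0 : ∀ z ∈ pdisc S, z ∉ A → u z ≠ 0)
    (hu1 : ∀ z ∈ pdisc S, ‖z‖ = 1 → u z = 1) {x : X} (hx : x ∉ k '' A) :
    Reg (patchExt S k u) x := by
  refine ⟨(patchExt_continuousOn hk hu hu1).continuousAt ((hA.image k).isClosed.isOpen_compl.mem_nhds hx), ?_⟩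
  by_cases h : x ∈ k '' pdisc S
  · obtain ⟨z, hz, rfl⟩ := h
    rw [patchExt_apply hk u hz]
    exact hu0 z hz fun h => hx ⟨z, h, rfl⟩
  · rw [patchExt_of_notMem u h]; exact one_ne_zero

/-- The boundary data `B` extends to a function which is `1` off `G` and has a single zero or pole,
at `p`. -/
def Reach (G : Set X) (B : X → ℂ) (p : X) : Prop :=
  ∃ w : X → ℂ, (∀ x, x ≠ p → Reg w x) ∧ (∀ x ∉ G, w x = 1) ∧ (∀ x ∈ surfaceBoundary X, w x = B x) ∧
    ∃ (k : ℂ → X) (d : ℤ), IsPatch univ k ∧ k 0 = p ∧ (d = 1 ∨ d = -1) ∧ HasDegAt w k d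

theorem patchExt_hasDegAt [T2Space X] {S : Set ℂ} {k : ℂ → X} (hk : IsPatch S k) {u f : ℂ → ℂ} {ζ : ℂ} {δ : ℝ}
    (hδ : 0 < δ) (hs : closedBall ζ δ ⊆ ball 0 1) (hsS : closedBall ζ δ ⊆ S) {d : ℤ}
    {r : ℝ} (hr : 0 < r) (hr1 : r ≤ 1)
    (hf : ContinuousOn f (ball 0 r)) (hf0 : ∀ z ∈ ball (0 : ℂ) r, f z ≠ 0)
    (h : ∀ z ∈ pball r, u (ζ + δ * z) = z ^ d * f z) :
    HasDegAt (patchExt S k u) (fun z => k (ζ + δ * z)) d := by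
  refine .of_eq hr hf hf0 fun z hz => ?_
  rw [patchExt_apply hk, h z hz]
  have : ζ + δ * z ∈ closedBall ζ δ := by
    simp only [mem_closedBall, dist_eq_norm, add_sub_cancel_left, norm_mul, Complex.norm_real,
      Real.norm_eq_abs, abs_of_pos hδ]
    nlinarith [hz.2]
  exact ⟨ball_subset_closedBall (hs this), hsS this⟩

theorem Reach.move [T2Space X] {G : Set X} {B : X → ℂ} {K : ℂ → X} (hK : IsPatch univ K)
    (hKG : K '' pdisc univ ⊆ G) (hG : IsOpen G) {ζ ζ' : ℂ} (hζ : ‖ζ‖ < 1 / 2) (hζ' : ‖ζ'‖ < 1 / 2)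
    (h : Reach G B (K ζ)) : Reach G B (K ζ') := by
  by_cases hne : ζ = ζ'
  · rwa [← hne]
  obtain ⟨w, hwr, hwG, hwB, k, d, hk, hkp, hd, hwd⟩ := h
  obtain ⟨δ, hδ, hδζ, hδζ', hδn⟩ : ∃ δ : ℝ, 0 < δ ∧ ‖ζ‖ + δ < 1 / 2 ∧ ‖ζ'‖ + δ < 1 / 2 ∧ δ < ‖ζ - ζ'‖ := by
    have h1 : 0 < ‖ζ - ζ'‖ := norm_pos_iff.2 (sub_ne_zero.2 hne)
    obtain ⟨δ, hδ, hlt⟩ := exists_between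
      (show 0 < min (min (1 / 2 - ‖ζ‖) (1 / 2 - ‖ζ'‖)) ‖ζ - ζ'‖ from
        lt_min (lt_min (by linarith) (by linarith)) h1)
    simp only [lt_min_iff] at hlt
    exact ⟨δ, hδ, by linarith, by linarith, hlt.2⟩
  have hball : ∀ {a : ℂ}, ‖a‖ + δ < 1 / 2 → ∀ z ∈ closedBall a δ, ‖z‖ < 1 / 2 := by
    intro a ha z hz
    have : ‖z - a‖ ≤ δ := by simpa [dist_eq_norm] using hz
    linarith [norm_le_norm_sub_add z a]
  have hb1 : ∀ {a : ℂ}, ‖a‖ + δ < 1 / 2 → closedBall a δ ⊆ ball 0 1 := fun ha z hz => by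
    have := hball ha z hz
    simp; linarith
  have hmem : ∀ (a z : ℂ), z ∈ ball (0 : ℂ) 1 → a + δ * z ∈ closedBall a δ := by
    intro a z hz
    have : ‖z‖ < 1 := by simpa using hz
    simp only [mem_closedBall, dist_eq_norm, add_sub_cancel_left, norm_mul, Complex.norm_real,
      Real.norm_eq_abs, abs_of_pos hδ]
    nlinarith
  have hpd : pdisc univ = closedBall (0 : ℂ) 1 := by simp [pdisc]
  have hnorm : ∀ z ∈ pdisc univ, ‖z‖ ≤ 1 := fun z hz => by simpa [hpd] using hz
  have mkm : ∀ z : ℂ, ‖z‖ < 1 / 2 → z ∈ pdisc univ := fun z hz => by simp [hpd]; linarith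
  have hδ0 : (δ : ℂ) ≠ 0 := by exact_mod_cast hδ.ne'
  have hKB : K '' pdisc univ ∩ surfaceBoundary X ⊆ K '' {z | ‖z‖ = 1} := by
    rintro _ ⟨⟨z, hz, rfl⟩, hzB⟩
    refine ⟨z, (hnorm z hz).antisymm (not_lt.1 fun hlt => ?_), rfl⟩
    exact hK.notMem_boundary' (by simpa using hlt) univ_mem hzB
  let u : ℂ → ℂ := fun z => shift ζ' z / shift ζ z
  let v := patchExt univ K u
  have hkp' := hK.rescale hδ (hb1 hδζ) (subset_univ _)
  have hkq' := hK.rescale hδ (hb1 hδζ') (subset_univ _)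
  have hvp : HasDegAt v (fun z => K (ζ + δ * z)) (-1) := by
    refine patchExt_hasDegAt hK hδ (hb1 hδζ) (subset_univ _) (f := fun z => (ζ - ζ' + δ * z) / δ)
      one_pos le_rfl (by fun_prop) ?_ ?_
    · intro z hz
      refine div_ne_zero (fun h => ?_) hδ0
      have h1 : ζ - ζ' = - (δ * z) := by linear_combination h
      have h2 : ‖z‖ < 1 := by simpa using hz
      rw [h1, norm_neg, norm_mul, Complex.norm_real, Real.norm_of_nonneg hδ.le] at hδn
      nlinarith
    · intro z hz
      have h1 := (hball hδζ _ (hmem ζ z (by simpa using hz.2))).le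
      simp only [u, shift_of_le h1]
      have := hz.1
      field_simp
      ring
  have hvq : HasDegAt v (fun z => K (ζ' + δ * z)) 1 := by
    refine patchExt_hasDegAt hK hδ (hb1 hδζ') (subset_univ _) (f := fun z => δ / (ζ' - ζ + δ * z))
      one_pos le_rfl ?_ ?_ ?_
    · refine continuousOn_const.div (by fun_prop) ?_
      intro z hz h
      have h1 : ζ - ζ' = δ * z := by linear_combination -h
      have h2 : ‖z‖ < 1 := by simpa using hz
      rw [h1, norm_mul, Complex.norm_real, Real.norm_of_nonneg hδ.le] at hδn
      nlinarith
    · intro z hz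
      refine div_ne_zero hδ0 (fun h => ?_)
      have h1 : ζ - ζ' = δ * z := by linear_combination -h
      have h2 : ‖z‖ < 1 := by simpa using hz
      rw [h1, norm_mul, Complex.norm_real, Real.norm_of_nonneg hδ.le] at hδn
      nlinarith
    · intro z hz
      have h1 := (hball hδζ' _ (hmem ζ' z (by simpa using hz.2))).le
      simp only [u, shift_of_le h1, zpow_one]
      rw [show ζ' + δ * z - ζ' = δ * z by ring, show ζ' + δ * z - ζ = ζ' - ζ + δ * z by ring]
      ring
  have hvr : ∀ x, x ≠ K ζ → x ≠ K ζ' → Reg v x := by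
    intro x hx hx'
    refine patchExt_reg hK (A := {ζ, ζ'}) (by simp) ?_ ?_ ?_ ?_
    · refine ((continuous_shift ζ').continuousOn).div (continuous_shift ζ).continuousOn ?_
      intro z hz
      exact shift_ne_zero hζ (hnorm z hz.1) fun h => hz.2 (by simp [h])
    · intro z hz hzA
      simp only [mem_insert_iff, mem_singleton_iff, not_or] at hzA
      exact div_ne_zero (shift_ne_zero hζ' (hnorm z hz) hzA.2) (shift_ne_zero hζ (hnorm z hz) hzA.1)
    · intro z _ hz1
      have : z ≠ 0 := by rintro rfl; simp at hz1
      simp only [u, shift_of_eq hz1, div_self this]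
    · rintro ⟨z, rfl | rfl, rfl⟩
      · exact hx rfl
      · exact hx' rfl
  have hvG : ∀ x ∉ G, v x = 1 := fun x hx => patchExt_of_notMem u fun h => hx (hKG h)
  have hvB : ∀ x ∈ surfaceBoundary X, v x = 1 := by
    intro x hx
    by_cases hxK : x ∈ K '' pdisc univ
    · obtain ⟨z, hz1, rfl⟩ := hKB ⟨hxK, hx⟩
      have hz1 : ‖z‖ = 1 := hz1
      have : z ≠ 0 := by rintro rfl; simp at hz1
      simp only [v]
      rw [patchExt_apply hK u (by simp [hpd, hz1])]
      simp only [u, shift_of_eq hz1, div_self this]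
    · exact patchExt_of_notMem u hxK
  obtain ⟨d', hd', hwd'⟩ := hwd.change_patch hk hkp' (by simp [hkp])
  have hd'1 : d' = 1 ∨ d' = -1 := by
    rcases hd with rfl | rfl <;> rcases hd' with rfl | rfl <;> simp
  have hKne : K ζ ≠ K ζ' := fun h => hne (hK.inj (mkm _ hζ) (mkm _ hζ') h)
  obtain ⟨O, O', hO, hO', hpO, hqO', hdis⟩ := t2_separation hKne
  let W : X → ℂ := fun x => w x * v x ^ d'
  have hWp : HasDegAt W (fun z => K (ζ + δ * z)) 0 := by
    have := hwd'.mul (hvp.zpow d')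
    simpa using this
  have hwq : HasDegAt w (fun z => K (ζ' + δ * z)) 0 := by
    refine Reg.hasDegAt hkq' ?_
    have : ∀ᶠ x in 𝓝 (K ζ'), x ≠ K ζ := isOpen_ne.mem_nhds hKne.symm
    rw [show K (ζ' + δ * 0) = K ζ' by simp]
    filter_upwards [this] with x hx using hwr x hx
  have hWq : HasDegAt W (fun z => K (ζ' + δ * z)) d' := by
    have := hwq.mul (hvq.zpow d')
    simpa using this
  have hOG : K ζ ∈ O ∩ G := ⟨hpO, hKG ⟨ζ, mkm _ hζ, rfl⟩⟩
  obtain ⟨w', h1, h2, h3, h4, -⟩ := hWp.fill hkp' (hO.inter hG) (by simpa using hOG)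
  refine ⟨w', fun x hx => ?_, fun x hx => ?_, fun x hx => ?_, _, d', hkq', by simp, hd'1, ?_⟩
  · by_cases hxp : x = K ζ
    · rw [hxp]; simpa using h3
    · exact h4 x ((hwr x hxp).mul ((hvr x hxp hx).zpow d'))
  · rw [h1 x fun h => hx h.2]
    simp [W, hwG x hx, hvG x hx]
  · rw [h2 x hx]
    simp [W, hwB x hx, hvB x hx]
  · refine hWq.congr hkq' ?_
    have : ∀ᶠ x in 𝓝 (K ζ'), x ∈ O' := hO'.mem_nhds hqO'
    rw [show K (ζ' + δ * 0) = K ζ' by simp]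
    filter_upwards [this] with x hx
    exact h1 x fun h => (disjoint_left.1 hdis) h.1 hx

end

/-! ### Twisting functions -/

section
variable {X : Type*} [TopologicalSpace X]

theorem exists_nhd_sdiff_boundary [T2Space X] (hX : IsSurface X) (x : X) {O : Set X} (hO : IsOpen O)
    (hx : x ∈ O) : ∃ N, IsOpen N ∧ x ∈ N ∧ N ⊆ O ∧ IsPreconnected (N \ surfaceBoundary X) ∧
      (N \ surfaceBoundary X).Nonempty := by
  by_cases hxB : x ∈ surfaceBoundary X
  · obtain ⟨k, hk, hk0, hkO⟩ := exists_half_patch hX hxB hO hx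
    have e : k '' (ball 0 1 ∩ cHalf) \ surfaceBoundary X = k '' (ball 0 1 ∩ {z | 0 < z.im}) := by
      ext y
      constructor
      · rintro ⟨⟨z, hz, rfl⟩, hy⟩
        rw [half_mem_boundary_iff hk hz.1 hz.2] at hy
        exact ⟨z, ⟨hz.1, lt_of_le_of_ne hz.2 (Ne.symm hy)⟩, rfl⟩
      · rintro ⟨z, ⟨hz, hzi⟩, rfl⟩
        have hzi : 0 < z.im := hzi
        refine ⟨⟨z, ⟨hz, hzi.le⟩, rfl⟩, ?_⟩
        rw [half_mem_boundary_iff hk hz hzi.le]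
        exact hzi.ne'
    refine ⟨k '' (ball 0 1 ∩ cHalf), hk.isOpen_interior, ⟨0, by simp [cHalf], hk0⟩,
      (image_mono (inter_subset_inter_left _ ball_subset_closedBall)).trans hkO, ?_, ?_⟩
    · rw [e]
      refine (((convex_ball 0 1).inter (convex_halfSpace_im_gt 0)).isPreconnected).image _
        (hk.cont.mono ?_)
      exact fun z hz => ⟨ball_subset_closedBall hz.1, show (0 : ℝ) ≤ z.im from (show (0 : ℝ) < z.im from hz.2).le⟩
    · rw [e]
      exact ⟨_, Complex.I / 2, ⟨by simp; norm_num, by simp⟩, rfl⟩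
  · obtain ⟨k, hk, hk0, hkO⟩ := exists_planar_patch hxB hO hx
    have e : k '' (ball 0 1 ∩ univ) \ surfaceBoundary X = k '' (ball 0 1 ∩ univ) := by
      refine sdiff_eq_left.2 (disjoint_left.2 ?_)
      rintro _ ⟨z, hz, rfl⟩ h
      exact hk.notMem_boundary' hz.1 univ_mem h
    refine ⟨k '' (ball 0 1 ∩ univ), hk.isOpen_interior, ⟨0, by simp, hk0⟩,
      (image_mono (inter_subset_inter_left _ ball_subset_closedBall)).trans hkO, ?_, ?_⟩
    · rw [e, inter_univ]
      refine (convex_ball 0 1).isPreconnected.image _ (hk.cont.mono ?_)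
      exact fun z hz => ⟨ball_subset_closedBall hz, trivial⟩
    · rw [e]; exact ⟨_, 0, by simp, rfl⟩

theorem isPreconnected_sdiff_boundary [T2Space X] (hX : IsSurface X) {G : Set X} (hG : IsOpen G)
    (hGc : IsPreconnected G) : IsPreconnected (G \ surfaceBoundary X) := by
  have hd : ∀ x, ∀ O : Set X, IsOpen O → x ∈ O → (O \ surfaceBoundary X).Nonempty := by
    intro x O hO hx
    obtain ⟨N, -, -, hNO, -, hne⟩ := exists_nhd_sdiff_boundary hX x hO hx
    exact hne.mono (sdiff_subset_sdiff_left hNO)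
  rw [isPreconnected_iff_subset_of_disjoint]
  intro U V hU hV hUV hdis
  let F : Set X → Set X := fun U => ⋃₀ {N | IsOpen N ∧ N ⊆ G ∧ N \ surfaceBoundary X ⊆ U}
  have hF : ∀ U, IsOpen (F U) := fun U => isOpen_sUnion fun N hN => hN.1
  have hFs : ∀ U, G ⊆ F U → G \ surfaceBoundary X ⊆ U := by
    intro U h x hx
    obtain ⟨N, hN, hxN⟩ := h hx.1
    exact hN.2.2 ⟨hxN, hx.2⟩
  have hcov : G ⊆ F U ∪ F V := by
    intro x hx
    obtain ⟨N, hN, hxN, hNG, hNc, hne⟩ := exists_nhd_sdiff_boundary hX x hG hx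
    have hs := sdiff_subset_sdiff_left (t := surfaceBoundary X) hNG
    rcases isPreconnected_iff_subset_of_disjoint.1 hNc U V hU hV (hs.trans hUV) (by
      rw [← subset_empty_iff, ← hdis]; exact inter_subset_inter_left _ hs) with h | h
    · exact Or.inl ⟨N, ⟨hN, hNG, h⟩, hxN⟩
    · exact Or.inr ⟨N, ⟨hN, hNG, h⟩, hxN⟩
  have hdisF : G ∩ (F U ∩ F V) = ∅ := by
    rw [eq_empty_iff_forall_notMem]
    rintro x ⟨hx, ⟨N, hN, hxN⟩, ⟨M, hM, hxM⟩⟩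
    obtain ⟨y, ⟨hyN, hyM⟩, hyB⟩ := hd x (N ∩ M) (hN.1.inter hM.1) ⟨hxN, hxM⟩
    have : y ∈ G \ surfaceBoundary X ∩ (U ∩ V) :=
      ⟨⟨hN.2.1 hyN, hyB⟩, hN.2.2 ⟨hyN, hyB⟩, hM.2.2 ⟨hyM, hyB⟩⟩
    rw [hdis] at this
    exact this
  exact (isPreconnected_iff_subset_of_disjoint.1 hGc _ _ (hF U) (hF V) hcov hdisF).imp (hFs U) (hFs V)

theorem Reach.spread [T2Space X] (hX : IsSurface X) {G : Set X} (hG : IsOpen G)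
    (hGc : IsPreconnected G) {B : X → ℂ} {p q : X} (hp : p ∈ G \ surfaceBoundary X)
    (hq : q ∈ G \ surfaceBoundary X) (h : Reach G B p) : Reach G B q := by
  have key : ∀ x ∈ G \ surfaceBoundary X, ∃ N, IsOpen N ∧ x ∈ N ∧ ∀ y ∈ N, ∀ z ∈ N,
      Reach G B y → Reach G B z := by
    intro x hx
    obtain ⟨k, hk, hk0, hkG⟩ := exists_planar_patch hx.2 hG hx.1
    refine ⟨k '' (ball 0 (1 / 2) ∩ univ), hk.opn _ isOpen_ball (ball_subset_ball (by norm_num)),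
      ⟨0, by simp, hk0⟩, ?_⟩
    rintro _ ⟨ζ, hζ, rfl⟩ _ ⟨ζ', hζ', rfl⟩ h
    exact h.move hk hkG hG (by simpa using hζ) (by simpa using hζ')
  have hc := isPreconnected_sdiff_boundary hX hG hGc
  let F : (X → Prop) → Set X := fun P => ⋃₀ {N | IsOpen N ∧ ∀ y ∈ N, P y}
  have hF : ∀ P, IsOpen (F P) := fun P => isOpen_sUnion fun N hN => hN.1
  by_contra hn
  obtain ⟨x, -, ⟨N, hN, hxN⟩, ⟨M, hM, hxM⟩⟩ := hc (F (Reach G B)) (F fun y => ¬ Reach G B y) (hF _) (hF _)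
    (by
      intro x hx
      obtain ⟨N, hN, hxN, hNr⟩ := key x hx
      by_cases hxr : Reach G B x
      · exact Or.inl ⟨N, ⟨hN, fun y hy => hNr x hxN y hy hxr⟩, hxN⟩
      · exact Or.inr ⟨N, ⟨hN, fun y hy hyr => hxr (hNr y hy x hxN hyr)⟩, hxN⟩)
    (by
      obtain ⟨N, hN, hxN, hNr⟩ := key p hp
      exact ⟨p, hp, N, ⟨hN, fun y hy => hNr p hxN y hy h⟩, hxN⟩)
    (by
      obtain ⟨N, hN, hxN, hNr⟩ := key q hq
      exact ⟨q, hq, N, ⟨hN, fun y hy hyr => hn (hNr y hy q hxN hyr)⟩, hxN⟩)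
  exact hM.2 x hxM (hN.2 x hxN)

theorem cay_continuousOn : ContinuousOn cay (pdisc cHalf) :=
  (continuous_shift _).continuousOn.div (continuous_shift _).continuousOn fun _ hz =>
    cay_den (by simpa using hz.1) hz.2

theorem cay_ne_zero {z : ℂ} (hz : z ∈ pdisc cHalf) (h : z ≠ Complex.I / 4) : cay z ≠ 0 := by
  have : ‖z‖ ≤ 1 := by simpa using hz.1
  exact div_ne_zero (shift_ne_zero (by simp; norm_num) this h) (cay_den this hz.2)

theorem cay_patch_reg [T2Space X] {k : ℂ → X} (hk : IsPatch cHalf k) {x : X} (hx : x ≠ k (Complex.I / 4)) :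
    Reg (patchExt cHalf k cay) x := by
  refine patchExt_reg hk (A := {Complex.I / 4}) (by simp) (cay_continuousOn.mono sdiff_subset)
    (fun z hz hzA => cay_ne_zero hz hzA) (fun z _ => cay_of_eq) ?_
  rintro ⟨z, hz, rfl⟩
  exact hx (by rw [mem_singleton_iff.1 hz])

theorem quarter_ball {z : ℂ} (hz : z ∈ closedBall (Complex.I / 4) (1 / 8)) : ‖z‖ < 1 / 2 ∧ 0 ≤ z.im := by
  have h1 : ‖z - Complex.I / 4‖ ≤ 1 / 8 := by simpa [dist_eq_norm] using hz
  have h2 : ‖Complex.I / 4‖ = 1 / 4 := by simp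
  have h3 := (abs_le.1 ((Complex.abs_im_le_norm _).trans h1)).1
  have h4 : (Complex.I / 4).im = 1 / 4 := by norm_num
  rw [Complex.sub_im, h4] at h3
  exact ⟨by linarith [norm_le_norm_sub_add z (Complex.I / 4)], by linarith⟩

theorem quarter_ball_subset : closedBall (Complex.I / 4) (1 / 8) ⊆ ball 0 1 := fun z hz => by
  have := (quarter_ball hz).1
  simp; linarith

theorem cay_patch_hasDegAt [T2Space X] {k : ℂ → X} (hk : IsPatch cHalf k) :
    HasDegAt (patchExt cHalf k cay) (fun z => k (Complex.I / 4 + ((1 / 8 : ℝ) : ℂ) * z)) 1 := by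
  have hne : ∀ z ∈ ball (0 : ℂ) 1, z + 4 * Complex.I ≠ 0 := by
    intro z hz h
    have h1 : ‖z‖ = 4 := by rw [eq_neg_of_add_eq_zero_left h]; simp
    have : ‖z‖ < 1 := by simpa using hz
    linarith
  refine patchExt_hasDegAt hk (by norm_num) quarter_ball_subset
    (fun z hz => (quarter_ball hz).2) (f := fun z => 1 / (z + 4 * Complex.I)) one_pos le_rfl ?_ ?_ ?_
  · exact continuousOn_const.div (by fun_prop) hne
  · exact fun z hz => div_ne_zero one_ne_zero (hne z hz)
  · intro z hz
    have hz1 : Complex.I / 4 + ((1 / 8 : ℝ) : ℂ) * z ∈ closedBall (Complex.I / 4) (1 / 8) := by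
      have : ‖z‖ < 1 := hz.2
      simp [dist_eq_norm]
      linarith
    have h2 := (quarter_ball hz1).1.le
    rw [cay, shift_of_le h2, shift_of_le h2, zpow_one]
    have := hne z (by simpa using hz.2)
    have h3 : Complex.I / 4 + ((1 / 8 : ℝ) : ℂ) * z - -Complex.I / 4 = (z + 4 * Complex.I) / 8 := by
      push_cast; ring
    rw [h3]
    push_cast
    field_simp
    ring

/-- A function supported in `G`, twisting the boundary along two half disc patches only. -/
theorem exists_twist [T2Space X] (hX : IsSurface X) {G : Set X} (hG : IsOpen G)
    (hGc : IsPreconnected G) {k₃ k₄ : ℂ → X} (hk₃ : IsPatch cHalf k₃) (hk₄ : IsPatch cHalf k₄)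
    (hG₃ : k₃ '' pdisc cHalf ⊆ G) (hG₄ : k₄ '' pdisc cHalf ⊆ G) :
    ∃ w : X → ℂ, Continuous w ∧ (∀ x, w x ≠ 0) ∧ (∀ x ∉ G, w x = 1) ∧ ∃ e : ℤ, (e = 1 ∨ e = -1) ∧
      ∀ x ∈ surfaceBoundary X, w x = patchExt cHalf k₃ cay x * patchExt cHalf k₄ cay x ^ e := by
  have hm : Complex.I / 4 ∈ pdisc cHalf := by
    have := quarter_ball (mem_closedBall_self (x := Complex.I / 4) (ε := 1 / 8) (by norm_num))
    exact ⟨by simpa using this.1.le.trans (by norm_num), this.2⟩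
  have hq : ∀ {k : ℂ → X}, IsPatch cHalf k →
      IsPatch univ (fun z => k (Complex.I / 4 + ((1 / 8 : ℝ) : ℂ) * z)) := fun hk =>
    hk.rescale (by norm_num) quarter_ball_subset (fun z hz => (quarter_ball hz).2)
  have hnb : ∀ {k : ℂ → X}, IsPatch cHalf k → k (Complex.I / 4) ∉ surfaceBoundary X := fun hk => by
    simpa using (hq hk).notMem_boundary
  have h₃ : Reach G (patchExt cHalf k₃ cay) (k₃ (Complex.I / 4)) :=
    ⟨patchExt cHalf k₃ cay, fun x hx => cay_patch_reg hk₃ hx,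
      fun x hx => patchExt_of_notMem _ fun h => hx (hG₃ h), fun x _ => rfl, _, 1, hq hk₃, by simp,
      Or.inl rfl, cay_patch_hasDegAt hk₃⟩
  have h₄G : k₄ (Complex.I / 4) ∈ G := hG₄ ⟨_, hm, rfl⟩
  obtain ⟨w, hwr, hwG, hwB, k, d, hk, hkp, hd, hwd⟩ :=
    h₃.spread hX hG hGc ⟨hG₃ ⟨_, hm, rfl⟩, hnb hk₃⟩ ⟨h₄G, hnb hk₄⟩
  obtain ⟨d', hd', hwd'⟩ := hwd.change_patch hk (hq hk₄) (by simp [hkp])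
  have hW := hwd'.mul ((cay_patch_hasDegAt hk₄).zpow (-d'))
  rw [show d' + 1 * -d' = 0 by ring] at hW
  obtain ⟨w', h1, h2, h3, h4, -⟩ := hW.fill (hq hk₄) hG (by simpa using h₄G)
  have hr : ∀ x, Reg w' x := by
    intro x
    by_cases hx : x = k₄ (Complex.I / 4)
    · rw [hx]; simpa using h3
    · exact h4 x ((hwr x hx).mul ((cay_patch_reg hk₄ hx).zpow _))
  refine ⟨w', continuous_iff_continuousAt.2 fun x => (hr x).1, fun x => (hr x).2, fun x hx => ?_, -d', ?_,
    fun x hx => ?_⟩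
  · rw [h1 x hx, hwG x hx, patchExt_of_notMem _ fun h => hx (hG₄ h)]; simp
  · rcases hd with rfl | rfl <;> rcases hd' with rfl | rfl <;> simp
  · rw [h2 x hx, hwB x hx]

end

/-! ### Compact connected one-dimensional manifolds -/

section OneManifold
variable {Y : Type*} [TopologicalSpace Y]

/-- A continuous locally injective path on `[0, T]`. -/
def LocInjPath (c : ℝ → Y) (T : ℝ) : Prop :=
  ContinuousOn c (Icc 0 T) ∧ ∀ t ∈ Icc 0 T, ∃ ε > 0, InjOn c (Icc 0 T ∩ Ioo (t - ε) (t + ε))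

theorem LocInjPath.extend_of_strictMono {c : ℝ → Y} {T δ : ℝ} (hc : LocInjPath c T) (hδ : 0 < δ) (hδT : δ ≤ T)
    (e : OpenPartialHomeomorph Y ℝ) (hs : MapsTo c (Icc (T - δ) T) e.source)
    (hm : StrictMonoOn (e ∘ c) (Icc (T - δ) T)) {b : ℝ} (hb : e (c T) < b)
    (hbt : Icc (e (c T)) b ⊆ e.target) :
    ∃ c' T', T < T' ∧ LocInjPath c' T' ∧ EqOn c' c (Icc 0 T) ∧ c' T' = e.symm b := by
  classical
  have hT : 0 < T := hδ.trans_le hδT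
  set r := e (c T) with hr
  let c' : ℝ → Y := fun t => if t ≤ T then c t else e.symm (r + (t - T))
  have hTs : c T ∈ e.source := hs ⟨by linarith, le_rfl⟩
  have hc1 : EqOn c' c (Iic T) := fun t ht => if_pos ht
  have hc2 : EqOn c' (fun t => e.symm (r + (t - T))) (Ici T) := by
    intro t ht
    rcases (show T ≤ t from ht).eq_or_lt with rfl | h
    · simp [c', hr, e.left_inv hTs]
    · exact if_neg (not_le.2 h)
  have hin : ∀ t ∈ Icc T (T + (b - r)), r + (t - T) ∈ Icc r b := fun t ht =>
    ⟨by linarith [ht.1], by linarith [ht.2]⟩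
  have hmono : StrictMonoOn (e ∘ c') (Icc (T - δ) (T + (b - r))) := by
    have h1 : StrictMonoOn (e ∘ c') (Icc (T - δ) T) :=
      hm.congr fun t ht => by simp [hc1 ht.2]
    have h2 : StrictMonoOn (e ∘ c') (Icc T (T + (b - r))) := by
      have : StrictMonoOn (fun t => r + (t - T)) (Icc T (T + (b - r))) :=
        fun x _ y _ h => by simp only; linarith
      refine this.congr fun t ht => ?_
      simp [hc2 ht.1, e.right_inv (hbt (hin t ht))]
    have h3 := h1.union h2 (c := T) ⟨⟨by linarith, le_rfl⟩, fun x hx => hx.2⟩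
      ⟨⟨le_rfl, by linarith⟩, fun x hx => hx.1⟩
    rwa [Icc_union_Icc_eq_Icc (by linarith) (by linarith)] at h3
  refine ⟨c', T + (b - r), by linarith, ⟨?_, ?_⟩, hc1.mono Icc_subset_Iic_self, ?_⟩
  · have h1 : ContinuousOn c' (Icc 0 T) := hc.1.congr (hc1.mono Icc_subset_Iic_self)
    have h2 : ContinuousOn c' (Icc T (T + (b - r))) := by
      have : ContinuousOn (fun t => e.symm (r + (t - T))) (Icc T (T + (b - r))) :=
        e.continuousOn_symm.comp (by fun_prop) fun t ht => hbt (hin t ht)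
      exact this.congr (hc2.mono Icc_subset_Ici_self)
    have := h1.union_of_isClosed h2 isClosed_Icc isClosed_Icc
    rwa [Icc_union_Icc_eq_Icc hT.le (by linarith)] at this
  · intro t ht
    by_cases h : t < T
    · obtain ⟨ε, hε, hi⟩ := hc.2 t ⟨ht.1, h.le⟩
      refine ⟨min ε (T - t), lt_min hε (by linarith), ?_⟩
      have hsub : Icc 0 (T + (b - r)) ∩ Ioo (t - min ε (T - t)) (t + min ε (T - t)) ⊆
          Icc 0 T ∩ Ioo (t - ε) (t + ε) := by
        rintro x ⟨hx, hx1, hx2⟩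
        have := min_le_left ε (T - t)
        have := min_le_right ε (T - t)
        exact ⟨⟨hx.1, by linarith⟩, by linarith, by linarith⟩
      intro x hx y hy hxy
      have hx' := hsub hx
      have hy' := hsub hy
      rw [hc1 hx'.1.2, hc1 hy'.1.2] at hxy
      exact hi hx' hy' hxy
    · refine ⟨δ, hδ, ?_⟩
      have hsub : Icc 0 (T + (b - r)) ∩ Ioo (t - δ) (t + δ) ⊆ Icc (T - δ) (T + (b - r)) := by
        rintro x ⟨hx, hx1, hx2⟩
        exact ⟨by linarith [not_lt.1 h], hx.2⟩
      intro x hx y hy hxy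
      exact hmono.injOn (hsub hx) (hsub hy) (congr_arg e hxy)
  · rw [hc2 (show T ≤ T + (b - r) by linarith)]
    simp

theorem LocInjPath.extend {c : ℝ → Y} {T : ℝ} (hT : 0 < T) (hc : LocInjPath c T)
    (e : OpenPartialHomeomorph Y ℝ) (hs : c T ∈ e.source) {a b : ℝ} (ha : a < e (c T)) (hb : e (c T) < b)
    (hab : Icc a b ⊆ e.target) :
    ∃ c' T', T < T' ∧ LocInjPath c' T' ∧ EqOn c' c (Icc 0 T) ∧ c' T' ∈ ({e.symm a, e.symm b} : Set Y) := by
  obtain ⟨ε, hε, hi⟩ := hc.2 T ⟨hT.le, le_rfl⟩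
  have hcT := hc.1 T ⟨hT.le, le_rfl⟩
  obtain ⟨η, hη, hηs⟩ := Metric.mem_nhdsWithin_iff.1 (hcT.preimage_mem_nhdsWithin (e.open_source.mem_nhds hs))
  obtain ⟨δ, hδ, hδlt⟩ := exists_between (lt_min (lt_min hε hη) hT)
  simp only [lt_min_iff] at hδlt
  obtain ⟨⟨h1, h2⟩, h3⟩ := hδlt
  have hsub : Icc (T - δ) T ⊆ Icc 0 T := Icc_subset_Icc_left (by linarith)
  have hms : MapsTo c (Icc (T - δ) T) e.source := by
    intro t ht
    refine hηs ⟨?_, hsub ht⟩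
    rw [mem_ball, Real.dist_eq, abs_lt]
    constructor <;> linarith [ht.1, ht.2]
  have hinj : InjOn (e ∘ c) (Icc (T - δ) T) := by
    have hi' : InjOn c (Icc (T - δ) T) := by
      refine hi.mono fun t ht => ?_
      exact ⟨hsub ht, by linarith [ht.1], by linarith [ht.2]⟩
    exact e.injOn.comp hi' hms
  have hcont : ContinuousOn (e ∘ c) (Icc (T - δ) T) := e.continuousOn.comp (hc.1.mono hsub) hms
  rcases hcont.strictMonoOn_of_injOn_Icc' (by linarith) hinj with hm | hm
  · obtain ⟨c', T', g1, g2, g3, g4⟩ := hc.extend_of_strictMono hδ h3.le e hms hm hb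
      ((Icc_subset_Icc_left ha.le).trans hab)
    exact ⟨c', T', g1, g2, g3, Or.inr g4⟩
  · let e' := e.transHomeomorph (Homeomorph.neg ℝ)
    have he' : ∀ y, e' y = - e y := fun y => rfl
    have hes : ∀ x, e'.symm x = e.symm (-x) := fun x => rfl
    obtain ⟨c', T', g1, g2, g3, g4⟩ := hc.extend_of_strictMono (b := -a) hδ h3.le e' hms
      (fun x hx y hy h => neg_lt_neg (hm hx hy h)) (by rw [he']; linarith)
      (by
        intro x hx
        rw [he'] at hx
        have h0 : -x ∈ Icc a b := ⟨by linarith [hx.2], by linarith [hx.1]⟩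
        exact hab h0)
    refine ⟨c', T', g1, g2, g3, Or.inl ?_⟩
    rw [g4, hes, neg_neg]

theorem exists_locInjPath_not_injOn [CompactSpace Y] [Nonempty Y]
    (hY : ∀ y : Y, ∃ e : OpenPartialHomeomorph Y ℝ, y ∈ e.source) :
    ∃ (c : ℝ → Y) (T : ℝ), LocInjPath c T ∧ ¬ InjOn c (Icc 0 T) := by
  classical
  choose e he using hY
  have hr : ∀ y, ∃ r > 0, closedBall (e y y) r ⊆ (e y).target := fun y =>
    Metric.nhds_basis_closedBall.mem_iff.1 ((e y).open_target.mem_nhds ((e y).map_source (he y)))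
  choose r hr0 hr using hr
  have hIcc : ∀ y, Icc (e y y - r y) (e y y + r y) ⊆ (e y).target := fun y => by
    rw [← Real.closedBall_eq_Icc]; exact hr y
  let U : Y → Set Y := fun y => (e y).source ∩ e y ⁻¹' ball (e y y) (r y)
  obtain ⟨t, -, ht⟩ := isCompact_univ.elim_nhds_subcover U fun y _ =>
    ((e y).isOpen_inter_preimage isOpen_ball).mem_nhds ⟨he y, mem_ball_self (hr0 y)⟩
  let F : Finset Y := t.image (fun y => (e y).symm (e y y - r y)) ∪ t.image (fun y => (e y).symm (e y y + r y))
  have key : ∀ n : ℕ, ∃ (c : ℝ → Y) (T : ℝ) (S : Finset ℝ), 0 < T ∧ LocInjPath c T ∧ S.card = n ∧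
      (∀ x ∈ S, x ∈ Icc 0 T) ∧ MapsTo c S F := by
    intro n
    induction n with
    | zero =>
      obtain ⟨y⟩ := ‹Nonempty Y›
      refine ⟨fun x => (e y).symm (e y y + x), r y, ∅, hr0 y, ⟨?_, fun t ht => ⟨1, one_pos, ?_⟩⟩, by simp,
        by simp, fun x hx => by simp at hx⟩
      · refine (e y).continuousOn_symm.comp (by fun_prop) fun x hx => hIcc y ⟨?_, ?_⟩
        · linarith [hx.1, hr0 y]
        · linarith [hx.2]
      · intro x hx z hz hxz
        have := (e y).symm.injOn (hIcc y ⟨by linarith [hx.1.1, hr0 y], by linarith [hx.1.2]⟩)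
          (hIcc y ⟨by linarith [hz.1.1, hr0 y], by linarith [hz.1.2]⟩) hxz
        linarith
    | succ n ih =>
      obtain ⟨c, T, S, hT, hc, hSn, hST, hSF⟩ := ih
      obtain ⟨y, hyt, hy⟩ : ∃ y ∈ t, c T ∈ U y := by simpa using ht (mem_univ (c T))
      have hy2 : |e y (c T) - e y y| < r y := by simpa [Real.dist_eq] using hy.2
      rw [abs_lt] at hy2
      obtain ⟨c', T', hTT', hc', hEq, hend⟩ := hc.extend hT (e y) hy.1 (a := e y y - r y) (b := e y y + r y)
        (by linarith) (by linarith) (hIcc y)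
      refine ⟨c', T', insert T' S, hT.trans hTT', hc', ?_, ?_, ?_⟩
      · rw [Finset.card_insert_of_notMem, hSn]
        intro h
        linarith [(hST _ h).2]
      · intro x hx
        rcases Finset.mem_insert.1 hx with rfl | hx
        · exact ⟨(hT.trans hTT').le, le_rfl⟩
        · exact ⟨(hST x hx).1, (hST x hx).2.trans hTT'.le⟩
      · intro x hx
        rcases Finset.mem_insert.1 (Finset.mem_coe.1 hx) with rfl | hx
        · rcases hend with h | h
          · rw [h]; exact Finset.mem_coe.2 (Finset.mem_union_left _ (Finset.mem_image_of_mem _ hyt))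
          · rw [mem_singleton_iff.1 h]
            exact Finset.mem_coe.2 (Finset.mem_union_right _ (Finset.mem_image_of_mem _ hyt))
        · rw [hEq (hST x hx)]
          exact hSF hx
  obtain ⟨c, T, S, hT, hc, hSn, hST, hSF⟩ := key (F.card + 1)
  obtain ⟨x, hx, y, hy, hne, hxy⟩ := Finset.exists_ne_map_eq_of_card_lt_of_maps_to (by omega) hSF
  exact ⟨c, T, hc, fun h => hne (h (hST x hx) (hST y hy) hxy)⟩

/-- A non-injective locally injective path contains a simple loop. -/
theorem LocInjPath.exists_loop [T2Space Y] {c : ℝ → Y} {T : ℝ} (hc : LocInjPath c T)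
    (hni : ¬ InjOn c (Icc 0 T)) :
    ∃ s t, 0 ≤ s ∧ s < t ∧ t ≤ T ∧ c s = c t ∧ InjOn c (Ico s t) := by
  choose ε hε hi using hc.2
  let O : Set (ℝ × ℝ) := ⋃ t : Icc 0 T, Ioo (t - ε t t.2) (t + ε t t.2) ×ˢ Ioo (t - ε t t.2) (t + ε t t.2)
  have hO : IsOpen O := isOpen_iUnion fun t => isOpen_Ioo.prod isOpen_Ioo
  let K : Set (ℝ × ℝ) := {p | p ∈ Icc 0 T ×ˢ Icc 0 T ∧ p.1 ≤ p.2 ∧ c p.1 = c p.2} \ O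
  have hK1 : ∀ p, p ∈ K ↔ (p ∈ Icc 0 T ×ˢ Icc 0 T ∧ p.1 < p.2 ∧ c p.1 = c p.2) := by
    rintro ⟨a, b⟩
    constructor
    · rintro ⟨⟨h1, h2, h3⟩, h4⟩
      refine ⟨h1, lt_of_le_of_ne h2 ?_, h3⟩
      rintro h5
      have h5 : a = b := h5
      subst h5
      refine h4 (mem_iUnion.2 ⟨⟨a, h1.1⟩, ?_, ?_⟩) <;>
      · have := hε a h1.1
        simp [this]
    · rintro ⟨h1, h2, h3⟩
      refine ⟨⟨h1, h2.le, h3⟩, fun h4 => ?_⟩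
      obtain ⟨t, ht⟩ := mem_iUnion.1 h4
      exact h2.ne (hi t t.2 ⟨h1.1, ht.1⟩ ⟨h1.2, ht.2⟩ h3)
  have hKc : IsCompact K := by
    refine IsCompact.diff ?_ hO
    have hcl : IsClosed {p : ℝ × ℝ | p ∈ Icc 0 T ×ˢ Icc 0 T ∧ c p.1 = c p.2} := by
      have hcc : ContinuousOn (fun p : ℝ × ℝ => (c p.1, c p.2)) (Icc 0 T ×ˢ Icc 0 T) :=
        (hc.1.comp continuousOn_fst fun p hp => hp.1).prodMk (hc.1.comp continuousOn_snd fun p hp => hp.2)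
      exact hcc.preimage_isClosed_of_isClosed (isClosed_Icc.prod isClosed_Icc) isClosed_diagonal
    refine (isCompact_Icc.prod isCompact_Icc).of_isClosed_subset
      (s := Icc (0 : ℝ) T ×ˢ Icc (0 : ℝ) T) ?_ fun p hp => hp.1
    have := hcl.inter (isClosed_le continuous_fst continuous_snd)
    convert this using 1
    ext p
    simp only [mem_inter_iff, mem_ofPred_eq]
    tauto
  have hKne : K.Nonempty := by
    simp only [InjOn] at hni
    push Not at hni
    obtain ⟨x, hx, y, hy, hxy, hne⟩ := hni
    rcases lt_or_gt_of_ne hne with h | h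
    · exact ⟨(x, y), (hK1 _).2 ⟨⟨hx, hy⟩, h, hxy⟩⟩
    · exact ⟨(y, x), (hK1 _).2 ⟨⟨hy, hx⟩, h, hxy.symm⟩⟩
  obtain ⟨⟨s, t⟩, hst, hmin⟩ := hKc.exists_isMinOn hKne (f := fun p => p.2 - p.1) (by fun_prop)
  obtain ⟨⟨h1, h1'⟩, h2, h3⟩ := (hK1 _).1 hst
  simp only at h1 h1' h2 h3
  refine ⟨s, t, h1.1, h2, h1'.2, h3, ?_⟩
  have aux : ∀ x ∈ Ico s t, ∀ y ∈ Ico s t, x < y → c x ≠ c y := by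
    intro x hx y hy hxy he
    have := hmin ((hK1 (x, y)).2 ⟨⟨⟨h1.1.trans hx.1, hx.2.le.trans h1'.2⟩,
      ⟨h1.1.trans hy.1, hy.2.le.trans h1'.2⟩⟩, hxy, he⟩)
    simp only [mem_ofPred_eq] at this
    linarith [hx.1, hy.2]
  intro x hx y hy he
  by_contra hne
  rcases lt_or_gt_of_ne hne with h | h
  · exact aux x hx y hy h he
  · exact aux y hy x hx h he.symm

/-- A compact connected one-dimensional manifold is a circle. -/
theorem exists_circle_param [CompactSpace Y] [T2Space Y] [ConnectedSpace Y]
    (hY : ∀ y : Y, ∃ e : OpenPartialHomeomorph Y ℝ, y ∈ e.source) :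
    ∃ c : ℝ → Y, Continuous c ∧ Function.Surjective c ∧ ∀ x y, c x = c y ↔ ∃ n : ℤ, x - y = n := by
  obtain ⟨c₀, T, hc, hni⟩ := exists_locInjPath_not_injOn hY
  obtain ⟨s, t, h0s, hst, htT, he, hinj⟩ := hc.exists_loop hni
  have hmem : ∀ x ∈ Icc (0 : ℝ) 1, s + (t - s) * x ∈ Icc s t := by
    intro x hx
    constructor <;> nlinarith [hx.1, hx.2]
  have hc1 : ContinuousOn (fun x => c₀ (s + (t - s) * x)) (Icc 0 1) :=
    hc.1.comp (by fun_prop) fun x hx => ⟨h0s.trans (hmem x hx).1, (hmem x hx).2.trans htT⟩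
  let c : ℝ → Y := (fun x => c₀ (s + (t - s) * x)) ∘ Int.fract
  have hcc : Continuous c := hc1.comp_fract'' (by simp [he])
  have hce : ∀ x y, c x = c y ↔ ∃ n : ℤ, x - y = n := by
    intro x y
    rw [← Int.fract_eq_fract]
    constructor
    · intro h
      have hI : ∀ z : ℝ, s + (t - s) * Int.fract z ∈ Ico s t := fun z => by
        constructor <;> nlinarith [Int.fract_nonneg z, Int.fract_lt_one z]
      have := hinj (hI x) (hI y) h
      have h2 : t - s ≠ 0 := by linarith
      exact mul_left_cancel₀ h2 (add_left_cancel this)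
    · intro h
      simp only [c, Function.comp, h]
  have hinjl : ∀ x, InjOn c (Ioo (x - 1 / 2) (x + 1 / 2)) := by
    intro x y hy z hz h
    obtain ⟨n, hn⟩ := (hce _ _).1 h
    have h1 : (n : ℝ) < 1 := by rw [← hn]; linarith [hy.2, hz.1]
    have h2 : (-1 : ℝ) < n := by rw [← hn]; linarith [hy.1, hz.2]
    have h3 : n = 0 := by
      have : n < 1 := by exact_mod_cast h1
      have : -1 < n := by exact_mod_cast h2
      omega
    rw [h3] at hn
    simpa [sub_eq_zero] using hn
  have hopen : IsOpen (range c) := by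
    rw [isOpen_iff_mem_nhds]
    rintro _ ⟨x, rfl⟩
    obtain ⟨e, hes⟩ := hY (c x)
    obtain ⟨η, hη, hηs⟩ := Metric.mem_nhds_iff.1 (hcc.continuousAt.preimage_mem_nhds (e.open_source.mem_nhds hes))
    obtain ⟨δ, hδ, hlt⟩ := exists_between (lt_min hη (one_half_pos (α := ℝ)))
    rw [lt_min_iff] at hlt
    have hms : MapsTo c (Icc (x - δ) (x + δ)) e.source := by
      intro y hy
      refine hηs ?_
      rw [mem_ball, Real.dist_eq, abs_lt]
      constructor <;> linarith [hy.1, hy.2]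
    have hin : InjOn (e ∘ c) (Icc (x - δ) (x + δ)) := by
      have hi' : InjOn c (Icc (x - δ) (x + δ)) := by
        refine (hinjl x).mono fun y hy => ?_
        exact ⟨by linarith [hy.1], by linarith [hy.2]⟩
      exact e.injOn.comp hi' hms
    have hct : ContinuousOn (e ∘ c) (Icc (x - δ) (x + δ)) := e.continuousOn.comp hcc.continuousOn hms
    have hnb : (e ∘ c) '' Icc (x - δ) (x + δ) ∈ 𝓝 (e (c x)) := by
      have i1 : x - δ ∈ Icc (x - δ) (x + δ) := ⟨by linarith, by linarith⟩
      have i2 : x + δ ∈ Icc (x - δ) (x + δ) := ⟨by linarith, by linarith⟩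
      have i3 : x ∈ Icc (x - δ) (x + δ) := ⟨by linarith, by linarith⟩
      rcases hct.strictMonoOn_of_injOn_Icc' (by linarith) hin with hm | hm
      · exact Filter.mem_of_superset (Icc_mem_nhds (hm i1 i3 (by linarith)) (hm i3 i2 (by linarith)))
          (intermediate_value_Icc (by linarith) hct)
      · exact Filter.mem_of_superset (Icc_mem_nhds (hm i3 i2 (by linarith)) (hm i1 i3 (by linarith)))
          (intermediate_value_Icc' (by linarith) hct)
    have := Filter.image_mem_map (m := e.symm) hnb
    rw [e.symm_map_nhds_eq hes] at this
    refine Filter.mem_of_superset this ?_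
    rintro _ ⟨_, ⟨y, hy, rfl⟩, rfl⟩
    exact ⟨y, (e.left_inv (hms hy)).symm⟩
  have hran : range c = c '' Icc 0 1 := by
    refine subset_antisymm ?_ (image_subset_range _ _)
    rintro _ ⟨x, rfl⟩
    exact ⟨Int.fract x, ⟨Int.fract_nonneg x, (Int.fract_lt_one x).le⟩, by simp [c]⟩
  have hclosed : IsClosed (range c) := by
    rw [hran]; exact (isCompact_Icc.image hcc).isClosed
  exact ⟨c, hcc, range_eq_univ.1 (IsClopen.eq_univ ⟨hclosed, hopen⟩ (range_nonempty c)), hce⟩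

end OneManifold

/-! ### Boundary components are circles -/

theorem isClosed_surfaceBoundary (X : Type*) [TopologicalSpace X] : IsClosed (surfaceBoundary X) := by
  rw [← isOpen_compl_iff, isOpen_iff_mem_nhds]
  intro x hx
  simp only [surfaceBoundary, mem_compl_iff, mem_ofPred_eq, not_not] at hx
  obtain ⟨U, V, hU, hxU, hV, hUV⟩ := hx
  refine Filter.mem_of_superset (hU.mem_nhds hxU) fun y hy => ?_
  simp only [surfaceBoundary, mem_compl_iff, mem_ofPred_eq, not_not]
  exact ⟨U, V, hU, hy, hV, hUV⟩

theorem exists_boundary_chart {X : Type*} [TopologicalSpace X] [T2Space X] (hX : IsSurface X)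
    (y : surfaceBoundary X) : ∃ e : OpenPartialHomeomorph (surfaceBoundary X) ℝ, y ∈ e.source := by
  obtain ⟨k, hk, hk0, -⟩ := exists_half_patch hX y.2 isOpen_univ (mem_univ _)
  obtain ⟨k', hk'c, hk'⟩ := hk.exists_inv
  have hreal : ∀ t : ℝ, |t| < 1 → (t : ℂ) ∈ ball (0 : ℂ) 1 ∩ cHalf := fun t ht => by
    refine ⟨by simpa using ht, ?_⟩
    simp [cHalf]
  have hsub : ball (0 : ℂ) 1 ∩ cHalf ⊆ pdisc cHalf := fun z hz => ⟨ball_subset_closedBall hz.1, hz.2⟩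
  have hb : ∀ x ∈ k '' (ball 0 1 ∩ cHalf), x ∈ surfaceBoundary X →
      |(k' x).re| < 1 ∧ k ((k' x).re : ℂ) = x := by
    rintro _ ⟨z, hz, rfl⟩ hx
    rw [half_mem_boundary_iff hk hz.1 hz.2] at hx
    have hzr : (z.re : ℂ) = z := Complex.ext rfl (by simp [hx])
    rw [hk' z (hsub hz), hzr]
    refine ⟨(Complex.abs_re_le_norm z).trans_lt (by simpa using hz.1), rfl⟩
  let r : surfaceBoundary X → ℝ := fun x => (k' x).re
  classical
  let i : ℝ → surfaceBoundary X := fun t =>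
    if ht : |t| < 1 then ⟨k t, mem_boundary_of_half hk ht⟩ else y
  have hi : ∀ t (ht : |t| < 1), (i t : X) = k t := fun t ht => by simp [i, ht]
  refine ⟨{ toFun := r, invFun := i, source := {x | (x : X) ∈ k '' (ball 0 1 ∩ cHalf)}, target := Ioo (-1) 1,
            map_source' := ?_, map_target' := ?_, left_inv' := ?_, right_inv' := ?_, open_source := ?_,
            open_target := isOpen_Ioo, continuousOn_toFun := ?_, continuousOn_invFun := ?_ }, ?_⟩
  · intro x hx
    exact abs_lt.1 (hb x hx x.2).1
  · intro t ht
    have ht' := abs_lt.2 ht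
    show (i t : X) ∈ k '' (ball 0 1 ∩ cHalf)
    rw [hi t ht']
    exact ⟨t, hreal t ht', rfl⟩
  · intro x hx
    apply Subtype.ext
    rw [hi _ (hb x hx x.2).1]
    exact (hb x hx x.2).2
  · intro t ht
    have ht' := abs_lt.2 ht
    show (k' (i t)).re = t
    rw [hi t ht', hk' _ (hsub (hreal t ht'))]
    simp
  · refine Complex.continuous_re.comp_continuousOn (hk'c.comp continuous_subtype_val.continuousOn ?_)
    exact fun x hx => image_mono hsub hx
  · rw [IsInducing.subtypeVal.continuousOn_iff]
    have : ContinuousOn (fun t : ℝ => k t) (Ioo (-1) 1) :=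
      hk.cont.comp Complex.continuous_ofReal.continuousOn fun t ht => hsub (hreal t (abs_lt.2 ht))
    exact this.congr fun t ht => hi t (abs_lt.2 ht)
  · exact hk.isOpen_interior.preimage continuous_subtype_val
  · show (y : X) ∈ k '' _
    exact ⟨0, ⟨by simp, by simp [cHalf]⟩, hk0⟩

/-- A component of the boundary is relatively open and closed. -/
theorem boundary_component_clopen {X : Type*} [TopologicalSpace X] [T2Space X] (hX : IsSurface X)
    {b : Set X} (hb : b ∈ surfaceBoundaryComponents X) :
    b ⊆ surfaceBoundary X ∧ IsClosed b ∧ ∃ O : Set X, IsOpen O ∧ O ∩ surfaceBoundary X = b := by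
  classical
  obtain ⟨x, hx, rfl⟩ := hb
  choose ch hch using exists_boundary_chart hX
  let cs : ChartedSpace ℝ (surfaceBoundary X) :=
    { atlas := range ch, chartAt := ch, mem_chart_source := hch, chart_mem_atlas := fun x => ⟨x, rfl⟩ }
  have : LocallyConnectedSpace (surfaceBoundary X) := ChartedSpace.locallyConnectedSpace ℝ _
  refine ⟨connectedComponentIn_subset _ _, ?_, ?_⟩
  · rw [connectedComponentIn_eq_image hx]
    exact (isClosed_surfaceBoundary X).isClosedEmbedding_subtypeVal.isClosedMap _ isClosed_connectedComponent
  · obtain ⟨O, hO, hO'⟩ := isOpen_induced_iff.1 (isOpen_connectedComponent (x := (⟨x, hx⟩ : surfaceBoundary X)))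
    refine ⟨O, hO, ?_⟩
    rw [connectedComponentIn_eq_image hx, ← hO', Subtype.image_preimage_coe, inter_comm]

theorem exists_boundary_circle {X : Type*} [TopologicalSpace X] [T2Space X] [CompactSpace X] (hX : IsSurface X)
    {b : Set X} (hb : b ∈ surfaceBoundaryComponents X) :
    ∃ c : ℝ → X, Continuous c ∧ range c = b ∧ ∀ x y, c x = c y ↔ ∃ n : ℤ, x - y = n := by
  obtain ⟨hsub, hcl, O, hO, hOb⟩ := boundary_component_clopen hX hb
  have hcomp : CompactSpace b := isCompact_iff_compactSpace.1 hcl.isCompact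
  have hconn : ConnectedSpace b := by
    obtain ⟨x, hx, rfl⟩ := hb
    exact isConnected_iff_connectedSpace.1 (isConnected_connectedComponentIn_iff.2 hx)
  have hemb : IsOpenEmbedding (inclusion hsub) := by
    refine ⟨IsEmbedding.inclusion hsub, ?_⟩
    rw [range_inclusion]
    convert hO.preimage (continuous_subtype_val (p := fun x => x ∈ surfaceBoundary X)) using 1
    ext ⟨x, hx⟩
    simp only [mem_ofPred_eq, mem_preimage, ← hOb, mem_inter_iff, hx, and_true]
  obtain ⟨c, hc, hs, he⟩ := exists_circle_param (Y := b) (fun y => by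
    obtain ⟨e, hy⟩ := exists_boundary_chart hX (inclusion hsub y)
    have : Nonempty b := ⟨y⟩
    exact ⟨(hemb.toOpenPartialHomeomorph _).trans e, by simpa using hy⟩)
  refine ⟨fun t => c t, continuous_subtype_val.comp hc, ?_, fun x y => ?_⟩
  · rw [show (fun t => (c t : X)) = Subtype.val ∘ c from rfl, range_comp, hs.range_eq, image_univ,
      Subtype.range_coe]
  · rw [← he, Subtype.ext_iff]

/-! ### Square roots of a twist along the boundary -/

/-- On the real axis a continuous square root of `cay`. -/
noncomputable def cayRoot (z : ℂ) : ℂ :=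
  (z.re - Complex.I * (cutoff z / 4 : ℝ)) / (√(z.re ^ 2 + (cutoff z / 4) ^ 2) : ℝ)

theorem cayRoot_den {z : ℂ} (hz : z.im = 0) : 0 < z.re ^ 2 + (cutoff z / 4) ^ 2 := by
  by_contra h
  have h1 : z.re ^ 2 = 0 := le_antisymm (by nlinarith [sq_nonneg (cutoff z / 4)]) (sq_nonneg _)
  have h2 : z.re = 0 := by simpa using h1
  have h3 : z = 0 := Complex.ext h2 hz
  have h4 : cutoff z = 1 := cutoff_of_le (by simp [h3])
  rw [h2, h4] at h
  norm_num at h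

theorem cayRoot_sq {z : ℂ} (hz : z.im = 0) : cayRoot z ^ 2 = cay z := by
  have hd := cayRoot_den hz
  set y : ℝ := cutoff z / 4 with hy
  have hzr : z = (z.re : ℂ) := Complex.ext rfl (by simp [hz])
  have e1 : shift (Complex.I / 4) z = z.re - Complex.I * y := by
    rw [shift, hy]
    nth_rewrite 1 [hzr]
    push_cast
    ring
  have e2 : shift (-Complex.I / 4) z = z.re + Complex.I * y := by
    rw [shift, hy]
    nth_rewrite 1 [hzr]
    push_cast
    ring
  have e3 : ((z.re : ℂ) - Complex.I * y) * (z.re + Complex.I * y) = ((z.re ^ 2 + y ^ 2 : ℝ) : ℂ) := by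
    push_cast
    linear_combination (-(y : ℂ) ^ 2) * Complex.I_sq
  have e4 : ((z.re ^ 2 + y ^ 2 : ℝ) : ℂ) ≠ 0 := by exact_mod_cast hd.ne'
  have e5 : ((√(z.re ^ 2 + y ^ 2) : ℝ) : ℂ) ^ 2 = ((z.re ^ 2 + y ^ 2 : ℝ) : ℂ) := by
    rw [← Complex.ofReal_pow, Real.sq_sqrt hd.le]
  have e6 : (z.re : ℂ) + Complex.I * y ≠ 0 := fun h => e4 (by rw [← e3, h, mul_zero])
  rw [cayRoot, cay, e1, e2, div_pow, e5, ← e3, pow_two]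
  rw [← hy]
  have e7 : (z.re : ℂ) - Complex.I * y ≠ 0 := fun h => e4 (by rw [← e3, h, zero_mul])
  field_simp

theorem cayRoot_continuousOn : ContinuousOn cayRoot {z | z.im = 0} := by
  have := continuous_cutoff
  refine ContinuousOn.div (by fun_prop) (by fun_prop) fun z hz => ?_
  have := Real.sqrt_pos.2 (cayRoot_den hz)
  exact_mod_cast this.ne'

/-- The discontinuous root of `cay` which equals one on the unit circle. -/
noncomputable def cayJump (z : ℂ) : ℂ :=
  if ‖z‖ = 1 then 1 else ((z.re / |z.re| : ℝ) : ℂ) * cayRoot z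

theorem cayJump_real {z : ℂ} (hz : z.im = 0) : cayJump z = ((z.re / |z.re| : ℝ) : ℂ) * cayRoot z := by
  rw [cayJump]
  split_ifs with h
  · have hzr : z = (z.re : ℂ) := Complex.ext rfl (by simp [hz])
    have h1 : |z.re| = 1 := by rw [hzr] at h; simpa using h
    have h2 : z.re ^ 2 = 1 := by rw [← sq_abs, h1]; norm_num
    rw [cayRoot, cutoff_of_eq h, h1]
    simp only [zero_div, Complex.ofReal_zero, mul_zero, sub_zero, ne_eq, OfNat.ofNat_ne_zero,
      not_false_eq_true, zero_pow, add_zero, h2, Real.sqrt_one, div_one, Complex.ofReal_one]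
    rw [← pow_two]
    exact_mod_cast h2.symm
  · rfl

theorem exists_twist_root {X : Type*} [TopologicalSpace X] [T2Space X] {k : ℂ → X} (hk : IsPatch cHalf k) :
    ∃ r ρ : X → ℂ, ContinuousOn r (surfaceBoundary X \ {k 0}) ∧
      ContinuousOn ρ (surfaceBoundary X ∩ k '' (ball 0 1 ∩ cHalf)) ∧
      (∀ x ∈ surfaceBoundary X, x ≠ k 0 → r x ^ 2 = patchExt cHalf k cay x) ∧
      (∀ x ∈ surfaceBoundary X ∩ k '' (ball 0 1 ∩ cHalf), ρ x ^ 2 = patchExt cHalf k cay x) ∧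
      (∀ x ∉ k '' pdisc cHalf, r x = 1) ∧
      ∀ t : ℝ, 0 < t → t < 1 → r (k t) = ρ (k t) ∧ r (k ((-t : ℝ) : ℂ)) = - ρ (k ((-t : ℝ) : ℂ)) := by
  have hb : ∀ z ∈ pdisc cHalf, k z ∈ surfaceBoundary X → ‖z‖ = 1 ∨ z.im = 0 := by
    intro z hz hx
    by_cases h : ‖z‖ = 1
    · exact Or.inl h
    · have h1 : ‖z‖ ≤ 1 := by simpa using hz.1
      exact Or.inr ((half_mem_boundary_iff hk (by simpa using lt_of_le_of_ne h1 h) hz.2).1 hx)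
  have hsub : ball (0 : ℂ) 1 ∩ cHalf ⊆ pdisc cHalf := fun z hz => ⟨ball_subset_closedBall hz.1, hz.2⟩
  obtain ⟨k', hk'c, hk'⟩ := hk.exists_inv
  refine ⟨patchExt cHalf k cayJump, patchExt cHalf k cayRoot, ?_, ?_, ?_, ?_, fun x hx => patchExt_of_notMem _ hx, ?_⟩
  · refine (patchExt_continuousOn hk (A := {z | z ∈ pdisc cHalf ∧ z.im ≠ 0 ∧ ‖z‖ ≠ 1} ∪ {0}) (u := cayJump) ?_ ?_).mono ?_
    · have c1 : ContinuousOn cayJump {z | ‖z‖ = 1} :=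
        (continuousOn_const (c := (1 : ℂ))).congr fun z hz => if_pos hz
      have c2 : ContinuousOn cayJump ({z : ℂ | z.im = 0} \ {0}) := by
        have : ContinuousOn (fun z : ℂ => ((z.re / |z.re| : ℝ) : ℂ) * cayRoot z) ({z : ℂ | z.im = 0} \ {0}) := by
          refine ContinuousOn.mul ?_ (cayRoot_continuousOn.mono sdiff_subset)
          refine Complex.continuous_ofReal.comp_continuousOn ?_
          refine ContinuousOn.div (by fun_prop) (by fun_prop) fun z hz => ?_
          rw [abs_ne_zero]
          exact fun h => hz.2 (Complex.ext h hz.1)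
        exact this.congr fun z hz => cayJump_real hz.1
      have cl1 : IsClosed {z : ℂ | ‖z‖ = 1} := isClosed_eq continuous_norm continuous_const
      have cl2 : IsClosed {z : ℂ | z.im = 0} := isClosed_eq Complex.continuous_im continuous_const
      intro z hz
      have w1 : ContinuousWithinAt cayJump {z | ‖z‖ = 1} z := by
        by_cases h : ‖z‖ = 1
        · exact c1 z h
        · exact continuousWithinAt_of_notMem_closure fun hc => h (cl1.closure_subset hc)
      have w2 : ContinuousWithinAt cayJump ({z : ℂ | z.im = 0} \ {0}) z := by
        by_cases h : z.im = 0
        · exact c2 z ⟨h, fun h0 => hz.2 (Or.inr h0)⟩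
        · exact continuousWithinAt_of_notMem_closure fun hc =>
            h (cl2.closure_subset (closure_mono sdiff_subset hc))
      refine (w1.union w2).mono ?_
      rintro y ⟨hyp, hy⟩
      by_contra hn
      apply hy
      by_cases h0 : y = 0
      · exact Or.inr h0
      · exact Or.inl ⟨hyp, fun h => hn (Or.inr ⟨h, h0⟩), fun h => hn (Or.inl h)⟩
    · intro z _ h
      exact if_pos h
    · rintro x ⟨hx, hx0⟩ ⟨z, hz, rfl⟩
      rcases hz with hz | hz
      · rcases hb z hz.1 hx with h | h
        · exact hz.2.2 h
        · exact hz.2.1 h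
      · exact hx0 (by rw [mem_singleton_iff.1 hz]; rfl)
  · have : ContinuousOn (cayRoot ∘ k') (surfaceBoundary X ∩ k '' (ball 0 1 ∩ cHalf)) := by
      refine cayRoot_continuousOn.comp (hk'c.mono ?_) ?_
      · exact inter_subset_right.trans (image_mono hsub)
      · rintro _ ⟨hx, z, hz, rfl⟩
        rw [hk' z (hsub hz)]
        exact (half_mem_boundary_iff hk hz.1 hz.2).1 hx
    refine this.congr ?_
    rintro _ ⟨hx, z, hz, rfl⟩
    rw [patchExt_apply hk _ (hsub hz), Function.comp, hk' z (hsub hz)]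
  · intro x hx hx0
    by_cases h : x ∈ k '' pdisc cHalf
    · obtain ⟨z, hz, rfl⟩ := h
      rw [patchExt_apply hk _ hz, patchExt_apply hk _ hz]
      rcases hb z hz hx with h | h
      · rw [cay_of_eq h, cayJump, if_pos h, one_pow]
      · rw [cayJump_real h, mul_pow, cayRoot_sq h]
        have : z.re ≠ 0 := fun h0 => hx0 (by rw [show z = 0 from Complex.ext h0 h])
        rw [← Complex.ofReal_pow, div_pow, sq_abs, div_self (pow_ne_zero _ this)]
        simp
    · rw [patchExt_of_notMem _ h, patchExt_of_notMem _ h, one_pow]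
  · rintro _ ⟨hx, z, hz, rfl⟩
    rw [patchExt_apply hk _ (hsub hz), patchExt_apply hk _ (hsub hz)]
    exact cayRoot_sq ((half_mem_boundary_iff hk hz.1 hz.2).1 hx)
  · intro t h0 h1
    have m1 : (t : ℂ) ∈ pdisc cHalf := ⟨by simp [abs_of_pos h0, h1.le], by simp [cHalf]⟩
    have m2 : ((-t : ℝ) : ℂ) ∈ pdisc cHalf := ⟨by simp [abs_of_pos h0, h1.le], by simp [cHalf]⟩
    rw [patchExt_apply hk _ m1, patchExt_apply hk _ m1, patchExt_apply hk _ m2, patchExt_apply hk _ m2,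
      cayJump_real (by simp), cayJump_real (Complex.ofReal_im _)]
    rw [Complex.ofReal_re, Complex.ofReal_re, abs_neg, abs_of_pos h0, div_self h0.ne', neg_div, div_self h0.ne']
    simp

theorem patchExt_cay_ne_zero {X : Type*} [TopologicalSpace X] [T2Space X] {k : ℂ → X} (hk : IsPatch cHalf k)
    {x : X} (hx : x ∈ surfaceBoundary X) : patchExt cHalf k cay x ≠ 0 := by
  by_cases h : x ∈ k '' pdisc cHalf
  · obtain ⟨z, hz, rfl⟩ := h
    rw [patchExt_apply hk _ hz]
    refine cay_ne_zero hz ?_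
    rintro rfl
    have h1 : Complex.I / 4 ∈ ball (0 : ℂ) 1 := by simp; norm_num
    have := (half_mem_boundary_iff hk h1 hz.2).1 hx
    norm_num at this
  · rw [patchExt_of_notMem _ h]
    exact one_ne_zero

theorem boundary_patch_cases {X : Type*} [TopologicalSpace X] [T2Space X] {k : ℂ → X} (hk : IsPatch cHalf k)
    {x : X} (hx : x ∈ surfaceBoundary X ∩ k '' (ball 0 1 ∩ cHalf)) :
    x = k 0 ∨ ∃ t : ℝ, 0 < t ∧ t < 1 ∧ (x = k t ∨ x = k ((-t : ℝ) : ℂ)) := by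
  obtain ⟨hx, z, hz, rfl⟩ := hx
  have hi := (half_mem_boundary_iff hk hz.1 hz.2).1 hx
  have hzr : z = (z.re : ℂ) := Complex.ext rfl (by simp [hi])
  have hlt : |z.re| < 1 := (Complex.abs_re_le_norm z).trans_lt (by simpa using hz.1)
  rw [abs_lt] at hlt
  rcases lt_trichotomy z.re 0 with h | h | h
  · exact Or.inr ⟨-z.re, by linarith, by linarith, Or.inr (by rw [neg_neg, ← hzr])⟩
  · exact Or.inl (by rw [hzr, h]; rfl)
  · exact Or.inr ⟨z.re, h, hlt.2, Or.inl (by rw [← hzr])⟩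

theorem sign_const_of_preconnected {A : Type*} [TopologicalSpace A] {S : Set A} (hS : IsPreconnected S) {τ : A → ℂ}
    (hτ : ContinuousOn τ S) (h1 : ∀ x ∈ S, τ x ^ 2 = 1) {x y : A} (hx : x ∈ S) (hy : y ∈ S) : τ x = τ y := by
  rcases hS.eq_one_or_eq_neg_one_of_sq_eq hτ (fun x hx => h1 x hx) with h | h <;>
  rw [h hx, h hy] <;> rfl

theorem exists_sign_at_jump {X : Type*} [TopologicalSpace X] [T2Space X] {k : ℂ → X} (hk : IsPatch cHalf k)
    {r ρ τ : X → ℂ} (hr : ∀ t : ℝ, 0 < t → t < 1 → r (k t) = ρ (k t) ∧ r (k ((-t : ℝ) : ℂ)) = - ρ (k ((-t : ℝ) : ℂ)))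
    (hτ : ContinuousOn τ ((surfaceBoundary X ∩ k '' (ball 0 1 ∩ cHalf)) \ {k 0}))
    (h1 : ∀ x ∈ (surfaceBoundary X ∩ k '' (ball 0 1 ∩ cHalf)) \ {k 0}, τ x ^ 2 = 1)
    (hne : ∃ x ∈ (surfaceBoundary X ∩ k '' (ball 0 1 ∩ cHalf)) \ {k 0},
      ∃ y ∈ (surfaceBoundary X ∩ k '' (ball 0 1 ∩ cHalf)) \ {k 0}, τ x ≠ τ y) :
    ∃ ε : ℂ, ε ^ 2 = 1 ∧ ∀ x ∈ (surfaceBoundary X ∩ k '' (ball 0 1 ∩ cHalf)) \ {k 0}, τ x * r x = ε * ρ x := by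
  set S := (surfaceBoundary X ∩ k '' (ball 0 1 ∩ cHalf)) \ {k 0} with hS
  have hball : ∀ t : ℝ, |t| < 1 → (t : ℂ) ∈ ball (0 : ℂ) 1 ∩ cHalf := fun t ht =>
    ⟨by simpa using ht, by simp [cHalf]⟩
  have hmem : ∀ t : ℝ, |t| < 1 → t ≠ 0 → k t ∈ S := fun t ht h0 => by
    refine ⟨⟨mem_boundary_of_half hk ht, t, hball t ht, rfl⟩, fun h => h0 ?_⟩
    have := hk.inj ⟨ball_subset_closedBall (hball t ht).1, (hball t ht).2⟩ ⟨by simp, by simp [cHalf]⟩ h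
    exact_mod_cast this
  have hkc : ContinuousOn (fun t : ℝ => k t) (Ioo (-1) 1) :=
    hk.cont.comp Complex.continuous_ofReal.continuousOn fun t ht =>
      ⟨ball_subset_closedBall (hball t (abs_lt.2 ht)).1, (hball t (abs_lt.2 ht)).2⟩
  have hside : ∀ u v : ℝ, -1 ≤ u → v ≤ 1 → (0 ∉ Ioo u v) → ∀ s ∈ Ioo u v, ∀ t ∈ Ioo u v, τ (k s) = τ (k t) := by
    intro u v hu hv h0 s hs t ht
    have hms : MapsTo (fun t : ℝ => k t) (Ioo u v) S := fun x hx =>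
      hmem x (abs_lt.2 ⟨hu.trans_lt hx.1, hx.2.trans_le hv⟩) (fun h => h0 (h ▸ hx))
    exact sign_const_of_preconnected (τ := fun t : ℝ => τ (k t)) isPreconnected_Ioo
      (hτ.comp (hkc.mono (Ioo_subset_Ioo hu hv)) hms) (fun x hx => h1 _ (hms hx)) hs ht
  have hp : ∀ t : ℝ, 0 < t → t < 1 → τ (k t) = τ (k ((1 / 2 : ℝ) : ℂ)) := fun t h0 h1 =>
    hside 0 1 (by norm_num) le_rfl (by simp) t ⟨h0, h1⟩ _ (by norm_num)
  have hm : ∀ t : ℝ, 0 < t → t < 1 → τ (k ((-t : ℝ) : ℂ)) = τ (k ((-(1 / 2) : ℝ) : ℂ)) := fun t h0 h1 =>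
    hside (-1) 0 le_rfl (by norm_num) (by simp) (-t) ⟨by linarith, by linarith⟩ _ (by norm_num)
  have sp := h1 _ (hmem (1 / 2) (by norm_num [abs_lt]) (by norm_num))
  have sm := h1 _ (hmem (-(1 / 2)) (by norm_num [abs_lt]) (by norm_num))
  have hopp : τ (k ((-(1 / 2) : ℝ) : ℂ)) = - τ (k ((1 / 2 : ℝ) : ℂ)) := by
    rcases sq_eq_sq_iff_eq_or_eq_neg.1 (sm.trans sp.symm) with h | h
    · exfalso
      obtain ⟨x, hx, y, hy, hxy⟩ := hne
      have : ∀ x ∈ S, τ x = τ (k ((1 / 2 : ℝ) : ℂ)) := by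
        intro x hx
        rcases boundary_patch_cases hk hx.1 with h' | ⟨t, h0, h1, h' | h'⟩
        · exact absurd h' hx.2
        · rw [h', hp t h0 h1]
        · rw [h', hm t h0 h1, h]
      exact hxy ((this x hx).trans (this y hy).symm)
    · exact h
  refine ⟨τ (k ((1 / 2 : ℝ) : ℂ)), sp, fun x hx => ?_⟩
  rcases boundary_patch_cases hk hx.1 with h' | ⟨t, h0, h1, h' | h'⟩
  · exact absurd h' hx.2
  · rw [h', hp t h0 h1, (hr t h0 h1).1]
  · rw [h', hm t h0 h1, (hr t h0 h1).2, hopp]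
    ring

theorem exists_pair_root {X : Type*} [TopologicalSpace X] [T2Space X] [CompactSpace X] (hX : IsSurface X)
    {b : Set X} (hb : b ∈ surfaceBoundaryComponents X) {c : ℝ → X} (hc : Continuous c) (hcr : range c = b)
    (hce : ∀ x y, c x = c y ↔ ∃ n : ℤ, x - y = n) {a : ℝ} (ha0 : 0 < a) (ha1 : a < 1) {k₃ k₄ : ℂ → X}
    (hk₃ : IsPatch cHalf k₃) (hk₄ : IsPatch cHalf k₄) (h₃ : k₃ 0 = c 0) (h₄ : k₄ 0 = c a)
    (hd : Disjoint (k₃ '' pdisc cHalf) (k₄ '' pdisc cHalf)) {e : ℤ} (he : e = 1 ∨ e = -1) :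
    ∃ s : X → ℂ, ContinuousOn s (surfaceBoundary X) ∧
      (∀ x ∈ surfaceBoundary X, s x ^ 2 = patchExt cHalf k₃ cay x * patchExt cHalf k₄ cay x ^ e) ∧
      ∀ x ∈ Ioo 0 a, ∀ y ∈ Ioo a 1, c x ∉ k₃ '' pdisc cHalf ∪ k₄ '' pdisc cHalf →
        c y ∉ k₃ '' pdisc cHalf ∪ k₄ '' pdisc cHalf → s (c x) ≠ s (c y) := by
  classical
  obtain ⟨hbs, hbcl, O, hO, hOb⟩ := boundary_component_clopen hX hb
  have hsub : ball (0 : ℂ) 1 ∩ cHalf ⊆ pdisc cHalf := fun z hz => ⟨ball_subset_closedBall hz.1, hz.2⟩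
  have h0m : (0 : ℂ) ∈ ball (0 : ℂ) 1 ∩ cHalf := ⟨by simp, by simp [cHalf]⟩
  have hcM : ∀ t, c t ∈ surfaceBoundary X := fun t => hbs (hcr ▸ mem_range_self t)
  have hcI : ∀ {x y : ℝ}, x ∈ Ico (0 : ℝ) 1 → y ∈ Ico (0 : ℝ) 1 → c x = c y → x = y := by
    intro x y hx hy h
    obtain ⟨n, hn⟩ := (hce _ _).1 h
    have h1 : (n : ℝ) < 1 := by rw [← hn]; linarith [hx.2, hy.1]
    have h2 : (-1 : ℝ) < n := by rw [← hn]; linarith [hx.1, hy.2]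
    have h3 : n = 0 := by
      have : n < 1 := by exact_mod_cast h1
      have : -1 < n := by exact_mod_cast h2
      omega
    rw [h3] at hn
    simpa [sub_eq_zero] using hn
  have hc10 : c 1 = c 0 := (hce _ _).2 ⟨1, by simp⟩
  set M := surfaceBoundary X with hM
  let τ : X → ℂ := fun x => if x ∈ c '' Ioo 0 a then -1 else 1
  have τ1 : ∀ x ∈ Ioo 0 a, τ (c x) = -1 := fun x hx => if_pos ⟨x, hx, rfl⟩
  have τ2 : ∀ x ∈ Ioo a 1, τ (c x) = 1 := fun x hx => if_neg (by
    rintro ⟨y, hy, hxy⟩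
    have := hcI ⟨hy.1.le, hy.2.trans ha1⟩ ⟨ha0.le.trans hx.1.le, hx.2⟩ hxy
    linarith [hy.2, hx.1])
  have τsq : ∀ x, τ x ^ 2 = 1 := fun x => by simp only [τ]; split_ifs <;> norm_num
  have cl1 : IsClosed (c '' Icc 0 a) := (isCompact_Icc.image hc).isClosed
  have cl2 : IsClosed (c '' Icc a 1 ∪ (M \ O)) :=
    (isCompact_Icc.image hc).isClosed.union ((isClosed_surfaceBoundary X).sdiff hO)
  have hcov : ∀ x ∈ M, x ∉ c '' Icc a 1 ∪ (M \ O) → x ∉ ({c 0, c a} : Set X) → x ∈ c '' Ioo 0 a := by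
    intro x hx hx1 hx2
    have hxb : x ∈ b := by
      rw [← hOb]
      exact ⟨by_contra fun h => hx1 (Or.inr ⟨hx, h⟩), hx⟩
    rw [← hcr] at hxb
    obtain ⟨t, rfl⟩ := hxb
    have hf : c t = c (Int.fract t) := (hce _ _).2 ⟨⌊t⌋, by rw [Int.fract]; ring⟩
    have f0 := Int.fract_nonneg t
    have f1 := Int.fract_lt_one t
    rw [hf] at hx1 hx2 ⊢
    generalize Int.fract t = u at *
    refine ⟨u, ⟨lt_of_le_of_ne f0 ?_, lt_of_not_ge fun h => ?_⟩, rfl⟩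
    · rintro rfl
      exact hx2 (Or.inl rfl)
    · exact hx1 (Or.inl ⟨u, ⟨h, f1.le⟩, rfl⟩)
  have hdisj : ∀ x, x ∈ c '' Icc 0 a → x ∈ c '' Icc a 1 ∪ (M \ O) → x ∈ ({c 0, c a} : Set X) := by
    rintro _ ⟨x, hx, rfl⟩ (⟨y, hy, hxy⟩ | h)
    · rcases hy.2.eq_or_lt with h | h
      · rw [h, hc10] at hxy
        exact Or.inl hxy.symm
      · have := hcI ⟨ha0.le.trans hy.1, h⟩ ⟨hx.1, hx.2.trans_lt ha1⟩ hxy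
        have : x = a := le_antisymm hx.2 (this ▸ hy.1)
        exact Or.inr (by rw [this]; rfl)
    · exact absurd (hOb ▸ (hcr ▸ mem_range_self x : c x ∈ b) : c x ∈ O ∩ M).1 h.2
  have τc : ContinuousOn τ (M \ {c 0, c a}) := by
    rintro x ⟨hx, hx'⟩
    by_cases h : x ∈ c '' Icc 0 a
    · have h2 : x ∉ c '' Icc a 1 ∪ (M \ O) := fun h2 => hx' (hdisj x h h2)
      refine (continuousWithinAt_const (b := (-1 : ℂ))).congr_of_eventuallyEq ?_ (if_pos (hcov x hx h2 hx'))
      filter_upwards [self_mem_nhdsWithin, mem_nhdsWithin_of_mem_nhds (cl2.isOpen_compl.mem_nhds h2)] with y hy hy'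
      exact if_pos (hcov y hy.1 hy' hy.2)
    · refine (continuousWithinAt_const (b := (1 : ℂ))).congr_of_eventuallyEq ?_
        (if_neg fun h' => h (image_mono Ioo_subset_Icc_self h'))
      filter_upwards [mem_nhdsWithin_of_mem_nhds (cl1.isOpen_compl.mem_nhds h)] with y hy
      exact if_neg fun h' => hy (image_mono Ioo_subset_Icc_self h')
  have hnear : ∀ (t : ℝ) (U : Set X), IsOpen U → c t ∈ U → ∃ δ > 0, ∀ u, |u - t| < δ → c u ∈ U := by
    intro t U hU ht
    obtain ⟨δ, hδ, h⟩ := Metric.mem_nhds_iff.1 (hc.continuousAt.preimage_mem_nhds (hU.mem_nhds ht))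
    exact ⟨δ, hδ, fun u hu => h (by rwa [mem_ball, Real.dist_eq])⟩
  have ne04 : c 0 ≠ c a := fun h => ha0.ne (hcI ⟨le_rfl, one_pos⟩ ⟨ha0.le, ha1⟩ h)
  have i3 : c 0 ∈ k₃ '' (ball 0 1 ∩ cHalf) := ⟨0, h0m, h₃⟩
  have i4 : c a ∈ k₄ '' (ball 0 1 ∩ cHalf) := ⟨0, h0m, h₄⟩
  have n3 : ∀ x ∈ k₃ '' pdisc cHalf, x ∉ k₄ '' pdisc cHalf := fun x h h' => disjoint_left.1 hd h h'
  obtain ⟨r₃, ρ₃, r₃c, ρ₃c, r₃s, ρ₃s, r₃o, r₃j⟩ := exists_twist_root hk₃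
  obtain ⟨r₄, ρ₄, r₄c, ρ₄c, r₄s, ρ₄s, r₄o, r₄j⟩ := exists_twist_root hk₄
  have S3 : (M ∩ k₃ '' (ball 0 1 ∩ cHalf)) \ {k₃ 0} ⊆ M \ {c 0, c a} := by
    rintro x ⟨hx, hx0⟩
    refine ⟨hx.1, ?_⟩
    rintro (h | h)
    · exact hx0 (by rw [h₃]; exact h)
    · exact n3 x (image_mono hsub hx.2) (by rw [mem_singleton_iff.1 h]; exact image_mono hsub i4)
  have S4 : (M ∩ k₄ '' (ball 0 1 ∩ cHalf)) \ {k₄ 0} ⊆ M \ {c 0, c a} := by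
    rintro x ⟨hx, hx0⟩
    refine ⟨hx.1, ?_⟩
    rintro (h | h)
    · exact n3 x (by rw [h]; exact image_mono hsub i3) (image_mono hsub hx.2)
    · exact hx0 (by rw [h₄]; exact h)
  obtain ⟨ε₃, hε₃, hj₃⟩ := exists_sign_at_jump hk₃ r₃j (τc.mono S3) (fun x _ => τsq x) (by
    obtain ⟨δ, hδ, h⟩ := hnear 0 _ hk₃.isOpen_interior i3
    obtain ⟨u, hu0, hu⟩ := exists_between (lt_min hδ (lt_min ha0 (sub_pos.2 ha1)))
    simp only [lt_min_iff] at hu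
    have m : c (1 - u) = c (-u) := (hce _ _).2 ⟨1, by simp⟩
    refine ⟨c u, ⟨⟨hcM _, h u (by rw [sub_zero, abs_of_pos hu0]; exact hu.1)⟩, ?_⟩, c (1 - u), ⟨⟨hcM _, ?_⟩, ?_⟩, ?_⟩
    · rw [h₃, mem_singleton_iff]
      exact fun h => hu0.ne' (hcI ⟨hu0.le, hu.2.1.trans ha1⟩ ⟨le_rfl, one_pos⟩ h)
    · rw [m]
      exact h _ (by rw [sub_zero, abs_neg, abs_of_pos hu0]; exact hu.1)
    · rw [h₃, mem_singleton_iff]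
      exact fun h => (by linarith [hu.2.2] : 1 - u ≠ 0) (hcI ⟨by linarith [hu.2.2], by linarith⟩ ⟨le_rfl, one_pos⟩ h)
    · rw [τ1 u ⟨hu0, hu.2.1⟩, τ2 (1 - u) ⟨by linarith [hu.2.2], by linarith⟩]
      norm_num)
  obtain ⟨ε₄, hε₄, hj₄⟩ := exists_sign_at_jump hk₄ r₄j (τc.mono S4) (fun x _ => τsq x) (by
    obtain ⟨δ, hδ, h⟩ := hnear a _ hk₄.isOpen_interior i4
    obtain ⟨u, hu0, hu⟩ := exists_between (lt_min hδ (lt_min ha0 (sub_pos.2 ha1)))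
    simp only [lt_min_iff] at hu
    refine ⟨c (a - u), ⟨⟨hcM _, h _ (by rw [sub_sub_cancel_left, abs_neg, abs_of_pos hu0]; exact hu.1)⟩, ?_⟩, c (a + u),
      ⟨⟨hcM _, h _ (by rw [add_sub_cancel_left, abs_of_pos hu0]; exact hu.1)⟩, ?_⟩, ?_⟩
    · rw [h₄, mem_singleton_iff]
      exact fun h => hu0.ne' (by linarith [hcI ⟨by linarith, by linarith⟩ ⟨ha0.le, ha1⟩ h])
    · rw [h₄, mem_singleton_iff]
      exact fun h => hu0.ne' (by linarith [hcI ⟨by linarith, by linarith⟩ ⟨ha0.le, ha1⟩ h])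
    · rw [τ1 (a - u) ⟨by linarith, by linarith⟩, τ2 (a + u) ⟨by linarith, by linarith⟩]
      norm_num)
  have τe : ∀ x, τ x ^ e = τ x := fun x => by
    rcases he with rfl | rfl
    · simp
    · rcases sq_eq_one_iff.1 (τsq x) with h | h <;> rw [h] <;> norm_num
  let s : X → ℂ := fun x => if x = c 0 then ε₃ * ρ₃ x else if x = c a then (ε₄ * ρ₄ x) ^ e else τ x * r₃ x * r₄ x ^ e
  have s3 : ∀ x ∈ M ∩ k₃ '' (ball 0 1 ∩ cHalf), s x = ε₃ * ρ₃ x := by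
    intro x hx
    by_cases h : x = c 0
    · exact if_pos h
    · have h' := S3 ⟨hx, by rwa [h₃]⟩
      have ha : x ≠ c a := fun h2 => h'.2 (Or.inr h2)
      simp only [s]
      rw [if_neg h, if_neg ha, r₄o x (n3 x (image_mono hsub hx.2)), one_zpow, mul_one]
      exact hj₃ x ⟨hx, by rwa [h₃]⟩
  have s4 : ∀ x ∈ M ∩ k₄ '' (ball 0 1 ∩ cHalf), s x = (ε₄ * ρ₄ x) ^ e := by
    intro x hx
    have h0 : x ≠ c 0 := by
      rintro rfl
      exact n3 _ (image_mono hsub i3) (image_mono hsub hx.2)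
    by_cases h : x = c a
    · simp only [s]
      rw [if_neg h0, if_pos h]
    · simp only [s]
      rw [if_neg h0, if_neg h, r₃o x (fun h => n3 x h (image_mono hsub hx.2)), mul_one,
        ← hj₄ x ⟨hx, by rwa [h₄]⟩, mul_zpow, τe]
  have ρ4ne : ∀ x ∈ M ∩ k₄ '' (ball 0 1 ∩ cHalf), ε₄ * ρ₄ x ≠ 0 := by
    intro x hx h
    have := congr_arg (· ^ 2) h
    simp only [mul_pow, hε₄, ρ₄s x hx, one_mul] at this
    exact patchExt_cay_ne_zero hk₄ hx.1 (by simpa using this)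
  refine ⟨s, ?_, ?_, ?_⟩
  · intro x hx
    by_cases h0 : x = c 0
    · have hx3 : x ∈ k₃ '' (ball 0 1 ∩ cHalf) := h0 ▸ i3
      refine ContinuousWithinAt.mono_of_mem_nhdsWithin (t := M ∩ k₃ '' (ball 0 1 ∩ cHalf)) ?_
        (inter_mem_nhdsWithin _ (hk₃.isOpen_interior.mem_nhds hx3))
      exact ((continuousOn_const.mul ρ₃c).congr s3) x ⟨hx, hx3⟩
    by_cases ha : x = c a
    · have hx4 : x ∈ k₄ '' (ball 0 1 ∩ cHalf) := ha ▸ i4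
      refine ContinuousWithinAt.mono_of_mem_nhdsWithin (t := M ∩ k₄ '' (ball 0 1 ∩ cHalf)) ?_
        (inter_mem_nhdsWithin _ (hk₄.isOpen_interior.mem_nhds hx4))
      exact (((continuousOn_const.mul ρ₄c).zpow₀ e fun x hx => Or.inl (ρ4ne x hx)).congr s4) x ⟨hx, hx4⟩
    · have hop : ({c 0, c a} : Set X)ᶜ ∈ 𝓝 x :=
        (toFinite _).isClosed.isOpen_compl.mem_nhds (by rintro (h | h); exacts [h0 h, ha h])
      refine ContinuousWithinAt.mono_of_mem_nhdsWithin (t := M \ {c 0, c a}) ?_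
        (inter_mem_nhdsWithin _ hop)
      have c3 : ContinuousOn r₃ (M \ {c 0, c a}) :=
        r₃c.mono fun y hy => ⟨hy.1, fun h => hy.2 (Or.inl (by rw [mem_singleton_iff.1 h, h₃]))⟩
      have c4 : ContinuousOn r₄ (M \ {c 0, c a}) :=
        r₄c.mono fun y hy => ⟨hy.1, fun h => hy.2 (Or.inr (by rw [mem_singleton_iff.1 h, h₄]; rfl))⟩
      have r4ne : ∀ y ∈ M \ {c 0, c a}, r₄ y ≠ 0 := by
        intro y hy h
        have := r₄s y hy.1 fun h => hy.2 (Or.inr (by rw [h, h₄]; rfl))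
        rw [h] at this
        exact patchExt_cay_ne_zero hk₄ hy.1 (by rw [← this]; norm_num)
      have := (τc.mul c3).mul (c4.zpow₀ e fun y hy => Or.inl (r4ne y hy))
      refine (this.congr fun y hy => ?_) x ⟨hx, by rintro (h | h); exacts [h0 h, ha h]⟩
      have h0 : y ≠ c 0 := fun h => hy.2 (Or.inl h)
      have h1 : y ≠ c a := fun h => hy.2 (Or.inr h)
      simp only [s]
      rw [if_neg h0, if_neg h1]
      rfl
  · intro x hx
    by_cases h0 : x = c 0
    · have hx3 : x ∈ M ∩ k₃ '' (ball 0 1 ∩ cHalf) := ⟨hx, h0 ▸ i3⟩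
      rw [s3 x hx3, mul_pow, hε₃, ρ₃s x hx3, patchExt_of_notMem _ (n3 x (image_mono hsub hx3.2)), one_zpow]
      ring
    by_cases ha : x = c a
    · have hx4 : x ∈ M ∩ k₄ '' (ball 0 1 ∩ cHalf) := ⟨hx, ha ▸ i4⟩
      rw [s4 x hx4, patchExt_of_notMem _ (fun h => n3 x h (image_mono hsub hx4.2)), one_mul, ← ρ₄s x hx4,
        ← zpow_natCast, ← zpow_natCast, ← zpow_mul, mul_zpow, mul_comm e, zpow_mul, zpow_natCast, hε₄, one_zpow,
        one_mul, ← zpow_mul]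
    · simp only [s]
      rw [if_neg h0, if_neg ha, mul_pow, mul_pow, τsq, one_mul, r₃s x hx (by rwa [h₃]), ← r₄s x hx (by rwa [h₄]),
        ← zpow_natCast, ← zpow_natCast, ← zpow_mul, ← zpow_mul, mul_comm e]
  · intro x hx y hy hxp hyp
    have e0 : ∀ z ∉ k₃ '' pdisc cHalf ∪ k₄ '' pdisc cHalf, s z = τ z := by
      intro z hz
      have h0 : z ≠ c 0 := by rintro rfl; exact hz (Or.inl (image_mono hsub i3))
      have ha : z ≠ c a := by rintro rfl; exact hz (Or.inr (image_mono hsub i4))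
      simp only [s]
      rw [if_neg h0, if_neg ha, r₃o z fun h => hz (Or.inl h), r₄o z fun h => hz (Or.inr h)]
      simp
    rw [e0 _ hxp, e0 _ hyp, τ1 x hx, τ2 y hy]
    norm_num

/-! ### Short geodesics between boundary points -/

theorem IsSurface.locallyPathConnectedSpace {X : Type*} [TopologicalSpace X] (hX : IsSurface X) :
    LocallyPathConnectedSpace X := by
  classical
  have hconv : Convex ℝ HalfPlane := by
    intro x hx y hy a b ha hb _
    simp only [HalfPlane, mem_ofPred_eq] at hx hy ⊢
    simp only [Prod.snd_add, Prod.smul_snd, smul_eq_mul]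
    positivity
  have : LocallyPathConnectedSpace HalfPlane := Convex.locallyPathConnectedSpace _ hconv
  choose U V hU hxU hV φ using hX
  let ch : X → OpenPartialHomeomorph X HalfPlane := fun x =>
    haveI : Nonempty (U x) := ⟨⟨x, hxU x⟩⟩
    haveI : Nonempty (V x) := ⟨(φ x).some ⟨x, hxU x⟩⟩
    ((hU x).isOpenEmbedding_subtypeVal.toOpenPartialHomeomorph _).symm.trans
      (((φ x).some.toOpenPartialHomeomorph).trans
        ((hV x).isOpenEmbedding_subtypeVal.toOpenPartialHomeomorph _))
  let cs : ChartedSpace HalfPlane X :=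
    { atlas := range ch, chartAt := ch, mem_chart_source := fun x => by simp [ch, hxU x],
      chart_mem_atlas := fun x => ⟨x, rfl⟩ }
  exact ChartedSpace.locallyPathConnectedSpace HalfPlane X

/-- A curve which is an isometric embedding of `[0, d]`. -/
def IsGeod {X : Type*} [MetricSpace X] (γ : ℝ → X) (d : ℝ) : Prop :=
  0 ≤ d ∧ ∀ s ∈ Icc 0 d, ∀ t ∈ Icc 0 d, dist (γ s) (γ t) = |s - t|

/-- Square roots along the boundary cannot change sign across a short geodesic. -/
def GoodHop (X : Type*) [MetricSpace X] (ε : ℝ) : Prop :=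
  ∀ w s : X → ℂ, Continuous w → (∀ x, w x ≠ 0) → ContinuousOn s (surfaceBoundary X) →
    (∀ x ∈ surfaceBoundary X, s x ^ 2 = w x) → ∀ (d : ℝ) (γ : ℝ → X), IsGeod γ d → d < ε →
    γ 0 ∈ surfaceBoundary X → γ d ∈ surfaceBoundary X → (∀ t ∈ Icc 0 d, w (γ t) = 1) → s (γ 0) = s (γ d)

section

variable {X : Type*} [MetricSpace X]

theorem IsGeod.continuousOn {γ : ℝ → X} {d : ℝ} (h : IsGeod γ d) : ContinuousOn γ (Icc 0 d) := by
  have : LipschitzOnWith 1 γ (Icc 0 d) := LipschitzOnWith.of_dist_le_mul fun s hs t ht => by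
    rw [h.2 s hs t ht, Real.dist_eq]; simp
  exact this.continuousOn

theorem IsGeod.left_mem {γ : ℝ → X} {d : ℝ} (h : IsGeod γ d) : (0 : ℝ) ∈ Icc 0 d := ⟨le_rfl, h.1⟩

theorem IsGeod.right_mem {γ : ℝ → X} {d : ℝ} (h : IsGeod γ d) : d ∈ Icc 0 d := ⟨h.1, le_rfl⟩

theorem IsGeod.isCompact {γ : ℝ → X} {d : ℝ} (h : IsGeod γ d) : IsCompact (γ '' Icc 0 d) :=
  isCompact_Icc.image_of_continuousOn h.continuousOn

theorem GoodHop.same_component (hX : IsSurface X) {ε : ℝ} (hg : GoodHop X ε) {b : Set X}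
    (hb : b ∈ surfaceBoundaryComponents X) {d : ℝ} {γ : ℝ → X} (hγ : IsGeod γ d) (hd : d < ε)
    (h0 : γ 0 ∈ b) (h1 : γ d ∈ surfaceBoundary X) : γ d ∈ b := by
  classical
  obtain ⟨hbs, hbc, O, hO, hOb⟩ := boundary_component_clopen hX hb
  by_contra hn
  have := hg (fun _ => 1) (fun x => if x ∈ b then 1 else -1) continuous_const (fun _ => one_ne_zero) ?_
    (fun x _ => by split_ifs <;> norm_num) d γ hγ hd (hbs h0) h1 (fun _ _ => rfl)
  · simp only [if_pos h0, if_neg hn] at this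
    norm_num at this
  · intro x hx
    by_cases hxb : x ∈ b
    · refine (continuousWithinAt_const (b := (1 : ℂ))).congr_of_eventuallyEq ?_ (if_pos hxb)
      have hxO : x ∈ O := (hOb ▸ hxb : x ∈ O ∩ surfaceBoundary X).1
      filter_upwards [mem_nhdsWithin_of_mem_nhds (hO.mem_nhds hxO), self_mem_nhdsWithin] with y hy hy'
      exact if_pos (hOb ▸ ⟨hy, hy'⟩)
    · refine (continuousWithinAt_const (b := (-1 : ℂ))).congr_of_eventuallyEq ?_ (if_neg hxb)
      filter_upwards [mem_nhdsWithin_of_mem_nhds (hbc.isOpen_compl.mem_nhds hxb)] with y hy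
      exact if_neg hy

theorem GoodHop.not_separated [CompactSpace X] (hX : IsSurface X) {ε : ℝ} (hg : GoodHop X ε) {b : Set X}
    (hb : b ∈ surfaceBoundaryComponents X) {c : ℝ → X} (hc : Continuous c) (hcr : range c = b)
    (hce : ∀ x y, c x = c y ↔ ∃ n : ℤ, x - y = n) {a x y : ℝ} (hx : x ∈ Ioo 0 a) (hy : y ∈ Ioo a 1)
    {d : ℝ} {γ : ℝ → X} (hγ : IsGeod γ d) (hd : d < ε)
    (h0 : γ 0 = c x) (h1 : γ d = c y) {Q : Set X} (hQ : IsPreconnected Q) (hQ0 : c 0 ∈ Q) (hQa : c a ∈ Q)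
    (hdis : Disjoint (γ '' Icc 0 d) Q) : False := by
  have hbs := (boundary_component_clopen hX hb).1
  have := hX.locallyPathConnectedSpace
  have hKo : IsOpen (γ '' Icc 0 d)ᶜ := hγ.isCompact.isClosed.isOpen_compl
  set G := connectedComponentIn (γ '' Icc 0 d)ᶜ (c 0) with hGdef
  have hG : IsOpen G := hKo.connectedComponentIn
  have hQG : Q ⊆ G := hQ.subset_connectedComponentIn hQ0 hdis.symm.subset_compl_right
  have hGsub : G ⊆ (γ '' Icc 0 d)ᶜ := connectedComponentIn_subset _ _
  have hne : c 0 ≠ c a := by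
    intro h
    obtain ⟨n, hn⟩ := (hce _ _).1 h
    have h1 : (0 : ℝ) < a := hx.1.trans hx.2
    have h2 : a < 1 := hy.1.trans hy.2
    have h3 : ((-1 : ℤ) : ℝ) < n := by rw [← hn]; push_cast; linarith
    have h4 : (n : ℝ) < ((0 : ℤ) : ℝ) := by rw [← hn]; push_cast; linarith
    rw [Int.cast_lt] at h3 h4
    omega
  obtain ⟨O₃, O₄, hO₃, hO₄, m₃, m₄, hO⟩ := t2_separation hne
  have hcb : ∀ t, c t ∈ surfaceBoundary X := fun t => hbs (hcr ▸ mem_range_self t)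
  obtain ⟨k₃, hk₃, h₃, s₃⟩ := exists_half_patch hX (hcb 0) (hO₃.inter hG) ⟨m₃, hQG hQ0⟩
  obtain ⟨k₄, hk₄, h₄, s₄⟩ := exists_half_patch hX (hcb a) (hO₄.inter hG) ⟨m₄, hQG hQa⟩
  obtain ⟨w, hw, hw0, hw1, e, he, hwe⟩ := exists_twist hX hG isPreconnected_connectedComponentIn hk₃ hk₄
    (fun z hz => (s₃ hz).2) (fun z hz => (s₄ hz).2)
  obtain ⟨s, hs, hs2, hsne⟩ := exists_pair_root hX hb hc hcr hce (hx.1.trans hx.2) (hy.1.trans hy.2) hk₃ hk₄ h₃ h₄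
    (hO.mono (fun z hz => (s₃ hz).1) fun z hz => (s₄ hz).1) he
  have hnot : ∀ t ∈ Icc 0 d, γ t ∉ k₃ '' pdisc cHalf ∪ k₄ '' pdisc cHalf := by
    rintro t ht (h | h)
    · exact hGsub (s₃ h).2 (mem_image_of_mem _ ht)
    · exact hGsub (s₄ h).2 (mem_image_of_mem _ ht)
  have hl := hγ.left_mem
  have hr := hγ.right_mem
  refine hsne x hx y hy (h0 ▸ hnot 0 hl) (h1 ▸ hnot d hr) ?_
  rw [← h0, ← h1]
  refine hg w s hw hw0 hs (fun z hz => by rw [hs2 z hz, hwe z hz]) d γ hγ hd (h0 ▸ hcb x) (h1 ▸ hcb y) ?_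
  exact fun t ht => hw1 _ fun h => hGsub h (mem_image_of_mem _ ht)

/-- Two boundary points joined by a short geodesic avoiding `Q`. -/
def HopAvoid {X : Type*} [MetricSpace X] (ε : ℝ) (Q : Set X) (u v : X) : Prop :=
  u ∈ surfaceBoundary X ∧ v ∈ surfaceBoundary X ∧
    ∃ (d : ℝ) (γ : ℝ → X), IsGeod γ d ∧ d < ε ∧ γ 0 = u ∧ γ d = v ∧ Disjoint (γ '' Icc 0 d) Q

theorem not_int_of_Ioo {r : ℝ} (h0 : 0 < r) (h1 : r < 1) : ¬ ∃ n : ℤ, r = n := by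
  rintro ⟨n, rfl⟩
  have h0' : (0 : ℤ) < n := by exact_mod_cast h0
  have h1' : n < 1 := by exact_mod_cast h1
  omega

/-- Three points cannot pairwise be joined past short chains from the third one to a fourth point. -/
theorem GoodHop.planar {X : Type*} [MetricSpace X] [CompactSpace X] (hX : IsSurface X) {ε : ℝ} (hg : GoodHop X ε)
    {p : X} {m : Fin 3 → X} (hm : ∀ k, m k ∈ surfaceBoundary X)
    (hp : ∀ k, m k ≠ p)
    (H : ∀ k i j, i ≠ j → i ≠ k → j ≠ k → ∃ Q, IsPreconnected Q ∧ m i ∈ Q ∧ m j ∈ Q ∧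
      Relation.ReflTransGen (HopAvoid ε Q) (m k) p) (hinj : Function.Injective m) : False := by
  set b := connectedComponentIn (surfaceBoundary X) p with hbdef
  have hmp : ∀ k, ∃ Q, Relation.ReflTransGen (HopAvoid ε Q) (m k) p := fun k => by
    obtain ⟨Q, -, -, -, h⟩ := H k (k + 1) (k + 2) (by fin_cases k <;> decide) (by fin_cases k <;> decide)
      (by fin_cases k <;> decide)
    exact ⟨Q, h⟩
  have hmem : ∀ k, p ∈ connectedComponentIn (surfaceBoundary X) (m k) := by
    intro k
    obtain ⟨Q, hQ⟩ := hmp k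
    suffices ∀ u, Relation.ReflTransGen (HopAvoid ε Q) (m k) u →
        u ∈ connectedComponentIn (surfaceBoundary X) (m k) from this p hQ
    intro u hu
    induction hu with
    | refl => exact mem_connectedComponentIn (hm k)
    | tail _ h ih =>
      obtain ⟨-, hv, d, γ, hγ, hd, h0, h1, -⟩ := h
      rw [← h1]
      exact hg.same_component hX ⟨m k, hm k, rfl⟩ hγ hd (h0 ▸ ih) (h1 ▸ hv)
  have hpB : p ∈ surfaceBoundary X := connectedComponentIn_subset _ _ (hmem 0)
  have hb : b ∈ surfaceBoundaryComponents X := ⟨p, hpB, rfl⟩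
  have hmb : ∀ k, m k ∈ b := fun k => by
    rw [hbdef, ← connectedComponentIn_eq (hmem k)]
    exact mem_connectedComponentIn (hm k)
  obtain ⟨c, hc, hcr, hce⟩ := exists_boundary_circle hX hb
  obtain ⟨t₀, ht₀⟩ : p ∈ range c := hcr ▸ mem_connectedComponentIn hpB
  have hτ : ∀ k, ∃ τ ∈ Ioo (0 : ℝ) 1, c (t₀ + τ) = m k := by
    intro k
    obtain ⟨t, ht⟩ : m k ∈ range c := hcr ▸ hmb k
    have key : c (t₀ + Int.fract (t - t₀)) = m k := by
      rw [← ht, hce]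
      exact ⟨-⌊t - t₀⌋, by rw [Int.fract]; push_cast; ring⟩
    refine ⟨Int.fract (t - t₀), ⟨lt_of_le_of_ne (Int.fract_nonneg _) fun h => ?_, Int.fract_lt_one _⟩, key⟩
    rw [← h, add_zero, ht₀] at key
    exact hp k key.symm
  choose τ hτ hcτ using hτ
  have hτi : Function.Injective τ := fun i j h => hinj (by rw [← hcτ, ← hcτ, h])
  obtain ⟨i, k, j, hij, hik, hjk, h1, h2⟩ : ∃ i k j : Fin 3, i ≠ j ∧ i ≠ k ∧ j ≠ k ∧ τ i < τ k ∧ τ k < τ j := by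
    have n01 : τ 0 ≠ τ 1 := fun h => absurd (hτi h) (by decide)
    have n02 : τ 0 ≠ τ 2 := fun h => absurd (hτi h) (by decide)
    have n12 : τ 1 ≠ τ 2 := fun h => absurd (hτi h) (by decide)
    rcases lt_or_gt_of_ne n01 with a | a <;> rcases lt_or_gt_of_ne n02 with b | b <;>
      rcases lt_or_gt_of_ne n12 with c | c
    · exact ⟨0, 1, 2, by decide, by decide, by decide, a, c⟩
    · exact ⟨0, 2, 1, by decide, by decide, by decide, b, c⟩
    · linarith
    · exact ⟨2, 0, 1, by decide, by decide, by decide, b, a⟩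
    · exact ⟨1, 0, 2, by decide, by decide, by decide, a, b⟩
    · linarith
    · exact ⟨1, 2, 0, by decide, by decide, by decide, c, b⟩
    · exact ⟨2, 1, 0, by decide, by decide, by decide, c, a⟩
  obtain ⟨Q, hQ, hQi, hQj, hch⟩ := H k i j hij hik hjk
  let c' : ℝ → X := fun t => c (t + (t₀ + τ i))
  have hc' : Continuous c' := hc.comp (by fun_prop)
  have hcr' : range c' = b := by
    rw [← hcr]
    exact (Equiv.addRight (t₀ + τ i)).surjective.range_comp c
  have hce' : ∀ x y, c' x = c' y ↔ ∃ n : ℤ, x - y = n := fun x y => by simp [c', hce]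
  have e0 : c' 0 = m i := by simp [c', hcτ]
  have ej : c' (τ j - τ i) = m j := by rw [← hcτ j]; simp only [c']; congr 1; ring
  have ek : c' (τ k - τ i) = m k := by rw [← hcτ k]; simp only [c']; congr 1; ring
  have ep : c' (1 - τ i) = p := by
    rw [← ht₀]; simp only [c']; rw [hce]; exact ⟨1, by push_cast; ring⟩
  have inv : ∀ u, Relation.ReflTransGen (HopAvoid ε Q) (m k) u → u ∈ c' '' Ioo 0 (τ j - τ i) := by
    intro u hu
    induction hu with
    | refl => exact ⟨_, ⟨by linarith, by linarith⟩, ek⟩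
    | @tail u v _ h ih =>
      obtain ⟨x, hx, hxu⟩ := ih
      obtain ⟨-, hv, d, γ, hγ, hd, h0, h1, hdis⟩ := h
      have hvb : v ∈ b := by
        rw [← h1]
        refine hg.same_component hX hb hγ hd ?_ (h1 ▸ hv)
        rw [h0, ← hxu, ← hcr']
        exact mem_range_self _
      obtain ⟨y, hy⟩ : v ∈ range c' := hcr' ▸ hvb
      have hyf : c' (Int.fract y) = v := by
        rw [← hy, hce']
        exact ⟨-⌊y⌋, by rw [Int.fract]; push_cast; ring⟩
      have hvQ : v ∉ Q := fun hq => hdis.le_bot ⟨⟨d, hγ.right_mem, h1⟩, hq⟩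
      have hy0 : 0 < Int.fract y := lt_of_le_of_ne (Int.fract_nonneg _) fun h => hvQ (by rw [← hyf, ← h, e0]; exact hQi)
      rcases lt_trichotomy (Int.fract y) (τ j - τ i) with hlt | heq | hgt
      · exact ⟨_, ⟨hy0, hlt⟩, hyf⟩
      · exact absurd (by rw [← hyf, heq, ej]; exact hQj) hvQ
      · exact (hg.not_separated hX hb hc' hcr' hce' hx ⟨hgt, Int.fract_lt_one y⟩ hγ hd (h0.trans hxu.symm)
          (h1.trans hyf.symm) hQ (e0 ▸ hQi) (ej ▸ hQj) hdis).elim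
  obtain ⟨x, hx, hxp⟩ := inv p hch
  have hi := hτ i
  have hj := hτ j
  rw [← ep, eq_comm, hce'] at hxp
  exact not_int_of_Ioo (by linarith [hx.1, hx.2, hj.2]) (by linarith [hx.1, hi.1]) hxp

end

/-! ### Geodesics in compact length spaces -/

section
variable {X : Type*} [MetricSpace X]

theorem IsLengthSpace.exists_approx_between (h : IsLengthSpace X) (x y : X) {t : ℝ} (ht0 : 0 ≤ t)
    (ht : t ≤ dist x y) {η : ℝ} (hη : 0 < η) : ∃ z, dist x z = t ∧ dist z y ≤ dist x y - t + η := by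
  have hlt : (⨅ γ : Path x y, pathLength γ) < ENNReal.ofReal (dist x y + η) := by
    rw [← h x y, edist_dist]
    exact (ENNReal.ofReal_lt_ofReal_iff (by positivity)).2 (by linarith)
  obtain ⟨γ, hγ⟩ := iInf_lt_iff.1 hlt
  obtain ⟨r, hr⟩ : ∃ r : I, dist x (γ r) = t := by
    have := intermediate_value_univ (0 : I) 1 (f := fun r => dist x (γ r)) (by fun_prop)
    simpa using this (show t ∈ Icc (dist x (γ 0)) (dist x (γ 1)) by simpa using ⟨ht0, ht⟩)
  refine ⟨γ r, hr, ?_⟩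
  have h1 : edist x (γ r) + edist (γ r) y ≤ pathLength γ := by
    have e1 := eVariationOn.edist_le (fun t => γ t) (s := Iic r) (show (0 : I) ∈ Iic r from r.2.1) (le_refl r)
    have e2 := eVariationOn.edist_le (fun t => γ t) (s := Ici r) (le_refl r) (show (1 : I) ∈ Ici r from r.2.2)
    have e3 := eVariationOn.union (fun t => γ t) (isGreatest_Iic (a := r)) (isLeast_Ici (a := r))
    rw [Iic_union_Ici] at e3
    simp only [γ.source, γ.target] at e1 e2
    rw [pathLength, e3]
    exact add_le_add e1 e2
  have h2 := h1.trans_lt hγ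
  rw [edist_dist, edist_dist, ← ENNReal.ofReal_add dist_nonneg dist_nonneg,
    ENNReal.ofReal_lt_ofReal_iff (by positivity), hr] at h2
  linarith

theorem IsLengthSpace.exists_between [CompactSpace X] (h : IsLengthSpace X) (x y : X) {t : ℝ} (ht0 : 0 ≤ t)
    (ht : t ≤ dist x y) : ∃ z, dist x z ≤ t ∧ dist z y ≤ dist x y - t := by
  have hc : IsCompact {z | dist x z = t} :=
    (isClosed_eq (by fun_prop) continuous_const).isCompact
  obtain ⟨z₀, hz₀, -⟩ := h.exists_approx_between x y ht0 ht one_pos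
  obtain ⟨z, hz, hmin⟩ := hc.exists_isMinOn ⟨z₀, hz₀⟩ (f := fun z => dist z y) (by fun_prop)
  refine ⟨z, le_of_eq hz, le_of_forall_pos_le_add fun η hη => ?_⟩
  obtain ⟨z', hz', hle⟩ := h.exists_approx_between x y ht0 ht hη
  exact (hmin hz').trans hle

theorem IsLengthSpace.exists_finite_geod [CompactSpace X] (h : IsLengthSpace X) (x y : X) (S : Finset ℝ)
    (hS : ∀ s ∈ S, s ∈ Icc 0 (dist x y)) :
    ∃ f : ℝ → X, f 0 = x ∧ f (dist x y) = y ∧ ∀ s ∈ insert 0 (insert (dist x y) S),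
      ∀ t ∈ insert 0 (insert (dist x y) S), s ≤ t → dist (f s) (f t) ≤ t - s := by
  classical
  induction S using Finset.induction_on with
  | empty =>
    refine ⟨fun t => if t ≤ 0 then x else y, by simp, ?_, ?_⟩
    · dsimp only
      split_ifs with h0
      · exact dist_le_zero.1 h0
      · rfl
    · simp only [Finset.mem_insert, Finset.notMem_empty, or_false]
      have hd := dist_nonneg (x := x) (y := y)
      rintro s (rfl | rfl) t (rfl | rfl) hst <;> split_ifs <;> first | linarith | simp_all
  | insert t S htS ih =>
    obtain ⟨f, f0, f1, hf⟩ := ih fun s hs => hS s (Finset.mem_insert_of_mem hs)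
    set T := insert 0 (insert (dist x y) S) with hT
    have ht := hS t (Finset.mem_insert_self _ _)
    by_cases htT : t ∈ T
    · refine ⟨f, f0, f1, ?_⟩
      have : insert 0 (insert (dist x y) (insert t S)) = T := by
        rw [Finset.insert_comm _ t, Finset.insert_comm _ t, ← hT, Finset.insert_eq_of_mem htT]
      rw [this]
      exact hf
    obtain ⟨a, ha, hamax⟩ := Finset.exists_max_image (T.filter (· ≤ t)) id ⟨0, by simp [hT, ht.1]⟩
    obtain ⟨b, hb, hbmin⟩ := Finset.exists_min_image (T.filter (t ≤ ·)) id ⟨dist x y, by simp [hT, ht.2]⟩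
    rw [Finset.mem_filter] at ha hb
    have hab := hf a ha.1 b hb.1 (ha.2.trans hb.2)
    obtain ⟨z, hz1, hz2⟩ : ∃ z, dist (f a) z ≤ t - a ∧ dist z (f b) ≤ b - t := by
      rcases le_total (t - a) (dist (f a) (f b)) with h1 | h1
      · obtain ⟨z, h2, h3⟩ := h.exists_between (f a) (f b) (by linarith [ha.2]) h1
        exact ⟨z, h2, by linarith⟩
      · exact ⟨f b, h1, by simpa using hb.2⟩
    have hlow : ∀ s ∈ T, s ≤ t → dist (f s) z ≤ t - s := fun s hs hst => by
      have := hf s hs a ha.1 (hamax s (Finset.mem_filter.2 ⟨hs, hst⟩))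
      linarith [dist_triangle (f s) (f a) z]
    have hupp : ∀ s ∈ T, t ≤ s → dist z (f s) ≤ s - t := fun s hs hst => by
      have := hf b hb.1 s hs (hbmin s (Finset.mem_filter.2 ⟨hs, hst⟩))
      linarith [dist_triangle z (f b) (f s)]
    have hneT : ∀ s ∈ T, s ≠ t := fun s hs h => htT (h ▸ hs)
    refine ⟨Function.update f t z, ?_, ?_, ?_⟩
    · rw [Function.update_of_ne (hneT 0 (by simp [hT])), f0]
    · rw [Function.update_of_ne (hneT _ (by simp [hT])), f1]
    · rw [Finset.insert_comm _ t, Finset.insert_comm _ t, ← hT]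
      intro s hs s' hs' hss
      rw [Finset.mem_insert] at hs hs'
      rcases hs with rfl | hs <;> rcases hs' with rfl | hs'
      · simp
      · rw [Function.update_self, Function.update_of_ne (hneT _ hs')]
        exact hupp _ hs' hss
      · rw [Function.update_self, Function.update_of_ne (hneT _ hs)]
        exact hlow _ hs hss
      · rw [Function.update_of_ne (hneT _ hs), Function.update_of_ne (hneT _ hs')]
        exact hf s hs s' hs' hss

theorem IsLengthSpace.exists_geod [CompactSpace X] (h : IsLengthSpace X) (x y : X) :
    ∃ γ : ℝ → X, IsGeod γ (dist x y) ∧ γ 0 = x ∧ γ (dist x y) = y := by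
  classical
  let J := {p : ℝ × ℝ // 0 ≤ p.1 ∧ p.1 ≤ p.2 ∧ p.2 ≤ dist x y}
  let K : J → Set (ℝ → X) := fun p => {f | f 0 = x ∧ f (dist x y) = y ∧ dist (f p.1.1) (f p.1.2) ≤ p.1.2 - p.1.1}
  have hKc : ∀ p, IsClosed (K p) := fun p => by
    have ev : ∀ r : ℝ, Continuous fun f : ℝ → X => f r := continuous_apply
    exact (isClosed_eq (ev _) continuous_const).inter
      ((isClosed_eq (ev _) continuous_const).inter (isClosed_le ((ev _).dist (ev _)) continuous_const))
  obtain ⟨f, hf⟩ := CompactSpace.iInter_nonempty hKc fun s => by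
    obtain ⟨f, f0, f1, hf⟩ := h.exists_finite_geod x y (s.image (fun p => p.1.1) ∪ s.image (fun p => p.1.2)) (by
      intro r hr
      rw [Finset.mem_union, Finset.mem_image, Finset.mem_image] at hr
      rcases hr with ⟨p, -, rfl⟩ | ⟨p, -, rfl⟩
      · exact ⟨p.2.1, p.2.2.1.trans p.2.2.2⟩
      · exact ⟨p.2.1.trans p.2.2.1, p.2.2.2⟩)
    refine ⟨f, mem_iInter₂.2 fun p hp => ⟨f0, f1, hf _ ?_ _ ?_ p.2.2.1⟩⟩
    · simp only [Finset.mem_insert, Finset.mem_union, Finset.mem_image]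
      exact Or.inr (Or.inr (Or.inl ⟨p, hp, rfl⟩))
    · simp only [Finset.mem_insert, Finset.mem_union, Finset.mem_image]
      exact Or.inr (Or.inr (Or.inr ⟨p, hp, rfl⟩))
  rw [mem_iInter] at hf
  have hd := dist_nonneg (x := x) (y := y)
  obtain ⟨f0, f1, -⟩ := hf ⟨(0, 0), le_rfl, le_rfl, hd⟩
  have hle : ∀ s t, 0 ≤ s → s ≤ t → t ≤ dist x y → dist (f s) (f t) ≤ t - s := fun s t h0 h1 h2 =>
    (hf ⟨(s, t), h0, h1, h2⟩).2.2
  have heq : ∀ s t, 0 ≤ s → s ≤ t → t ≤ dist x y → dist (f s) (f t) = t - s := fun s t h0 h1 h2 => by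
    refine (hle s t h0 h1 h2).antisymm ?_
    have e1 := hle 0 s le_rfl h0 (h1.trans h2)
    have e2 := hle t _ (h0.trans h1) h2 le_rfl
    rw [f0] at e1
    rw [f1] at e2
    linarith [dist_triangle4 x (f s) (f t) y]
  refine ⟨f, ⟨hd, fun s hs t ht => ?_⟩, f0, f1⟩
  rcases le_total s t with hst | hst
  · rw [heq s t hs.1 hst ht.2, abs_sub_comm, abs_of_nonneg (by linarith)]
  · rw [dist_comm, heq t s ht.1 hst hs.2, abs_of_nonneg (by linarith)]

end

/-! ### Line fields -/

/-- The square of a vector; it determines the vector up to sign. -/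
def sqTensor (v : ℂ × ℝ) : ℂ × ℂ × ℝ := (v.1 ^ 2, v.1 * v.2, v.2 ^ 2)

theorem continuous_sqTensor : Continuous sqTensor := by unfold sqTensor; fun_prop

theorem sqTensor_eq_iff {v v' : ℂ × ℝ} : sqTensor v = sqTensor v' ↔ v = v' ∨ v = -v' := by
  obtain ⟨a, r⟩ := v
  obtain ⟨a', r'⟩ := v'
  simp only [sqTensor, Prod.mk.injEq, Prod.neg_mk]
  constructor
  · rintro ⟨h1, h2, h3⟩
    by_cases ha : a' = 0
    · subst ha
      have : a = 0 := by simpa using h1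
      subst this
      rcases sq_eq_sq_iff_eq_or_eq_neg.1 h3 with h | h <;> simp [h]
    rcases sq_eq_sq_iff_eq_or_eq_neg.1 h1 with rfl | rfl
    · left
      exact ⟨rfl, by exact_mod_cast mul_left_cancel₀ ha h2⟩
    · right
      refine ⟨rfl, ?_⟩
      have := mul_left_cancel₀ ha (b := ((-r : ℝ) : ℂ)) (c := r') (by push_cast; linear_combination h2)
      have h4 : -r = r' := by exact_mod_cast this
      linarith
  · rintro (⟨rfl, rfl⟩ | ⟨rfl, rfl⟩)
    · simp
    · refine ⟨by ring, by push_cast; ring, by ring⟩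

theorem sqTensor_eq_zero_iff {v : ℂ × ℝ} : sqTensor v = 0 ↔ v = 0 := by
  rw [show (0 : ℂ × ℂ × ℝ) = sqTensor 0 by simp [sqTensor]; rfl, sqTensor_eq_iff]
  simp

theorem isProperMap_sqTensor : IsProperMap sqTensor := by
  rw [isProperMap_iff_tendsto_cocompact]
  refine ⟨continuous_sqTensor, ?_⟩
  rw [← Metric.cobounded_eq_cocompact, ← Metric.cobounded_eq_cocompact, ← tendsto_norm_atTop_iff_cobounded]
  refine tendsto_atTop_mono (f := fun v : ℂ × ℝ => ‖v‖ ^ 2) (fun v => ?_)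
    ((tendsto_pow_atTop two_ne_zero).comp tendsto_norm_cobounded_atTop)
  rcases max_choice ‖v.1‖ ‖v.2‖ with h | h <;> rw [Prod.norm_def, h, ← norm_pow]
  · exact norm_fst_le (sqTensor v)
  · exact (norm_snd_le (sqTensor v).2).trans (norm_snd_le (sqTensor v))

theorem sqTensor_restrict_isCoveringMap :
    IsCoveringMap ((range sqTensor \ {0}).restrictPreimage sqTensor) := by
  set R := range sqTensor \ {0}
  have hne : ∀ (u : ℤˣ) (v : ℂ × ℝ), v ∈ sqTensor ⁻¹' R → u • v ∈ sqTensor ⁻¹' R := by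
    intro u v hv
    rcases Int.units_eq_one_or u with rfl | rfl
    · simpa using hv
    · rw [Units.neg_smul, one_smul, mem_preimage, sqTensor_eq_iff.2 (Or.inr rfl)]
      exact hv
  let act : MulAction ℤˣ (sqTensor ⁻¹' R) :=
    { smul := fun u v => ⟨u • v.1, hne u _ v.2⟩
      one_smul := fun v => Subtype.ext (one_smul _ _)
      mul_smul := fun a b v => Subtype.ext (mul_smul _ _ _) }
  have hs : ∀ (u : ℤˣ) (v : sqTensor ⁻¹' R), ((u • v : sqTensor ⁻¹' R) : ℂ × ℝ) = u • (v : ℂ × ℝ) := fun _ _ => rfl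
  have hv0 : ∀ v : sqTensor ⁻¹' R, (v : ℂ × ℝ) ≠ 0 := fun v h => v.2.2 (by simp [h, sqTensor])
  refine IsQuotientCoveringMap.isCoveringMap _ ℤˣ ?_
  refine { toIsQuotientMap := ?_, continuous_const_smul := fun u => ?_, apply_eq_iff_mem_orbit := fun {v v'} => ?_,
           disjoint := fun v => ?_ }
  · refine (isProperMap_sqTensor.isClosedMap.restrictPreimage R).isQuotientMap
      (continuous_sqTensor.restrictPreimage) ?_
    rintro ⟨_, ⟨v, rfl⟩, h⟩
    exact ⟨⟨v, ⟨v, rfl⟩, h⟩, rfl⟩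
  · refine Continuous.subtype_mk ?_ _
    rcases Int.units_eq_one_or u with rfl | rfl
    · simp only [one_smul]; exact continuous_subtype_val
    · simp only [Units.neg_smul, one_smul]; exact continuous_subtype_val.neg
  · rw [Subtype.ext_iff, restrictPreimage_coe, restrictPreimage_coe, sqTensor_eq_iff, MulAction.mem_orbit_iff]
    constructor
    · rintro (h | h)
      · exact ⟨1, by rw [one_smul]; exact Subtype.ext h.symm⟩
      · exact ⟨-1, Subtype.ext (by rw [hs, h]; simp)⟩
    · rintro ⟨u, rfl⟩
      rw [hs]
      rcases Int.units_eq_one_or u with rfl | rfl <;> simp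
  · have hv : 0 < ‖(v : ℂ × ℝ)‖ := norm_pos_iff.2 (hv0 v)
    refine ⟨ball v ‖(v : ℂ × ℝ)‖, ball_mem_nhds _ hv, ?_⟩
    rintro u ⟨_, ⟨x, hx, rfl⟩, hx'⟩
    rcases Int.units_eq_one_or u with rfl | rfl
    · rfl
    exfalso
    rw [mem_ball, Subtype.dist_eq, dist_eq_norm] at hx hx'
    simp only [hs, Units.neg_smul, one_smul] at hx'
    have h1 : ‖(2 : ℝ) • (v : ℂ × ℝ)‖ ≤ ‖(x : ℂ × ℝ) - v‖ + ‖-(x : ℂ × ℝ) - v‖ := by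
      rw [show (2 : ℝ) • (v : ℂ × ℝ) = -((x : ℂ × ℝ) - v + (-(x : ℂ × ℝ) - v)) by rw [two_smul]; abel, norm_neg]
      exact norm_add_le _ _
    rw [norm_smul, Real.norm_eq_abs, abs_of_pos two_pos] at h1
    linarith

theorem exists_line_lift {A : Type*} [TopologicalSpace A] {F : I × A → ℂ × ℂ × ℝ} (hF : Continuous F)
    (hr : ∀ x, F x ∈ range sqTensor) (h0 : ∀ x, F x ≠ 0) {y : ℂ × ℂ × ℝ} (hy : ∀ a, F (0, a) = y) :
    ∃ Ψ : A → ℂ × ℝ, Continuous Ψ ∧ ∀ a, sqTensor (Ψ a) = F (1, a) := by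
  rcases isEmpty_or_nonempty A with hA | ⟨⟨a₀⟩⟩
  · exact ⟨fun _ => 0, continuous_const, fun a => hA.elim a⟩
  obtain ⟨v₀, hv₀⟩ := hr (0, a₀)
  let H : C(I × A, ↥(range sqTensor \ {0})) := ⟨fun x => ⟨F x, hr x, h0 x⟩, hF.subtype_mk _⟩
  have hv₀m : sqTensor v₀ ∈ range sqTensor \ {0} := ⟨⟨v₀, rfl⟩, fun h => h0 (0, a₀) (by rw [← hv₀]; exact h)⟩
  let f : C(A, ↥(sqTensor ⁻¹' (range sqTensor \ {0}))) := ContinuousMap.const A ⟨v₀, hv₀m⟩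
  have hH0 : ∀ a, H (0, a) = (range sqTensor \ {0}).restrictPreimage sqTensor (f a) := fun a => by
    apply Subtype.ext
    show F (0, a) = sqTensor v₀
    rw [hv₀, hy, hy]
  refine ⟨fun a => sqTensor_restrict_isCoveringMap.liftHomotopy H f hH0 (1, a), ?_, fun a => ?_⟩
  · exact continuous_subtype_val.comp ((map_continuous _).comp (by fun_prop))
  · have := congr_fun (sqTensor_restrict_isCoveringMap.liftHomotopy_lifts H f hH0) (1, a)
    exact congrArg Subtype.val this

section
variable {X D : Type*} [MetricSpace X] [MetricSpace D] {B : Set X} {ip im : X → D}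

theorem IsMetricDouble.eq_of_eq (hD : IsMetricDouble X B D ip im) (hB : IsCompact B) (hne : B.Nonempty)
    {a b : X} (h : ip a = im b) : a = b ∧ a ∈ B := by
  obtain ⟨z, hz, hmin⟩ := hB.exists_isMinOn hne (f := fun z => dist a z + dist z b) (by fun_prop)
  have : Nonempty B := hne.to_subtype
  have h0 := hD.dist_mix a b
  rw [h, dist_self] at h0
  have h1 : dist a z + dist z b ≤ 0 := h0 ▸ le_ciInf fun x => hmin x.2
  have h2 : a = z := dist_le_zero.1 (by linarith [dist_nonneg (x := z) (y := b)])
  have h3 : z = b := dist_le_zero.1 (by linarith [dist_nonneg (x := a) (y := z)])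
  exact ⟨h2.trans h3, h2 ▸ hz⟩

/-- Glueing continuous functions on the two halves of a double. -/
theorem IsMetricDouble.exists_glue [CompactSpace X] (hD : IsMetricDouble X B D ip im) (hB : IsCompact B)
    (hne : B.Nonempty) {W : Type*} [TopologicalSpace W] {f g : X → W} (hf : Continuous f) (hg : Continuous g)
    (hfg : ∀ x ∈ B, f x = g x) : ∃ l : D → W, Continuous l ∧ (∀ x, l (ip x) = f x) ∧ ∀ x, l (im x) = g x := by
  classical
  have hsur : ∀ z, (∃ x, ip x = z) ∨ ∃ x, im x = z := fun z => by
    have : z ∈ range ip ∪ range im := hD.surj ▸ mem_univ z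
    exact this
  have hq : IsQuotientMap (Sum.elim ip im) := by
    have hc : Continuous (Sum.elim ip im) := hD.isom_p.continuous.sumElim hD.isom_m.continuous
    refine hc.isClosedMap.isQuotientMap hc fun z => ?_
    rcases hsur z with ⟨x, hx⟩ | ⟨x, hx⟩
    · exact ⟨Sum.inl x, hx⟩
    · exact ⟨Sum.inr x, hx⟩
  let l : D → W := fun z => if h : ∃ x, ip x = z then f h.choose else
    g ((hsur z).resolve_left h).choose
  have h1 : ∀ x, l (ip x) = f x := fun x => by
    have h : ∃ y, ip y = ip x := ⟨x, rfl⟩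
    simp only [l, dif_pos h]
    rw [hD.isom_p.injective h.choose_spec]
  have h2 : ∀ x, l (im x) = g x := fun x => by
    by_cases h : ∃ y, ip y = im x
    · obtain ⟨y, hy⟩ := h
      obtain ⟨rfl, hm⟩ := hD.eq_of_eq hB hne hy
      rw [← hy, h1, hfg _ hm]
    · simp only [l, dif_neg h]
      rw [hD.isom_m.injective ((hsur (im x)).resolve_left h).choose_spec]
  refine ⟨l, ?_, h1, h2⟩
  rw [hq.continuous_iff]
  have : l ∘ Sum.elim ip im = Sum.elim f g := by
    ext x
    rcases x with x | x
    · exact h1 x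
    · exact h2 x
  rw [this]
  exact hf.sumElim hg

theorem IsMetricDouble.exists_line_field [CompactSpace X] (hD : IsMetricDouble X B D ip im) (hB : IsCompact B)
    (hne : B.Nonempty) {w s : X → ℂ} (hw : Continuous w) (hw0 : ∀ x, w x ≠ 0) (hs : ContinuousOn s B)
    (hsw : ∀ x ∈ B, s x ^ 2 = w x) : ∃ (l : D → ℂ × ℂ × ℝ) (S : X → ℂ × ℝ), Continuous l ∧
      (∀ z, l z ∈ range sqTensor) ∧ (∀ z, l z ≠ 0) ∧ (∀ x, l (ip x) = (w x, 0, 0)) ∧ Continuous S ∧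
      (∀ x, l (im x) = sqTensor (S x)) ∧ ∀ x ∈ B, S x = (s x, 0) := by
  obtain ⟨g, hg⟩ := ContinuousMap.exists_restrict_eq hB.isClosed ⟨B.domRestrict s, hs.domRestrict⟩
  have hgs : ∀ x ∈ B, g x = s x := fun x hx => DFunLike.congr_fun hg ⟨x, hx⟩
  let S : X → ℂ × ℝ := fun x => (g x, infDist x B)
  have hS : Continuous S := g.continuous.prodMk (continuous_infDist_pt B)
  have hSB : ∀ x ∈ B, S x = (s x, 0) := fun x hx => by
    simp only [S, hgs x hx, infDist_zero_of_mem hx]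
  obtain ⟨l, hl, h1, h2⟩ := hD.exists_glue hB hne (f := fun x => (w x, (0 : ℂ), (0 : ℝ))) (g := fun x => sqTensor (S x))
    (hw.prodMk continuous_const) (continuous_sqTensor.comp hS) fun x hx => by
      simp [hSB x hx, sqTensor, hsw x hx]
  have hS0 : ∀ x, S x ≠ 0 := fun x h => by
    have hx : x ∈ B := (hB.isClosed.mem_iff_infDist_zero hne).2 (congrArg Prod.snd h)
    rw [hSB x hx] at h
    have : s x = 0 := congrArg Prod.fst h
    exact hw0 x (by rw [← hsw x hx, this]; norm_num)
  have hz : ∀ z, (∃ x, ip x = z) ∨ ∃ x, im x = z := fun z => by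
    have : z ∈ range ip ∪ range im := hD.surj ▸ mem_univ z
    exact this
  refine ⟨l, S, hl, fun z => ?_, fun z => ?_, h1, hS, h2, hSB⟩
  · rcases hz z with ⟨x, rfl⟩ | ⟨x, rfl⟩
    · rw [h1]
      refine ⟨(w x ^ (1 / 2 : ℂ), 0), ?_⟩
      simp only [sqTensor, Complex.ofReal_zero, mul_zero, Prod.mk.injEq]
      refine ⟨?_, by norm_num⟩
      rw [← Complex.cpow_nat_mul]
      simp
    · rw [h2]; exact mem_range_self _
  · rcases hz z with ⟨x, rfl⟩ | ⟨x, rfl⟩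
    · rw [h1]
      exact fun h => hw0 x (congrArg Prod.fst h)
    · rw [h2, Ne, sqTensor_eq_zero_iff]
      exact hS0 x

/-- The Jordan curve in the double obtained from an arc with endpoints in the boundary. -/
theorem IsMetricDouble.exists_doubled_arc [CompactSpace X] (hD : IsMetricDouble X B D ip im) (hB : IsCompact B)
    (hne : B.Nonempty) {a : ℝ → X} (ha : ContinuousOn a (Icc (-1) 1)) (hi : InjOn a (Icc (-1) 1)) (h0 : a (-1) ∈ B)
    (h1 : a 1 ∈ B) (hI : ∀ t ∈ Ioo (-1 : ℝ) 1, a t ∉ B) :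
    ∃ f : C(Circle1, D), Function.Injective f ∧ (∀ v : Circle1, 0 ≤ (v : EuclideanSpace ℝ (Fin 2)) 1 →
      f v = ip (a ((v : EuclideanSpace ℝ (Fin 2)) 0))) ∧ ∀ v : Circle1, (v : EuclideanSpace ℝ (Fin 2)) 1 ≤ 0 →
      f v = im (a ((v : EuclideanSpace ℝ (Fin 2)) 0)) := by
  classical
  have hsq : ∀ v : Circle1, (v : EuclideanSpace ℝ (Fin 2)) 0 ^ 2 + (v : EuclideanSpace ℝ (Fin 2)) 1 ^ 2 = 1 := by
    intro v
    have h : ‖(v : EuclideanSpace ℝ (Fin 2))‖ = 1 := by simpa [Circle1] using v.2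
    have := EuclideanSpace.norm_sq_eq (v : EuclideanSpace ℝ (Fin 2))
    rw [h, Fin.sum_univ_two, Real.norm_eq_abs, Real.norm_eq_abs, sq_abs, sq_abs] at this
    linarith
  have hmem : ∀ v : Circle1, (v : EuclideanSpace ℝ (Fin 2)) 0 ∈ Icc (-1 : ℝ) 1 := fun v => by
    have := hsq v
    exact ⟨by nlinarith [sq_nonneg ((v : EuclideanSpace ℝ (Fin 2)) 1)],
      by nlinarith [sq_nonneg ((v : EuclideanSpace ℝ (Fin 2)) 1)]⟩
  have hc : Continuous fun v : Circle1 => a ((v : EuclideanSpace ℝ (Fin 2)) 0) :=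
    ha.comp_continuous (by fun_prop) hmem
  have hend : ∀ v : Circle1, a ((v : EuclideanSpace ℝ (Fin 2)) 0) ∈ B ↔ (v : EuclideanSpace ℝ (Fin 2)) 1 = 0 := by
    intro v
    have h2 := hsq v
    constructor
    · intro h
      by_contra hn
      have hp : 0 < (v : EuclideanSpace ℝ (Fin 2)) 1 ^ 2 := by positivity
      exact hI _ ⟨by nlinarith, by nlinarith⟩ h
    · intro h
      rw [h] at h2
      have : (v : EuclideanSpace ℝ (Fin 2)) 0 = 1 ∨ (v : EuclideanSpace ℝ (Fin 2)) 0 = -1 :=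
        sq_eq_sq_iff_eq_or_eq_neg.1 (by linarith)
      rcases this with h | h <;> rw [h] <;> assumption
  have hag : ∀ v : Circle1, (v : EuclideanSpace ℝ (Fin 2)) 1 = 0 →
      ip (a ((v : EuclideanSpace ℝ (Fin 2)) 0)) = im (a ((v : EuclideanSpace ℝ (Fin 2)) 0)) := fun v h =>
    hD.agree _ ((hend v).2 h)
  let f : C(Circle1, D) := ⟨fun v => if 0 ≤ (v : EuclideanSpace ℝ (Fin 2)) 1 then
      ip (a ((v : EuclideanSpace ℝ (Fin 2)) 0)) else im (a ((v : EuclideanSpace ℝ (Fin 2)) 0)), by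
    refine Continuous.if_le (hD.isom_p.continuous.comp hc) (hD.isom_m.continuous.comp hc) continuous_const
      (by fun_prop) fun v hv => hag v hv.symm⟩
  have e1 : ∀ v : Circle1, 0 ≤ (v : EuclideanSpace ℝ (Fin 2)) 1 →
      f v = ip (a ((v : EuclideanSpace ℝ (Fin 2)) 0)) := fun v hv => if_pos hv
  have e2 : ∀ v : Circle1, (v : EuclideanSpace ℝ (Fin 2)) 1 ≤ 0 →
      f v = im (a ((v : EuclideanSpace ℝ (Fin 2)) 0)) := fun v hv => by
    rcases hv.eq_or_lt with h | h
    · rw [e1 v h.ge, hag v h]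
    · exact if_neg (not_le.2 h)
  refine ⟨f, ?_, e1, e2⟩
  have key : ∀ v v' : Circle1, (v : EuclideanSpace ℝ (Fin 2)) 0 = (v' : EuclideanSpace ℝ (Fin 2)) 0 →
      0 ≤ (v : EuclideanSpace ℝ (Fin 2)) 1 * (v' : EuclideanSpace ℝ (Fin 2)) 1 → v = v' := by
    intro v v' h h'
    have h1 := hsq v
    have h2 := hsq v'
    rw [h] at h1
    have h3 : (v : EuclideanSpace ℝ (Fin 2)) 1 = (v' : EuclideanSpace ℝ (Fin 2)) 1 := by
      rcases sq_eq_sq_iff_eq_or_eq_neg.1 (by linarith : (v : EuclideanSpace ℝ (Fin 2)) 1 ^ 2 =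
        (v' : EuclideanSpace ℝ (Fin 2)) 1 ^ 2) with h4 | h4
      · exact h4
      · rw [h4] at h' ⊢
        have : (v' : EuclideanSpace ℝ (Fin 2)) 1 = 0 := by nlinarith
        linarith
    apply Subtype.ext
    ext i
    fin_cases i
    · exact h
    · exact h3
  intro v v' h
  rcases le_total 0 ((v : EuclideanSpace ℝ (Fin 2)) 1) with p | p <;>
    rcases le_total 0 ((v' : EuclideanSpace ℝ (Fin 2)) 1) with p' | p'
  · rw [e1 v p, e1 v' p'] at h
    exact key v v' (hi (hmem v) (hmem v') (hD.isom_p.injective h)) (by positivity)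
  · rw [e1 v p, e2 v' p'] at h
    obtain ⟨h, hm⟩ := hD.eq_of_eq hB hne h
    refine key v v' (hi (hmem v) (hmem v') h) ?_
    rw [(hend v).1 hm, zero_mul]
  · rw [e2 v p, e1 v' p'] at h
    obtain ⟨h, hm⟩ := hD.eq_of_eq hB hne h.symm
    refine key v v' (hi (hmem v) (hmem v') h.symm) ?_
    rw [(hend v').1 hm, mul_zero]
  · rw [e2 v p, e2 v' p'] at h
    exact key v v' (hi (hmem v) (hmem v') (hD.isom_m.injective h)) (mul_nonneg_of_nonpos_of_nonpos p p')

end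

section

instance : CompactSpace Circle1 := isCompact_iff_compactSpace.1 (isCompact_sphere _ _)

theorem isNullhomotopic_of_range {D : Type*} [TopologicalSpace D] [T2Space D] {f : C(Circle1, D)}
    (hf : Function.Injective f) (h : ¬ IsNonContractibleJordanCurve (range f)) : IsNullhomotopic f := by
  have hJ : IsJordanCurve (range f) :=
    ⟨(f.continuous.isClosedEmbedding hf).isEmbedding.toHomeomorph.symm⟩
  simp only [IsNonContractibleJordanCurve, hJ, true_and, not_forall, not_not] at h
  obtain ⟨f', hf', hr, y, hy⟩ := h
  let φ : Circle1 ≃ₜ Circle1 := ((f.continuous.isClosedEmbedding hf).isEmbedding.toHomeomorph.trans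
    (Homeomorph.setCongr hr.symm)).trans (f'.continuous.isClosedEmbedding hf').isEmbedding.toHomeomorph.symm
  have hφ : ∀ v, f' (φ v) = f v := by
    intro v
    have := ((f'.continuous.isClosedEmbedding hf').isEmbedding.toHomeomorph).apply_symm_apply
      ((Homeomorph.setCongr hr.symm) ((f.continuous.isClosedEmbedding hf).isEmbedding.toHomeomorph v))
    exact congrArg Subtype.val this
  refine ⟨y, ?_⟩
  have h1 : f = f'.comp ⟨φ, φ.continuous⟩ := by ext v; exact (hφ v).symm
  rw [h1]
  exact hy.comp (ContinuousMap.Homotopic.refl _)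

/-- The point of the unit circle with given first coordinate on the upper or lower half. -/
noncomputable def circlePt (sg u : ℝ) (hu : u ∈ Icc (-1 : ℝ) 1) (hsg : sg ^ 2 = 1) : Circle1 :=
  ⟨!₂[u, sg * Real.sqrt (1 - u ^ 2)], by
    have : 0 ≤ 1 - u ^ 2 := by nlinarith [hu.1, hu.2]
    simp [Circle1, EuclideanSpace.norm_eq, Fin.sum_univ_two, mul_pow, hsg, Real.sq_sqrt this]⟩

theorem sign_const_arc {Ψ : Circle1 → ℂ × ℝ} (hΨ : Continuous Ψ) {sg : ℝ} (hsg : sg ^ 2 = 1) {G : ℝ → ℂ × ℝ}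
    (hG : ContinuousOn G (Icc (-1) 1)) (h0 : ∀ u ∈ Icc (-1 : ℝ) 1, G u ≠ 0)
    (h : ∀ u (hu : u ∈ Icc (-1 : ℝ) 1), sqTensor (Ψ (circlePt sg u hu hsg)) = sqTensor (G u)) :
    ∃ τ : ℂ, τ ^ 2 = 1 ∧ ∀ u (hu : u ∈ Icc (-1 : ℝ) 1), Ψ (circlePt sg u hu hsg) = ((τ * (G u).1, τ.re * (G u).2) : ℂ × ℝ) := by
  classical
  have hc : Continuous fun u : Icc (-1 : ℝ) 1 => Ψ (circlePt sg u u.2 hsg) := by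
    refine hΨ.comp (Continuous.subtype_mk ?_ _)
    refine (PiLp.continuous_toLp 2 _).comp (continuous_pi fun i => ?_)
    fin_cases i
    · exact continuous_subtype_val
    · simp
      fun_prop
  have hGc : Continuous fun u : Icc (-1 : ℝ) 1 => G u := hG.comp_continuous continuous_subtype_val fun u => u.2
  have hcl1 : IsClosed {u : Icc (-1 : ℝ) 1 | Ψ (circlePt sg u u.2 hsg) = G u} := isClosed_eq hc hGc
  have hcl2 : IsClosed {u : Icc (-1 : ℝ) 1 | Ψ (circlePt sg u u.2 hsg) = -G u} := isClosed_eq hc hGc.neg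
  have hcov : ∀ u : Icc (-1 : ℝ) 1, Ψ (circlePt sg u u.2 hsg) = G u ∨ Ψ (circlePt sg u u.2 hsg) = -G u :=
    fun u => sqTensor_eq_iff.1 (h u u.2)
  have : PreconnectedSpace (Icc (-1 : ℝ) 1) := Subtype.preconnectedSpace isPreconnected_Icc
  have hsplit := isPreconnected_closed_iff.1 (isPreconnected_univ (α := Icc (-1 : ℝ) 1)) _ _ hcl1 hcl2
    (fun u _ => hcov u)
  by_cases hA : ∀ u : Icc (-1 : ℝ) 1, Ψ (circlePt sg u u.2 hsg) = G u
  · exact ⟨1, by simp, fun u hu => by rw [hA ⟨u, hu⟩]; simp⟩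
  · by_cases hB : ∀ u : Icc (-1 : ℝ) 1, Ψ (circlePt sg u u.2 hsg) = -G u
    · exact ⟨-1, by simp, fun u hu => by rw [hB ⟨u, hu⟩]; ext <;> simp⟩
    · push Not at hA hB
      obtain ⟨u1, hu1⟩ := hA
      obtain ⟨u2, hu2⟩ := hB
      obtain ⟨u, -, e1, e2⟩ := hsplit ⟨u2, trivial, (hcov u2).resolve_right hu2⟩
        ⟨u1, trivial, (hcov u1).resolve_left hu1⟩
      simp only [mem_ofPred_eq] at e1 e2
      exact absurd (self_eq_neg.1 (e1.symm.trans e2)) (h0 u u.2)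

variable {X D : Type*} [MetricSpace X] [CompactSpace X] [MetricSpace D] {ip im : X → D}

theorem IsMetricDouble.sign_eq_of_gap {B : Set X} (hD : IsMetricDouble X B D ip im)
    (hB : IsCompact B) (hne : B.Nonempty) {ε : ℝ}
    (hJ : ∀ J : Set D, IsNonContractibleJordanCurve J → 2 * ε ≤ diam J) {w s : X → ℂ} (hw : Continuous w)
    (hw0 : ∀ x, w x ≠ 0) (hs : ContinuousOn s B) (hsw : ∀ x ∈ B, s x ^ 2 = w x) {d : ℝ} {γ : ℝ → X}
    (hγ : IsGeod γ d) (hd : d < ε) (hw1 : ∀ t ∈ Icc 0 d, w (γ t) = 1) {p r : ℝ} (hp : p ∈ Icc 0 d)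
    (hr : r ∈ Icc 0 d) (hpr : p < r) (hpB : γ p ∈ B) (hrB : γ r ∈ B) (hI : ∀ t ∈ Ioo p r, γ t ∉ B) :
    s (γ p) = s (γ r) := by
  set a : ℝ → X := fun u => γ (p + (u + 1) / 2 * (r - p)) with ha
  have hmem : ∀ u ∈ Icc (-1 : ℝ) 1, p + (u + 1) / 2 * (r - p) ∈ Icc 0 d := by
    intro u hu
    have h1 := hu.1
    have h2 := hu.2
    exact ⟨by nlinarith [hp.1], by nlinarith [hr.2]⟩
  have hac : ContinuousOn a (Icc (-1) 1) := hγ.continuousOn.comp (by fun_prop) hmem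
  have hai : InjOn a (Icc (-1) 1) := by
    intro u hu v hv h
    have h1 := hγ.2 _ (hmem u hu) _ (hmem v hv)
    simp only [ha] at h
    rw [h, dist_self] at h1
    have h2 := sub_eq_zero.1 (abs_eq_zero.1 h1.symm)
    have h3 : (u - v) * (r - p) = 0 := by linarith
    rcases mul_eq_zero.1 h3 with h | h <;> linarith
  have hap : a (-1) = γ p := by simp [ha]
  have har : a 1 = γ r := by simp only [ha]; congr 1; ring
  obtain ⟨f, hfi, hf1, hf2⟩ := hD.exists_doubled_arc hB hne hac hai (hap ▸ hpB) (har ▸ hrB) (by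
    intro t ht
    exact hI _ ⟨by nlinarith [ht.1], by nlinarith [ht.2]⟩)
  have hmemC : ∀ v : Circle1, (v : EuclideanSpace ℝ (Fin 2)) 0 ∈ Icc (-1 : ℝ) 1 := by
    intro v
    have h := v.2
    simp only [Circle1, mem_sphere_zero_iff_norm, EuclideanSpace.norm_eq, Fin.sum_univ_two, Real.sqrt_eq_one,
      Real.norm_eq_abs, sq_abs] at h
    constructor <;> nlinarith [sq_nonneg ((v : EuclideanSpace ℝ (Fin 2)) 1)]
  have hdist : ∀ v, dist (f v) (ip (γ p)) + dist (f v) (ip (γ r)) ≤ d := by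
    intro v
    have h1 := hγ.2 _ (hmem _ (hmemC v)) _ hp
    have h2 := hγ.2 _ (hmem _ (hmemC v)) _ hr
    have hv := hmemC v
    have e1 : dist (a ((v : EuclideanSpace ℝ (Fin 2)) 0)) (γ p) + dist (a ((v : EuclideanSpace ℝ (Fin 2)) 0)) (γ r) ≤ d := by
      simp only [ha]
      rw [h1, h2, abs_of_nonneg (by nlinarith [hv.1]), abs_of_nonpos (by nlinarith [hv.2])]
      linarith [hp.1, hr.2]
    rcases le_total 0 ((v : EuclideanSpace ℝ (Fin 2)) 1) with h | h
    · rw [hf1 v h, hD.isom_p.dist_eq, hD.isom_p.dist_eq]; exact e1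
    · rw [hf2 v h, hD.agree _ hpB, hD.agree _ hrB, hD.isom_m.dist_eq, hD.isom_m.dist_eq]; exact e1
  have hdiam : diam (range f) ≤ d := by
    refine diam_le_of_forall_dist_le hγ.1 ?_
    rintro _ ⟨v, rfl⟩ _ ⟨v', rfl⟩
    linarith [hdist v, hdist v', dist_triangle_right (f v) (f v') (ip (γ p)),
      dist_triangle_right (f v) (f v') (ip (γ r))]
  have hε : 0 < ε := lt_of_le_of_lt hγ.1 hd
  obtain ⟨y, ⟨Hh⟩⟩ := isNullhomotopic_of_range hfi fun h => by linarith [hJ _ h]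
  obtain ⟨l, S, hl, hlr, hl0, hlp, hSc, hlm, hSB⟩ := hD.exists_line_field hB hne hw hw0 hs hsw
  obtain ⟨Ψ, hΨ, hΨl⟩ := exists_line_lift (F := fun z : I × Circle1 => l (Hh.symm z))
    (hl.comp Hh.symm.continuous) (fun z => hlr _) (fun z => hl0 _) (y := l y) (fun v => by simp)
  have hΨl' : ∀ v, sqTensor (Ψ v) = l (f v) := fun v => by simpa using hΨl v
  obtain ⟨τ, hτ, hτe⟩ := sign_const_arc (sg := 1) hΨ (by norm_num) (G := fun _ => (1, 0)) continuousOn_const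
    (fun u _ => by simp) (fun u hu => by
      rw [hΨl', hf1 _ (by simp [circlePt]), hlp]
      have : w (a u) = 1 := hw1 _ (hmem u hu)
      simp [circlePt, this, sqTensor])
  obtain ⟨τ', hτ', hτe'⟩ := sign_const_arc (sg := -1) hΨ (by norm_num) (G := fun u => S (a u))
    (hSc.comp_continuousOn hac) (fun u _ h => by
      refine hl0 (im (a u)) ?_
      rw [hlm, h]; simp [sqTensor]) (fun u hu => by
      rw [hΨl', hf2 _ (by simp [circlePt]), hlm]
      simp [circlePt])
  have hend : ∀ u (hu : u ∈ Icc (-1 : ℝ) 1), u ^ 2 = 1 → a u ∈ B → τ = τ' * s (a u) := by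
    intro u hu hu1 huB
    have h1 := hτe u hu
    have h2 := hτe' u hu
    have h3 : circlePt 1 u hu (by norm_num) = circlePt (-1) u hu (by norm_num) := by simp [circlePt, hu1]
    rw [h3, h2, hSB _ huB] at h1
    simpa using (congrArg Prod.fst h1).symm
  have e1 := hend (-1) (by simp) (by norm_num) (hap ▸ hpB)
  have e2 := hend 1 (by simp) (by norm_num) (har ▸ hrB)
  rw [hap] at e1
  rw [har] at e2
  have hτ0 : τ' ≠ 0 := fun h => by simp [h] at hτ'
  exact mul_left_cancel₀ hτ0 (e1.symm.trans e2)

theorem IsMetricDouble.goodHop (hD : IsMetricDouble X (surfaceBoundary X) D ip im)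
    (hB : IsCompact (surfaceBoundary X)) {ε : ℝ}
    (hJ : ∀ J : Set D, IsNonContractibleJordanCurve J → 2 * ε ≤ diam J) : GoodHop X ε := by
  intro w s hw hw0 hs hsw d γ hγ hd h0 h1 hw1
  have hne : (surfaceBoundary X).Nonempty := ⟨_, h0⟩
  set F : Set ℝ := Icc 0 d ∩ γ ⁻¹' surfaceBoundary X with hF
  have hFc : IsCompact F := by
    refine isCompact_Icc.of_isClosed_subset ?_ inter_subset_left
    exact hγ.continuousOn.preimage_isClosed_of_isClosed isClosed_Icc hB.isClosed
  have hsc : ContinuousOn (fun t => s (γ t)) F :=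
    hs.comp (hγ.continuousOn.mono inter_subset_left) fun t ht => ht.2
  have hpm : ∀ t ∈ F, s (γ t) = 1 ∨ s (γ t) = -1 := fun t ht => by
    have := hsw _ ht.2
    rw [hw1 t ht.1] at this
    exact sq_eq_sq_iff_eq_or_eq_neg.1 (by rw [this, one_pow])
  have h0F : (0 : ℝ) ∈ F := ⟨hγ.left_mem, h0⟩
  by_contra hne'
  have hcl : ∀ c : ℂ, IsCompact {t ∈ F | s (γ t) = c} := fun c =>
    hFc.of_isClosed_subset (hsc.preimage_isClosed_of_isClosed hFc.isClosed isClosed_singleton) fun t h => h.1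
  have h1F : d ∈ F := ⟨hγ.right_mem, h1⟩
  obtain ⟨m, ⟨hmF, hms⟩, hmin⟩ := (hcl (s (γ d))).exists_isLeast ⟨d, h1F, rfl⟩
  have hs2 : ∀ t ∈ F, s (γ t) = s (γ 0) ∨ s (γ t) = s (γ d) := by
    intro t ht
    rcases hpm t ht with h | h <;> rcases hpm 0 h0F with h' | h' <;> rcases hpm d h1F with h'' | h'' <;>
      simp_all
  obtain ⟨p, ⟨⟨hpF, hps⟩, hpm'⟩, hmax⟩ := ((hcl (s (γ 0))).inter_right isClosed_Iic (t := Iic m)).exists_isGreatest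
    ⟨0, ⟨h0F, rfl⟩, hmF.1.1⟩
  have hpm2 : p < m := lt_of_le_of_ne hpm' fun h => hne' (by rw [← hps, ← hms, h])
  refine hne' ?_
  rw [← hps, ← hms]
  refine hD.sign_eq_of_gap hB hne hJ hw hw0 hs hsw hγ hd hw1 hpF.1 hmF.1 hpm2 hpF.2 hmF.2 fun t ht htB => ?_
  have htF : t ∈ F := ⟨⟨hpF.1.1.trans ht.1.le, ht.2.le.trans hmF.1.2⟩, htB⟩
  rcases hs2 t htF with h | h
  · exact absurd (hmax ⟨⟨htF, h⟩, ht.2.le⟩) (not_le.2 ht.1)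
  · exact absurd (hmin ⟨htF, h⟩) (not_le.2 ht.2)

end

/-! ### Homotopy classes of curves at small scales -/

section

/-- Paths in a ball of radius `R` are homotopic as soon as they have the same ends. -/
def IsHtpyScale (X : Type*) [MetricSpace X] (R : ℝ) : Prop :=
  ∀ (x a b : X) (p q : Path a b), range p ⊆ ball x R → range q ⊆ ball x R → p.Homotopic q

theorem homotopic_of_range_subset {Y X : Type*} [TopologicalSpace Y] [TopologicalSpace X] [SimplyConnectedSpace Y]
    {ψ : Y → X} (hψ : IsEmbedding ψ) {a b : X} {p q : Path a b} (hp : range p ⊆ range ψ)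
    (hq : range q ⊆ range ψ) : p.Homotopic q := by
  obtain ⟨a', rfl⟩ : a ∈ range ψ := hp ⟨0, p.source⟩
  obtain ⟨b', rfl⟩ : b ∈ range ψ := hp ⟨1, p.target⟩
  have lift : ∀ r : Path (ψ a') (ψ b'), range r ⊆ range ψ → ∃ r' : Path a' b', r = r'.map hψ.continuous := by
    intro r hr
    have hch : ∀ t, ψ (hψ.toHomeomorph.symm ⟨r t, hr ⟨t, rfl⟩⟩) = r t := fun t =>
      congrArg Subtype.val (hψ.toHomeomorph.apply_symm_apply ⟨r t, hr ⟨t, rfl⟩⟩)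
    refine ⟨⟨⟨fun t => hψ.toHomeomorph.symm ⟨r t, hr ⟨t, rfl⟩⟩, ?_⟩, ?_, ?_⟩, ?_⟩
    · exact hψ.toHomeomorph.symm.continuous.comp (r.continuous.subtype_mk _)
    · exact hψ.injective ((hch 0).trans r.source)
    · exact hψ.injective ((hch 1).trans r.target)
    · ext t; exact (hch t).symm
  obtain ⟨p', rfl⟩ := lift p hp
  obtain ⟨q', rfl⟩ := lift q hq
  exact (SimplyConnectedSpace.paths_homotopic p' q').map ⟨ψ, hψ.continuous⟩

theorem IsSurface.exists_htpyScale {X : Type*} [MetricSpace X] [CompactSpace X] (hX : IsSurface X) :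
    ∃ R > 0, IsHtpyScale X R := by
  have hconv : Convex ℝ HalfPlane := by
    intro x hx y hy a b ha hb _
    simp only [HalfPlane, mem_ofPred_eq] at hx hy ⊢
    simp only [Prod.snd_add, Prod.smul_snd, smul_eq_mul]
    positivity
  have hloc : ∀ x : X, ∃ W : Set X, IsOpen W ∧ x ∈ W ∧ ∀ (a b : X) (p q : Path a b), range p ⊆ W → range q ⊆ W →
      p.Homotopic q := by
    intro x
    obtain ⟨U, V, hU, hxU, hV, ⟨φ⟩⟩ := hX x
    obtain ⟨r, hr, hrV⟩ := Metric.isOpen_iff.1 hV (φ ⟨x, hxU⟩) (φ ⟨x, hxU⟩).2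
    set B : Set HalfPlane := ball (φ ⟨x, hxU⟩ : HalfPlane) r with hB
    have hBc : Convex ℝ (Subtype.val '' B : Set (ℝ × ℝ)) := by
      have : (Subtype.val '' B : Set (ℝ × ℝ)) = ball ((φ ⟨x, hxU⟩ : HalfPlane) : ℝ × ℝ) r ∩ HalfPlane := by
        ext v
        constructor
        · rintro ⟨v, hv, rfl⟩; exact ⟨hv, v.2⟩
        · rintro ⟨hv, hv2⟩; exact ⟨⟨v, hv2⟩, hv, rfl⟩
      rw [this]
      exact (convex_ball _ _).inter hconv
    have hcon : ContractibleSpace B := by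
      have := hBc.contractibleSpace ⟨_, mem_image_of_mem _ (mem_ball_self hr)⟩
      exact (IsEmbedding.subtypeVal.homeomorphImage B).contractibleSpace
    let ψ : B → X := fun v => (φ.symm (Set.inclusion hrV v) : U)
    have hψ : IsOpenEmbedding ψ :=
      hU.isOpenEmbedding_subtypeVal.comp (φ.symm.isOpenEmbedding.comp
        (IsOpenEmbedding.inclusion hrV (isOpen_ball.preimage continuous_subtype_val)))
    refine ⟨range ψ, hψ.isOpen_range, ⟨⟨φ ⟨x, hxU⟩, mem_ball_self hr⟩, ?_⟩, fun a b p q hp hq =>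
      homotopic_of_range_subset hψ.isEmbedding hp hq⟩
    have : Set.inclusion hrV ⟨φ ⟨x, hxU⟩, mem_ball_self hr⟩ = φ ⟨x, hxU⟩ := rfl
    simp only [ψ, this, Homeomorph.symm_apply_apply]
  choose W hW hxW hWh using hloc
  obtain ⟨R, hR, h⟩ := lebesgue_number_lemma_of_metric (isCompact_univ (X := X)) hW
    (fun x _ => mem_iUnion.2 ⟨x, hxW x⟩)
  refine ⟨R, hR, fun x a b p q hp hq => ?_⟩
  obtain ⟨i, hi⟩ := h x trivial
  exact hWh i a b p q (hp.trans hi) (hq.trans hi)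

/-- The class of a path, as a loop at the base point. -/
noncomputable def pathCls {X : Type*} [TopologicalSpace X] [PathConnectedSpace X] (x₀ : X) {x y : X} (q : Path x y) :
    FundamentalGroup X x₀ :=
  FundamentalGroup.fromPath (((Path.Homotopic.Quotient.mk (PathConnectedSpace.somePath x₀ x)).trans (Path.Homotopic.Quotient.mk q)).trans
    (Path.Homotopic.Quotient.mk (PathConnectedSpace.somePath x₀ y)).symm)

section

variable {X : Type*} [TopologicalSpace X] [PathConnectedSpace X] (x₀ : X)

theorem pathCls_trans {x y z : X} (p : Path x y) (q : Path y z) :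
    pathCls x₀ (p.trans q) = pathCls x₀ q * pathCls x₀ p := by
  rw [FundamentalGroup.mul_def]
  simp only [pathCls, Path.Homotopic.Quotient.mk_trans, Path.Homotopic.Quotient.trans_assoc]
  congr 2
  rw [← Path.Homotopic.Quotient.trans_assoc (Path.Homotopic.Quotient.symm _), Path.Homotopic.Quotient.symm_trans, Path.Homotopic.Quotient.refl_trans]

theorem pathCls_eq_iff {x y : X} {p q : Path x y} : pathCls x₀ p = pathCls x₀ q ↔ p.Homotopic q := by
  rw [← Path.Homotopic.Quotient.eq]
  constructor
  · intro h
    simp only [pathCls] at h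
    have := congrArg (fun g => ((Path.Homotopic.Quotient.mk (PathConnectedSpace.somePath x₀ x)).symm.trans g).trans
      (Path.Homotopic.Quotient.mk (PathConnectedSpace.somePath x₀ y))) h
    simp only [Path.Homotopic.Quotient.trans_assoc, Path.Homotopic.Quotient.symm_trans, Path.Homotopic.Quotient.trans_refl] at this
    simpa only [← Path.Homotopic.Quotient.trans_assoc, Path.Homotopic.Quotient.symm_trans, Path.Homotopic.Quotient.refl_trans] using this
  · intro h
    simp only [pathCls, h]

theorem pathCls_refl (x : X) : pathCls x₀ (Path.refl x) = 1 := by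
  rw [FundamentalGroup.one_def]
  simp only [pathCls, Path.Homotopic.Quotient.mk_refl, Path.Homotopic.Quotient.trans_refl, Path.Homotopic.Quotient.trans_symm]

theorem exists_pathCls (g : FundamentalGroup X x₀) : ∃ q : Path x₀ x₀, pathCls x₀ q = g := by
  obtain ⟨q, hq⟩ := Path.Homotopic.Quotient.mk_surjective (((Path.Homotopic.Quotient.mk (PathConnectedSpace.somePath x₀ x₀)).symm.trans
    (FundamentalGroup.toPath g)).trans (Path.Homotopic.Quotient.mk (PathConnectedSpace.somePath x₀ x₀)))
  refine ⟨q, ?_⟩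
  simp only [pathCls, hq, Path.Homotopic.Quotient.trans_assoc, Path.Homotopic.Quotient.trans_symm, Path.Homotopic.Quotient.trans_refl]
  rw [← Path.Homotopic.Quotient.trans_assoc, Path.Homotopic.Quotient.trans_symm, Path.Homotopic.Quotient.refl_trans]

/-- The affine path between two real numbers. -/
noncomputable def realPath (a b : ℝ) : Path a b where
  toFun t := a + t * (b - a)
  continuous_toFun := by fun_prop
  source' := by simp
  target' := by simp

theorem realPath_mem (a b : ℝ) (t : I) : realPath a b t ∈ uIcc a b := by
  have h0 := t.2.1
  have h1 := t.2.2
  show a + t * (b - a) ∈ uIcc a b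
  rcases le_total a b with h | h
  · rw [uIcc_of_le h]; constructor <;> nlinarith
  · rw [uIcc_of_ge h]; constructor <;> nlinarith

/-- The class of the part of a curve between two parameters. -/
noncomputable def curveCls (c : C(ℝ, X)) (a b : ℝ) : FundamentalGroup X x₀ :=
  pathCls x₀ ((realPath a b).map c.continuous)

theorem curveCls_mul (c : C(ℝ, X)) (a b d : ℝ) : curveCls x₀ c b d * curveCls x₀ c a b = curveCls x₀ c a d := by
  rw [curveCls, curveCls, ← pathCls_trans, ← Path.map_trans, curveCls, pathCls_eq_iff]
  exact (SimplyConnectedSpace.paths_homotopic _ _).map c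

theorem curveCls_self (c : C(ℝ, X)) (a : ℝ) : curveCls x₀ c a a = 1 := by
  exact mul_eq_right.1 (curveCls_mul x₀ c a a a)

theorem exists_curveCls (g : FundamentalGroup X x₀) :
    ∃ c : C(ℝ, X), c 0 = x₀ ∧ c 1 = x₀ ∧ curveCls x₀ c 0 1 = g := by
  obtain ⟨q, rfl⟩ := exists_pathCls x₀ g
  refine ⟨⟨q.extend, q.continuous_extend⟩, by simp, by simp, ?_⟩
  have h0 : q.extend 0 = x₀ := by simp
  have h1 : q.extend 1 = x₀ := by simp
  have : ∀ (x y : X) (hx : x = x₀) (hy : y = x₀) (p : Path x y), (∀ t, p t = q t) → pathCls x₀ p = pathCls x₀ q := by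
    rintro x y rfl rfl p hp
    congr 1
    ext t; exact hp t
  refine this _ _ h0 h1 _ fun t => ?_
  simp [realPath]

end

end

section

variable {X : Type*} [MetricSpace X] [PathConnectedSpace X] (x₀ : X)

/-- A choice of paths which do not leave the balls around their starting points. -/
def IsShortPaths (P : ∀ x y : X, Path x y) : Prop := ∀ x y t, dist (P x y t) x ≤ dist y x

variable {x₀} {R : ℝ} {P : ∀ x y : X, Path x y}

theorem IsHtpyScale.pathCls_eq (hR : IsHtpyScale X R) (hP : IsShortPaths P) {x y : X} {p : Path x y}
    (hp : ∀ t, dist (p t) x < R) : pathCls x₀ p = pathCls x₀ (P x y) := by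
  rw [pathCls_eq_iff]
  have h1 := hp 1
  rw [p.target] at h1
  refine hR x _ _ _ _ ?_ ?_
  · rintro _ ⟨t, rfl⟩; exact hp t
  · rintro _ ⟨t, rfl⟩; exact (hP x y t).trans_lt h1

theorem IsHtpyScale.short_mul (hR : IsHtpyScale X R) (hP : IsShortPaths P) {x y z : X}
    (h : dist y x + dist z y < R) : pathCls x₀ (P y z) * pathCls x₀ (P x y) = pathCls x₀ (P x z) := by
  rw [← pathCls_trans]
  refine hR.pathCls_eq hP fun t => ?_
  have : (P x y).trans (P y z) t ∈ range ((P x y).trans (P y z)) := ⟨t, rfl⟩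
  rw [Path.trans_range] at this
  rcases this with ⟨u, hu⟩ | ⟨u, hu⟩ <;> rw [← hu]
  · linarith [hP x y u, dist_nonneg (x := z) (y := y)]
  · linarith [hP y z u, dist_triangle (P y z u) y x]

theorem IsHtpyScale.short_self (hR : IsHtpyScale X R) (hP : IsShortPaths P) (h0 : 0 < R) (x : X) :
    pathCls x₀ (P x x) = 1 := by
  rw [← pathCls_refl x₀ x]
  exact (hR.pathCls_eq hP fun t => by simpa using h0).symm

theorem IsHtpyScale.curveCls_eq (hR : IsHtpyScale X R) (hP : IsShortPaths P) {c : C(ℝ, X)} {a b : ℝ}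
    (h : ∀ u ∈ uIcc a b, dist (c u) (c a) < R) : curveCls x₀ c a b = pathCls x₀ (P (c a) (c b)) :=
  hR.pathCls_eq hP fun t => h _ (realPath_mem a b t)

theorem interval_induction {p : ℝ → Prop} {a b δ : ℝ} (hab : a ≤ b) (hδ : 0 < δ) (h0 : p a)
    (h : ∀ s t, a ≤ s → s ≤ t → t ≤ b → t - s < δ → p s → p t) : p b := by
  obtain ⟨n, hn⟩ := exists_nat_gt ((b - a) / δ)
  have hn0 : (0 : ℝ) < n := lt_of_le_of_lt (by have := sub_nonneg.2 hab; positivity) hn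
  have hst : (b - a) / n < δ := by rw [div_lt_iff₀ hn0]; rw [div_lt_iff₀ hδ] at hn; linarith
  have hst0 : 0 ≤ (b - a) / n := by have := sub_nonneg.2 hab; positivity
  have key : ∀ k : ℕ, k ≤ n → p (a + k * ((b - a) / n)) := by
    intro k
    induction k with
    | zero => intro _; simpa using h0
    | succ k ih =>
      intro hk
      have hk' : ((k + 1 : ℕ) : ℝ) ≤ n := by exact_mod_cast hk
      have e : (n : ℝ) * ((b - a) / n) = b - a := by field_simp
      push_cast at hk' ⊢
      refine h _ _ ?_ ?_ ?_ ?_ (ih (by omega))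
      · have : 0 ≤ (k : ℝ) * ((b - a) / n) := by positivity
        linarith
      · nlinarith
      · nlinarith
      · linarith
  have := key n le_rfl
  rwa [show a + n * ((b - a) / n) = b by field_simp; ring] at this

theorem exists_uniform_step (c : C(ℝ, X)) (a b : ℝ) {η : ℝ} (hη : 0 < η) :
    ∃ δ > 0, ∀ s ∈ Icc a b, ∀ t ∈ Icc a b, |s - t| < δ → dist (c s) (c t) < η := by
  have := (isCompact_Icc (a := a) (b := b)).uniformContinuousOn_of_continuous c.continuous.continuousOn
  obtain ⟨δ, hδ, h⟩ := Metric.uniformContinuousOn_iff.1 this η hη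
  exact ⟨δ, hδ, fun s hs t ht hst => h s hs t ht (by rwa [Real.dist_eq])⟩

theorem IsHtpyScale.exists_curve_step (hR : IsHtpyScale X R) (hP : IsShortPaths P) (c : C(ℝ, X)) (a b : ℝ) {η : ℝ}
    (hη : 0 < η) (hηR : η ≤ R) : ∃ δ > 0, ∀ s t, a ≤ s → s ≤ t → t ≤ b → t - s < δ → dist (c t) (c s) < η ∧
      curveCls x₀ c a t = pathCls x₀ (P (c s) (c t)) * curveCls x₀ c a s := by
  obtain ⟨δ, hδ, h⟩ := exists_uniform_step c a b hη
  refine ⟨δ, hδ, fun s t has hst htb hd => ⟨h t ⟨has.trans hst, htb⟩ s ⟨has, hst.trans htb⟩ ?_, ?_⟩⟩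
  · rwa [abs_of_nonneg (by linarith)]
  · rw [← curveCls_mul x₀ c a s t, hR.curveCls_eq hP]
    intro u hu
    rw [uIcc_of_le hst] at hu
    refine (h u ⟨has.trans hu.1, hu.2.trans htb⟩ s ⟨has, hst.trans htb⟩ ?_).trans_le hηR
    rw [abs_of_nonneg (by linarith [hu.1])]
    linarith [hu.2]

theorem IsHtpyScale.ladder (hR : IsHtpyScale X R) (hP : IsShortPaths P) (h0 : 0 < R) {c c' : C(ℝ, X)} {a b : ℝ}
    (hab : a ≤ b) (h : ∀ u ∈ Icc a b, dist (c' u) (c u) < R / 2) :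
    pathCls x₀ (P (c b) (c' b)) * curveCls x₀ c a b = curveCls x₀ c' a b * pathCls x₀ (P (c a) (c' a)) := by
  obtain ⟨δ, hδ, hc⟩ := hR.exists_curve_step (x₀ := x₀) hP c a b (half_pos h0) (by linarith)
  obtain ⟨δ', hδ', hc'⟩ := hR.exists_curve_step (x₀ := x₀) hP c' a b (half_pos h0) (by linarith)
  refine interval_induction (p := fun t => pathCls x₀ (P (c t) (c' t)) * curveCls x₀ c a t =
    curveCls x₀ c' a t * pathCls x₀ (P (c a) (c' a))) hab (lt_min hδ hδ') ?_ ?_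
  · simp only [curveCls_self, mul_one, one_mul]
  · intro s t has hst htb hd ih
    obtain ⟨h1, h2⟩ := hc s t has hst htb (hd.trans_le (min_le_left _ _))
    obtain ⟨h3, h4⟩ := hc' s t has hst htb (hd.trans_le (min_le_right _ _))
    rw [h2, h4, ← mul_assoc, mul_assoc _ _ (pathCls x₀ (P (c a) (c' a))), ← ih, ← mul_assoc,
      hR.short_mul hP (by linarith [h t ⟨has.trans hst, htb⟩]),
      hR.short_mul hP (by linarith [h s ⟨has, hst.trans htb⟩])]

theorem IsHtpyScale.curveCls_congr (hR : IsHtpyScale X R) (hP : IsShortPaths P) (h0 : 0 < R) {c c' : C(ℝ, X)} {a b : ℝ}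
    (hab : a ≤ b) (d : ℝ) (h : ∀ u ∈ Icc a b, c' (d + u) = c u) :
    curveCls x₀ c' (d + a) (d + b) = curveCls x₀ c a b := by
  let c'' : C(ℝ, X) := ⟨fun u => c' (d + u), by fun_prop⟩
  have e1 : curveCls x₀ c' (d + a) (d + b) = curveCls x₀ c'' a b := by
    have : (realPath (d + a) (d + b)).map c'.continuous = (realPath a b).map c''.continuous := by
      ext t
      simp only [Path.map_coe, Function.comp, c'', ContinuousMap.coe_mk, realPath, Path.coe_mk_mk]
      congr 1; ring
    exact congrArg (pathCls x₀) this
  have := hR.ladder (x₀ := x₀) hP h0 (c := c) (c' := c'') hab (fun u hu => by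
    show dist (c' (d + u)) (c u) < R / 2
    rw [h u hu, dist_self]; exact half_pos h0)
  have ha : c'' a = c a := h a ⟨le_rfl, hab⟩
  have hb : c'' b = c b := h b ⟨hab, le_rfl⟩
  rw [ha, hb, hR.short_self hP h0, hR.short_self hP h0, one_mul, mul_one] at this
  rw [e1, this]

theorem IsHtpyScale.group_fg [CompactSpace X] (hR : IsHtpyScale X R) (hP : IsShortPaths P) (h0 : 0 < R) :
    Group.FG (FundamentalGroup X x₀) := by
  obtain ⟨N, hN, hcov⟩ := finite_cover_balls_of_compact (isCompact_univ (X := X)) (by positivity : 0 < R / 8)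
  have hcov' : ∀ x, ∃ a ∈ insert x₀ N, dist a x < R / 8 := by
    intro x
    obtain ⟨a, ha, hx⟩ := mem_iUnion₂.1 (hcov.2 (mem_univ x))
    exact ⟨a, Or.inr ha, by rwa [mem_ball'] at hx⟩
  set N' := insert x₀ N with hN'
  have hfin : N'.Finite := hcov.1.insert x₀
  set S : Set (FundamentalGroup X x₀) := (fun z : X × X => pathCls x₀ (P z.1 z.2)) '' (N' ×ˢ N') with hS
  have hSm : ∀ a ∈ N', ∀ b ∈ N', pathCls x₀ (P a b) ∈ Subgroup.closure S := fun a ha b hb =>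
    Subgroup.subset_closure ⟨(a, b), ⟨ha, hb⟩, rfl⟩
  rw [Group.fg_iff]
  refine ⟨S, (Subgroup.eq_top_iff' _).2 fun g => ?_, (hfin.prod hfin).image _⟩
  obtain ⟨c, hc0, hc1, rfl⟩ := exists_curveCls x₀ g
  obtain ⟨δ, hδ, hc⟩ := hR.exists_curve_step (x₀ := x₀) hP c 0 1 (by positivity : 0 < R / 8) (by linarith)
  have key := interval_induction (p := fun t => ∀ a ∈ N', dist a (c t) < R / 8 →
    pathCls x₀ (P (c t) a) * curveCls x₀ c 0 t ∈ Subgroup.closure S) zero_le_one hδ ?_ ?_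
  · have := key x₀ (Or.inl rfl) (by rw [hc1, dist_self]; positivity)
    rwa [hc1, hR.short_self hP h0, one_mul] at this
  · intro a ha had
    rw [curveCls_self, mul_one, hc0]
    exact hSm _ (Or.inl rfl) _ ha
  · intro s t has hst htb hd ih a ha had
    obtain ⟨h1, h2⟩ := hc s t has hst htb hd
    obtain ⟨b, hb, hbd⟩ := hcov' (c s)
    have hba : dist a b < 3 * R / 8 := by
      linarith [dist_triangle a (c t) b, dist_triangle (c t) (c s) b, dist_comm b (c s)]
    rw [h2, ← mul_assoc, hR.short_mul hP (by linarith), ← hR.short_mul hP (y := b) (by linarith), mul_assoc]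
    exact mul_mem (hSm _ hb _ ha) (ih b hb hbd)

end

section

variable {X : Type*} [MetricSpace X]

theorem LipschitzWith.ite_le {f g : ℝ → X} {T : ℝ} (hf : LipschitzWith 1 f) (hg : LipschitzWith 1 g)
    (h : f T = g T) : LipschitzWith 1 fun u => if u ≤ T then f u else g u := by
  refine LipschitzWith.of_dist_le_mul fun u v => ?_
  have key : ∀ u v, u ≤ T → ¬ v ≤ T → dist (f u) (g v) ≤ dist u v := by
    intro u v hu hv
    push Not at hv
    have h1 := hf.dist_le_mul u T
    have h2 := hg.dist_le_mul T v
    have h3 := dist_triangle (f u) (f T) (g v)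
    rw [NNReal.coe_one, one_mul, Real.dist_eq, abs_of_nonpos (by linarith)] at h1 h2
    rw [Real.dist_eq, abs_of_nonpos (by linarith)]
    rw [← h] at h2
    linarith
  simp only [NNReal.coe_one, one_mul]
  by_cases hu : u ≤ T <;> by_cases hv : v ≤ T
  · simpa [hu, hv] using hf.dist_le_mul u v
  · simpa [hu, hv] using key u v hu hv
  · simpa [hu, hv, dist_comm] using key v u hv hu
  · simpa [hu, hv] using hg.dist_le_mul u v

/-- Any two points are joined by a curve parametrized by arc length. -/
def HasGeods (X : Type*) [MetricSpace X] : Prop :=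
  ∀ x y : X, ∃ γ : ℝ → X, LipschitzWith 1 γ ∧ γ 0 = x ∧ γ (dist y x) = y

theorem IsLengthSpace.hasGeods [CompactSpace X] (h : IsLengthSpace X) : HasGeods X := by
  intro x y
  obtain ⟨γ, hγ, h0, h1⟩ := h.exists_geod x y
  refine ⟨fun u => γ (projIcc 0 (dist x y) dist_nonneg u), ?_, ?_, ?_⟩
  · refine LipschitzWith.of_dist_le_mul fun u v => ?_
    have := (LipschitzWith.projIcc (a := 0) (b := dist x y) dist_nonneg).dist_le_mul u v
    rw [hγ.2 _ (projIcc _ _ _ u).2 _ (projIcc _ _ _ v).2]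
    simpa [Subtype.dist_eq, Real.dist_eq] using this
  · simp [h0]
  · rw [dist_comm y x]; simp [h1]

theorem HasGeods.exists_shortPaths (h : HasGeods X) : ∃ P : ∀ x y : X, Path x y, IsShortPaths P := by
  choose γ hγ h0 h1 using h
  refine ⟨fun x y => ⟨⟨fun t => γ x y (t * dist y x), ?_⟩, by simp [h0], by simp [h1]⟩, fun x y t => ?_⟩
  · have := (hγ x y).continuous
    fun_prop
  · have := (hγ x y).dist_le_mul (t * dist y x) 0
    rw [h0] at this
    refine this.trans ?_
    simp only [NNReal.coe_one, one_mul, Real.dist_eq, sub_zero]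
    rw [abs_of_nonneg (mul_nonneg t.2.1 dist_nonneg)]
    exact mul_le_of_le_one_left dist_nonneg t.2.2

theorem HasGeods.pathConnectedSpace [Nonempty X] (h : HasGeods X) : PathConnectedSpace X := by
  obtain ⟨P, -⟩ := h.exists_shortPaths
  exact ⟨inferInstance, fun x y => ⟨P x y⟩⟩

variable [PathConnectedSpace X] {x₀ : X} {R : ℝ} {P : ∀ x y : X, Path x y}

theorem IsHtpyScale.exists_lipschitz_rep (hR : IsHtpyScale X R) (hP : IsShortPaths P) (h0 : 0 < R)
    (hgeo : HasGeods X) (c : C(ℝ, X)) : ∃ (q : C(ℝ, X)) (T : ℝ), 0 ≤ T ∧ LipschitzWith 1 q ∧ q 0 = c 0 ∧ q T = c 1 ∧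
      curveCls x₀ q 0 T = curveCls x₀ c 0 1 := by
  obtain ⟨δ, hδ, hc⟩ := hR.exists_curve_step (x₀ := x₀) hP c 0 1 h0 le_rfl
  refine interval_induction (p := fun t => ∃ (q : C(ℝ, X)) (T : ℝ), 0 ≤ T ∧ LipschitzWith 1 q ∧ q 0 = c 0 ∧
    q T = c t ∧ curveCls x₀ q 0 T = curveCls x₀ c 0 t) zero_le_one hδ ?_ ?_
  · exact ⟨ContinuousMap.const _ (c 0), 0, le_rfl, (LipschitzWith.const _).weaken zero_le_one, rfl, rfl, by simp only [curveCls_self]⟩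
  · rintro s t has hst htb hd ⟨q, T, hT, hq, hq0, hqT, hqc⟩
    obtain ⟨h1, h2⟩ := hc s t has hst htb hd
    obtain ⟨γ, hγ, hγ0, hγ1⟩ := hgeo (c s) (c t)
    have hγ' : LipschitzWith 1 fun u => γ (u - T) := by
      refine LipschitzWith.of_dist_le_mul fun u v => ?_
      simpa using hγ.dist_le_mul (u - T) (v - T)
    have hL := hq.ite_le (T := T) hγ' (by simp only [sub_self, hγ0, hqT])
    let q' : C(ℝ, X) := ⟨_, hL.continuous⟩
    have hq'1 : ∀ u ≤ T, q' u = q u := fun u hu => if_pos hu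
    have hq'2 : ∀ u, T ≤ u → q' u = γ (u - T) := fun u hu => by
      rcases hu.eq_or_lt with rfl | hu
      · rw [hq'1 _ le_rfl, sub_self, hγ0, hqT]
      · exact if_neg (not_le.2 hu)
    refine ⟨q', T + dist (c t) (c s), by positivity, hL, (hq'1 0 hT).trans hq0, ?_, ?_⟩
    · rw [hq'2 _ (by linarith [dist_nonneg (x := c t) (y := c s)])]; simp [hγ1]
    · have e1 : q' T = c s := (hq'1 T le_rfl).trans hqT
      have e2 : q' (T + dist (c t) (c s)) = c t := by
        rw [hq'2 _ (by linarith [dist_nonneg (x := c t) (y := c s)])]; simp [hγ1]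
      have e3 : curveCls x₀ q' 0 T = curveCls x₀ q 0 T := by
        simpa using hR.curveCls_congr (x₀ := x₀) hP h0 (c := q) (c' := q') hT 0 fun u hu => by
          rw [zero_add]; exact hq'1 u hu.2
      have e4 : curveCls x₀ q' T (T + dist (c t) (c s)) = pathCls x₀ (P (c s) (c t)) := by
        rw [hR.curveCls_eq hP, e1, e2]
        intro u hu
        rw [uIcc_of_le (by linarith [dist_nonneg (x := c t) (y := c s)])] at hu
        have := hL.dist_le_mul u T
        refine lt_of_le_of_lt this ?_
        rw [NNReal.coe_one, one_mul, Real.dist_eq, abs_of_nonneg (by linarith [hu.1])]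
        linarith [hu.2]
      rw [← curveCls_mul x₀ q' 0 T, e3, e4, hqc, h2]

/-- A closed curve of length at most `T` which is not contractible. -/
def IsEssential (x₀ : X) (c : C(ℝ, X)) (T : ℝ) : Prop :=
  0 ≤ T ∧ LipschitzWith 1 c ∧ c T = c 0 ∧ curveCls x₀ c 0 T ≠ 1

theorem IsHtpyScale.exists_isLeast_essential [CompactSpace X] (hR : IsHtpyScale X R) (hP : IsShortPaths P) (h0 : 0 < R)
    (hne : ∃ c T, IsEssential x₀ c T) : ∃ c T, IsEssential x₀ c T ∧ ∀ c' T', IsEssential x₀ c' T' → T ≤ T' := by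
  set A : Set ℝ := {T | ∃ c, IsEssential x₀ c T} with hA
  have hAne : A.Nonempty := by obtain ⟨c, T, h⟩ := hne; exact ⟨T, c, h⟩
  have hAb : BddBelow A := ⟨0, by rintro T ⟨c, h⟩; exact h.1⟩
  obtain ⟨u, -, hu, huA⟩ := exists_seq_tendsto_sInf hAne hAb
  set T := sInf A with hT
  choose c hc using huA
  let U : Filter ℕ := hyperfilter ℕ
  have huU : Tendsto u U (𝓝 T) := hu.mono_left Nat.hyperfilter_le_atTop
  have hlim : ∀ x : ℝ, ∃ y, Tendsto (fun n => c n x) U (𝓝 y) := by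
    intro x
    obtain ⟨y, -, hy⟩ := (isCompact_univ (X := X)).ultrafilter_le_nhds ((hyperfilter ℕ).map fun n => c n x) (by simp)
    exact ⟨y, hy⟩
  choose g hg using hlim
  have hgL : LipschitzWith 1 g := by
    refine LipschitzWith.of_dist_le_mul fun x y => ?_
    exact le_of_tendsto ((hg x).dist (hg y)) (Eventually.of_forall fun n => (hc n).2.1.dist_le_mul x y)
  let g' : C(ℝ, X) := ⟨g, hgL.continuous⟩
  have hTn : 0 ≤ T := le_csInf hAne fun T ⟨c, h⟩ => h.1
  have hsm : ∀ {c : ℝ → X}, LipschitzWith 1 c → ∀ x y, dist (c x) (c y) ≤ |x - y| := fun hc x y => by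
    simpa [Real.dist_eq] using hc.dist_le_mul x y
  have hclose : ∀ η > 0, ∀ᶠ n in U, dist (c n (u n)) (c n T) < η := by
    intro η hη
    filter_upwards [Metric.tendsto_nhds.1 huU η hη] with n hn
    exact lt_of_le_of_lt (hsm (hc n).2.1 _ _) (by rwa [Real.dist_eq] at hn)
  have hgT : g T = g 0 := by
    refine eq_of_forall_dist_le fun η hη => ?_
    obtain ⟨n, h1, h2, h3⟩ := ((Metric.tendsto_nhds.1 (hg T) (η / 3) (by positivity)).and
      ((Metric.tendsto_nhds.1 (hg 0) (η / 3) (by positivity)).and (hclose (η / 3) (by positivity)))).exists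
    rw [(hc n).2.2.1] at h3
    linarith [dist_triangle (g T) (c n T) (g 0), dist_triangle (c n T) (c n 0) (g 0), dist_comm (g T) (c n T),
      dist_comm (c n T) (c n 0)]
  have hunif : ∀ᶠ n in U, ∀ x ∈ Icc 0 T, dist (c n x) (g x) < R / 8 := by
    obtain ⟨N, hN⟩ := exists_nat_gt (T / (R / 32))
    have : ∀ᶠ n in U, ∀ k ∈ Finset.range (N + 1), dist (c n (k * (R / 32))) (g (k * (R / 32))) < R / 32 :=
      (Finset.eventually_all _).2 fun k _ => Metric.tendsto_nhds.1 (hg _) (R / 32) (by positivity)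
    filter_upwards [this] with n hn x hx
    set k := ⌊x / (R / 32)⌋₊ with hk
    have hk1 : (k : ℝ) * (R / 32) ≤ x := by
      rw [← le_div_iff₀ (by positivity)]; exact Nat.floor_le (div_nonneg hx.1 (by positivity))
    have hk2 : x < (k + 1 : ℝ) * (R / 32) := by
      rw [← div_lt_iff₀ (by positivity)]; exact Nat.lt_floor_add_one _
    have hkN : k < N + 1 := by
      have : (k : ℝ) < N := by
        refine lt_of_le_of_lt ?_ hN
        rw [le_div_iff₀ (by positivity)]; exact hk1.trans hx.2
      exact_mod_cast this.trans (lt_add_one _)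
    have h1 := hn k (Finset.mem_range.2 hkN)
    have h2 := hsm (hc n).2.1 x (k * (R / 32))
    have h3 := hsm hgL (k * (R / 32)) x
    rw [abs_of_nonneg (by linarith)] at h2
    rw [abs_of_nonpos (by linarith)] at h3
    linarith [dist_triangle (c n x) (c n (k * (R / 32))) (g x),
      dist_triangle (c n (k * (R / 32))) (g (k * (R / 32))) (g x)]
  refine ⟨g', T, ⟨hTn, hgL, hgT, fun h1 => ?_⟩, fun c' T' h => csInf_le hAb ⟨c', h⟩⟩
  obtain ⟨n, hn, hn2, hn3⟩ := (hunif.and ((hclose (R / 8) (by positivity)).and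
    (Metric.tendsto_nhds.1 huU (R / 8) (by positivity)))).exists
  rw [Real.dist_eq] at hn3
  have hlad := hR.ladder (x₀ := x₀) hP h0 (c := g') (c' := c n) hTn (fun x hx => (hn x hx).trans (by linarith))
  rw [h1, mul_one] at hlad
  have hgT' : g' T = g' 0 := hgT
  have ha : dist (c n 0) (g' 0) < R / 8 := hn 0 ⟨le_rfl, hTn⟩
  have hb : dist (c n T) (g' 0) < R / 8 := hgT' ▸ hn T ⟨hTn, le_rfl⟩
  have hlast : curveCls x₀ (c n) T (u n) = pathCls x₀ (P (c n T) (c n (u n))) := by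
    refine hR.curveCls_eq hP fun x hx => ?_
    refine (hsm (hc n).2.1 _ _).trans_lt ?_
    have := abs_sub_left_of_mem_uIcc hx
    linarith
  refine (hc n).2.2.2 ?_
  have hfin : curveCls x₀ (c n) 0 T = pathCls x₀ (P (c n 0) (c n T)) := by
    have h2 : pathCls x₀ (P (c n 0) (g' 0)) * pathCls x₀ (P (g' 0) (c n 0)) = 1 := by
      rw [hR.short_mul hP (by rw [dist_comm (g' 0)]; linarith), hR.short_self hP h0]
    have h3 : pathCls x₀ (P (g' 0) (c n 0)) * pathCls x₀ (P (c n 0) (g' 0)) = 1 := by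
      rw [hR.short_mul hP (by rw [dist_comm (g' 0)]; linarith), hR.short_self hP h0]
    calc curveCls x₀ (c n) 0 T = curveCls x₀ (c n) 0 T *
          (pathCls x₀ (P (g' 0) (c n 0)) * pathCls x₀ (P (c n 0) (g' 0))) := by rw [h3, mul_one]
      _ = pathCls x₀ (P (g' 0) (c n T)) * pathCls x₀ (P (c n 0) (g' 0)) := by
          rw [← mul_assoc, ← hlad, hgT']
      _ = _ := hR.short_mul hP (by rw [dist_comm (g' 0)]; linarith)
  have hz := hclose
  rw [← curveCls_mul x₀ (c n) 0 T, hlast, hfin, hR.short_mul hP, (hc n).2.2.1, hR.short_self hP h0]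
  have := dist_triangle_right (c n T) (c n 0) (g' 0)
  linarith

theorem IsHtpyScale.injOn_of_least (hR : IsHtpyScale X R) (hP : IsShortPaths P) (h0 : 0 < R) {c : C(ℝ, X)} {T : ℝ}
    (hc : IsEssential x₀ c T) (hmin : ∀ c' T', IsEssential x₀ c' T' → T ≤ T') {s t : ℝ} (hs : 0 ≤ s) (hst : s < t)
    (ht : t < T) : c s ≠ c t := by
  intro h
  obtain ⟨hT, hL, hcT, hc1⟩ := hc
  have hsh : ∀ d, LipschitzWith 1 fun u => c (d + u) := fun d => by
    refine LipschitzWith.of_dist_le_mul fun u v => ?_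
    simpa using hL.dist_le_mul (d + u) (d + v)
  let c1 : C(ℝ, X) := ⟨fun u => c (s + u), by fun_prop⟩
  have e1 : curveCls x₀ c s t = 1 := by
    have e : curveCls x₀ c s t = curveCls x₀ c1 0 (t - s) := by
      have := hR.curveCls_congr (x₀ := x₀) hP h0 (c := c1) (c' := c) (a := 0) (b := t - s) (by linarith) s
        fun u _ => rfl
      simpa using this
    rw [e]
    by_contra hn
    have := hmin c1 (t - s) ⟨by linarith, hsh s, by simp [c1, h], hn⟩
    linarith
  have hL2 := hL.ite_le (T := s) (hsh (t - s)) (by simp [h])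
  let c2 : C(ℝ, X) := ⟨_, hL2.continuous⟩
  have hc21 : ∀ u ≤ s, c2 u = c u := fun u hu => if_pos hu
  have hc22 : ∀ u, s ≤ u → c2 u = c (t - s + u) := fun u hu => by
    rcases hu.eq_or_lt with rfl | hu
    · rw [hc21 _ le_rfl, h]; congr 1; ring
    · exact if_neg (not_le.2 hu)
  have e2 : curveCls x₀ c2 0 s = curveCls x₀ c 0 s := by
    simpa using hR.curveCls_congr (x₀ := x₀) hP h0 (c := c) (c' := c2) hs 0 fun u hu => by
      rw [zero_add]; exact hc21 u hu.2
  have e3 : curveCls x₀ c t T = curveCls x₀ c2 s (T - (t - s)) := by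
    have := hR.curveCls_congr (x₀ := x₀) hP h0 (c := c2) (c' := c) (a := s) (b := T - (t - s)) (by linarith) (t - s)
        fun u hu => (hc22 u hu.1).symm
    rw [← this]; congr 1 <;> ring
  have e4 : curveCls x₀ c2 0 (T - (t - s)) = 1 := by
    by_contra hn
    have := hmin c2 (T - (t - s)) ⟨by linarith, hL2, by
      rw [hc21 0 hs, hc22 _ (by linarith), ← hcT]; congr 1; ring, hn⟩
    linarith
  refine hc1 ?_
  rw [← curveCls_mul x₀ c 0 t T, ← curveCls_mul x₀ c 0 s t, e1, one_mul, e3, ← e2, curveCls_mul, e4]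

end

section

/-- The parametrization of the circle by turns. -/
noncomputable def circTurn (u : ℝ) : Circle1 :=
  ⟨!₂[Real.cos (2 * Real.pi * u), Real.sin (2 * Real.pi * u)], by
    simp [Circle1, EuclideanSpace.norm_eq, Fin.sum_univ_two]⟩

theorem continuous_circTurn : Continuous circTurn := by
  refine Continuous.subtype_mk ((PiLp.continuous_toLp 2 _).comp (continuous_pi fun i => ?_)) _
  fin_cases i
  · simp; fun_prop
  · simp; fun_prop

theorem circTurn_eq_iff {u v : ℝ} : circTurn u = circTurn v ↔ ∃ k : ℤ, u - v = k := by
  have hpi := Real.pi_pos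
  constructor
  · intro h
    have h0 : Real.cos (2 * Real.pi * u) = Real.cos (2 * Real.pi * v) := by
      simpa [circTurn] using congrArg (fun z : Circle1 => z.1 0) h
    have h1 : Real.sin (2 * Real.pi * u) = Real.sin (2 * Real.pi * v) := by
      simpa [circTurn] using congrArg (fun z : Circle1 => z.1 1) h
    obtain ⟨k, hk⟩ := Real.Angle.angle_eq_iff_two_pi_dvd_sub.1 (Real.Angle.cos_sin_inj h0 h1)
    exact ⟨k, mul_left_cancel₀ (by positivity : 2 * Real.pi ≠ 0) (by linarith)⟩
  · rintro ⟨k, hk⟩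
    have : 2 * Real.pi * u = 2 * Real.pi * v + k * (2 * Real.pi) := by
      rw [← hk]; ring
    refine Subtype.ext ?_
    simp only [circTurn]
    rw [this, Real.cos_add_int_mul_two_pi, Real.sin_add_int_mul_two_pi]

theorem exists_circTurn (z : Circle1) : ∃ u, circTurn u = z := by
  obtain ⟨z, hz⟩ := z
  have hz' : z 0 ^ 2 + z 1 ^ 2 = 1 := by
    simpa [Circle1, EuclideanSpace.norm_eq, Fin.sum_univ_two] using hz
  set w : ℂ := ⟨z 0, z 1⟩ with hw
  have hn : ‖w‖ = 1 := by
    rw [Complex.norm_def, Complex.normSq_mk, Real.sqrt_eq_one]; linarith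
  have hw0 : w ≠ 0 := fun h => by simp [h] at hn
  refine ⟨w.arg / (2 * Real.pi), Subtype.ext ?_⟩
  have e : 2 * Real.pi * (w.arg / (2 * Real.pi)) = w.arg := by
    have := Real.pi_pos; field_simp
  simp only [circTurn]
  rw [e, Complex.cos_arg hw0, Complex.sin_arg, hn]
  ext i
  fin_cases i <;> simp [hw]

theorem exists_circTurn_Ico (z : Circle1) (a : ℝ) : ∃ u ∈ Ico a (a + 1), circTurn u = z := by
  obtain ⟨u, rfl⟩ := exists_circTurn z
  refine ⟨a + Int.fract (u - a), ⟨by linarith [Int.fract_nonneg (u - a)], by linarith [Int.fract_lt_one (u - a)]⟩,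
    circTurn_eq_iff.2 ⟨-⌊u - a⌋, ?_⟩⟩
  have := Int.self_sub_floor (u - a)
  push_cast
  linarith

/-- A closed curve factors through the circle. -/
theorem exists_circle_map {X : Type*} [TopologicalSpace X] {c : ℝ → X} (hc : ContinuousOn c (Icc 0 1)) (h : c 0 = c 1) :
    ∃ g : C(Circle1, X), ∀ u ∈ Icc (0 : ℝ) 1, g (circTurn u) = c u := by
  let π : C(Icc (0 : ℝ) 1, Circle1) := ⟨fun u => circTurn u, continuous_circTurn.comp continuous_subtype_val⟩
  have hsur : Function.Surjective π := fun z => by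
    obtain ⟨u, hu, rfl⟩ := exists_circTurn_Ico z 0
    exact ⟨⟨u, hu.1, by linarith [hu.2]⟩, rfl⟩
  have hq : IsQuotientMap π := π.continuous.isClosedMap.isQuotientMap π.continuous hsur
  let c' : C(Icc (0 : ℝ) 1, X) := ⟨fun u => c u, hc.comp_continuous continuous_subtype_val fun u => u.2⟩
  have hfac : Function.FactorsThrough c' π := by
    rintro ⟨u, hu⟩ ⟨v, hv⟩ huv
    obtain ⟨k, hk⟩ := circTurn_eq_iff.1 huv
    have h1 : (k : ℝ) ≤ 1 := by linarith [hu.2, hv.1]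
    have h2 : (-1 : ℝ) ≤ k := by linarith [hu.1, hv.2]
    have h1' : k ≤ 1 := by exact_mod_cast h1
    have h2' : -1 ≤ k := by exact_mod_cast h2
    show c u = c v
    obtain rfl | rfl | rfl : k = -1 ∨ k = 0 ∨ k = 1 := by omega
    · push_cast at hk
      rw [show u = 0 by linarith [hu.1, hv.2], show v = 1 by linarith [hu.1, hv.2], h]
    · push_cast at hk
      rw [show u = v by linarith]
    · push_cast at hk
      rw [show v = 0 by linarith [hv.1, hu.2], show u = 1 by linarith [hv.1, hu.2], h]
  refine ⟨hq.lift c' hfac, fun u hu => ?_⟩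
  have := congrArg (fun f => f ⟨u, hu⟩) (hq.lift_comp c' hfac)
  exact this

variable {X : Type*} [MetricSpace X] [PathConnectedSpace X] {x₀ : X} {R : ℝ} {P : ∀ x y : X, Path x y}

theorem IsHtpyScale.curveCls_eq_one_of_nullhomotopic (hR : IsHtpyScale X R) (hP : IsShortPaths P) (h0 : 0 < R)
    {c : C(ℝ, X)} {T : ℝ} (hT : 0 < T) {g : C(Circle1, X)} (hg : ∀ t ∈ Icc 0 T, g (circTurn (t / T)) = c t)
    (hn : IsNullhomotopic g) : curveCls x₀ c 0 T = 1 := by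
  obtain ⟨y, ⟨H⟩⟩ := hn
  let F : ℝ → C(ℝ, X) := fun s => ⟨fun t => H (projIcc 0 1 zero_le_one s, circTurn (t / T)),
    H.continuous.comp (continuous_const.prodMk (continuous_circTurn.comp (by fun_prop)))⟩
  have hF0 : ∀ u, F 0 u = g (circTurn (u / T)) := fun u => by
    show H (projIcc 0 1 zero_le_one (0 : ℝ), circTurn (u / T)) = _
    rw [projIcc_left]
    exact H.apply_zero (circTurn (u / T))
  have hF1 : ∀ u, F 1 u = y := fun u => by
    show H (projIcc 0 1 zero_le_one (1 : ℝ), circTurn (u / T)) = _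
    rw [projIcc_right]
    exact H.apply_one (circTurn (u / T))
  have hper : ∀ s, F s T = F s 0 := fun s => by
    show H _ = H _
    congr 2
    exact circTurn_eq_iff.2 ⟨1, by field_simp; simp⟩
  have hu : UniformContinuous H := CompactSpace.uniformContinuous_of_continuous H.continuous
  obtain ⟨δ, hδ, hd⟩ := Metric.uniformContinuous_iff.1 hu (R / 4) (by positivity)
  have hstep : ∀ s t, 0 ≤ s → s ≤ t → t ≤ 1 → t - s < δ → ∀ u, dist (F s u) (F t u) < R / 4 := by
    intro s t hs hst ht hst' u
    refine hd ?_
    rw [Prod.dist_eq, dist_self, max_eq_left dist_nonneg, Subtype.dist_eq, projIcc_of_mem _ ⟨hs, hst.trans ht⟩,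
      projIcc_of_mem _ ⟨hs.trans hst, ht⟩, Real.dist_eq, abs_of_nonpos (by simp; linarith)]
    simp; linarith
  have key := interval_induction (p := fun s => curveCls x₀ (F s) 0 T = 1 → curveCls x₀ (F 0) 0 T = 1) (a := 0) (b := 1)
    zero_le_one hδ id (fun s t hs hst ht hst' ih h1 => ih ?_)
  · have e0 : curveCls x₀ (F 1) 0 T = 1 := by
      rw [hR.curveCls_eq hP]
      · rw [hper]; exact hR.short_self hP h0 _
      · intro u _
        rw [hF1, hF1, dist_self]; exact h0
    have e1 := hR.curveCls_congr (x₀ := x₀) hP h0 (c := c) (c' := F 0) hT.le 0 fun u hu => by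
      rw [zero_add, ← hg u hu, hF0]
    rw [zero_add, zero_add] at e1
    rw [← e1]; exact key e0
  · have hlad := hR.ladder (x₀ := x₀) hP h0 (c := F t) (c' := F s) hT.le
      (fun u _ => (hstep s t hs hst ht hst' u).trans (by linarith))
    rw [h1, mul_one, hper, hper] at hlad
    exact mul_right_cancel (hlad.symm.trans (one_mul _).symm)

theorem IsMetricDouble.fundamentalGroup_subsingleton [CompactSpace X] (hX : IsSurface X) (hgeo : HasGeods X)
    {D : Type*} [MetricSpace D] {ip im : X → D} {B : Set X} (hD : IsMetricDouble X B D ip im) (hB : IsCompact B)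
    (hne : B.Nonempty) (hJ : ∀ J : Set D, ¬ IsNonContractibleJordanCurve J) (x₀ : X) :
    ∀ a : FundamentalGroup X x₀, a = 1 := by
  intro a
  by_contra ha
  obtain ⟨R, h0, hR⟩ := hX.exists_htpyScale
  obtain ⟨P, hP⟩ := hgeo.exists_shortPaths
  obtain ⟨c, hc0, hc1, rfl⟩ := exists_curveCls x₀ a
  obtain ⟨q, T, hT, hq, hq0, hqT, hqc⟩ := hR.exists_lipschitz_rep (x₀ := x₀) hP h0 hgeo c
  obtain ⟨c, T, hc, hmin⟩ := hR.exists_isLeast_essential (x₀ := x₀) hP h0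
    ⟨q, T, hT, hq, by rw [hq0, hqT, hc0, hc1], by rwa [hqc]⟩
  have hT : 0 < T := by
    refine lt_of_le_of_ne hc.1 fun h => hc.2.2.2 ?_
    rw [← h, curveCls_self]
  obtain ⟨g, hg⟩ := exists_circle_map (c := fun u => c (u * T)) (by fun_prop) (by simp [hc.2.2.1])
  have hinj : Function.Injective g := by
    intro z z' h
    obtain ⟨u, hu, rfl⟩ := exists_circTurn_Ico z 0
    obtain ⟨v, hv, rfl⟩ := exists_circTurn_Ico z' 0
    rw [zero_add] at hu hv
    rw [hg u ⟨hu.1, hu.2.le⟩, hg v ⟨hv.1, hv.2.le⟩] at h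
    by_contra hne
    rcases lt_trichotomy u v with huv | rfl | huv
    · exact hR.injOn_of_least hP h0 hc hmin (mul_nonneg hu.1 hT.le) (mul_lt_mul_of_pos_right huv hT)
        (by nlinarith [hv.2]) h
    · exact hne rfl
    · exact hR.injOn_of_least hP h0 hc hmin (mul_nonneg hv.1 hT.le) (mul_lt_mul_of_pos_right huv hT)
        (by nlinarith [hu.2]) h.symm
  let ip' : C(X, D) := ⟨ip, hD.isom_p.continuous⟩
  obtain ⟨l, hl, h1, -⟩ := hD.exists_glue hB hne (f := id) (g := id) continuous_id continuous_id fun _ _ => rfl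
  obtain ⟨y, hy⟩ := isNullhomotopic_of_range (f := ip'.comp g) (hD.isom_p.injective.comp hinj) (hJ _)
  have hnull : IsNullhomotopic g := by
    refine ⟨l y, ?_⟩
    have := (ContinuousMap.Homotopic.refl (⟨l, hl⟩ : C(D, X))).comp hy
    have e : (⟨l, hl⟩ : C(D, X)).comp (ip'.comp g) = g := by ext z; exact h1 _
    rw [e] at this
    exact this
  refine hc.2.2.2 (hR.curveCls_eq_one_of_nullhomotopic hP h0 hT (g := g) (fun t ht => ?_) hnull)
  rw [hg _ ⟨div_nonneg ht.1 hT.le, div_le_one_of_le₀ ht.2 hT.le⟩]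
  rw [div_mul_cancel₀ _ hT.ne']

end

section

section LogIncrement

variable {X : Type*} [TopologicalSpace X] {w : X → ℂ}

/-- `v` is the increment of a logarithm of `w` along the path `q`. -/
def LogInc (w : X → ℂ) {x y : X} (q : Path x y) (v : ℂ) : Prop :=
  ∃ (a : ℂ) (l : Path a (a + v)), ∀ t, w (q t) = Complex.exp (l t)

theorem exists_logInc (hw : Continuous w) (h0 : ∀ x, w x ≠ 0) {x y : X} (q : Path x y) : ∃ v, LogInc w q v := by
  obtain ⟨G, hG, h⟩ := exists_log_homotopy (A := Unit) (H := fun p => w (q p.1)) (by fun_prop) (fun _ => h0 _)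
    (g := fun _ => Complex.log (w x)) continuous_const fun _ => by simp [Complex.exp_log (h0 x)]
  exact ⟨G (1, ()) - G (0, ()), G (0, ()), ⟨⟨fun t => G (t, ()), by fun_prop⟩, rfl, by simp⟩, fun t => h (t, ())⟩

theorem LogInc.unique {x y : X} {q : Path x y} {v v' : ℂ} (h : LogInc w q v) (h' : LogInc w q v') : v = v' := by
  obtain ⟨a, l, hl⟩ := h
  obtain ⟨a', l', hl'⟩ := h'
  have := log_unique (S := (univ : Set I)) isPreconnected_univ l.continuous.continuousOn l'.continuous.continuousOn
    (fun t _ => (hl t).symm.trans (hl' t)) (x := 0) (y := 1) trivial trivial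
  simp only [Path.source, Path.target] at this
  linear_combination -this

theorem LogInc.trans {x y z : X} {p : Path x y} {q : Path y z} {v v' : ℂ} (h : LogInc w p v) (h' : LogInc w q v') :
    LogInc w (p.trans q) (v + v') := by
  obtain ⟨a, l, hl⟩ := h
  obtain ⟨a', l', hl'⟩ := h'
  have he : Complex.exp (a + v) = Complex.exp a' := by
    have h1 := hl 1
    have h2 := hl' 0
    simp only [Path.source, Path.target] at h1 h2
    rw [← h1, ← h2]
  let l'' : Path (a + v) (a + (v + v')) :=
    ⟨⟨fun t => l' t + (a + v - a'), by fun_prop⟩, by simp, by simp; ring⟩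
  refine ⟨a, l.trans l'', fun t => ?_⟩
  rw [Path.trans_apply, Path.trans_apply]
  split_ifs
  · exact hl _
  · show _ = Complex.exp (l' _ + (a + v - a'))
    rw [Complex.exp_add, Complex.exp_sub, he, div_self (Complex.exp_ne_zero _), mul_one]
    exact hl' _

theorem LogInc.homotopic (hw : Continuous w) (h0 : ∀ x, w x ≠ 0) {x y : X} {p q : Path x y} (hpq : p.Homotopic q)
    {v : ℂ} (h : LogInc w p v) : LogInc w q v := by
  obtain ⟨F⟩ := hpq
  obtain ⟨a, l, hl⟩ := h
  obtain ⟨G, hG, hGe⟩ := exists_log_homotopy (A := I) (H := fun p => w (F p)) (by fun_prop) (fun _ => h0 _)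
    (g := l) l.continuous fun t => by simpa using hl t
  have hend : ∀ e : I, (e = 0 ∨ e = 1) → G (1, e) = G (0, e) := by
    intro e he
    have := log_unique (S := (univ : Set I)) isPreconnected_univ (g₁ := fun s => G (s, e)) (g₂ := fun _ => G (0, e))
      (by fun_prop) (by fun_prop) (fun s _ => by
        rw [← hGe, ← hGe]
        rcases he with rfl | rfl <;> simp) (x := 1) (y := 0) trivial trivial
    simpa [sub_eq_zero] using this
  have hlG := log_unique (S := (univ : Set I)) isPreconnected_univ (g₁ := fun t => G (0, t)) (g₂ := l)
      (by fun_prop) (by fun_prop) (fun t _ => by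
        rw [← hGe, ← hl]; simp) (x := 1) (y := 0) trivial trivial
  simp only [Path.source, Path.target] at hlG
  refine ⟨G (1, 0), ⟨⟨fun t => G (1, t), by fun_prop⟩, rfl, ?_⟩, fun t => ?_⟩
  · simp only
    rw [hend 0 (Or.inl rfl), hend 1 (Or.inr rfl)]
    linear_combination hlG
  · have := hGe (1, t)
    simpa using this

theorem LogInc.refl (h0 : ∀ x, w x ≠ 0) (x : X) : LogInc w (Path.refl x) 0 := by
  refine ⟨Complex.log (w x), ⟨⟨fun _ => Complex.log (w x), by fun_prop⟩, rfl, by simp⟩, fun t => ?_⟩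
  show _ = Complex.exp (Complex.log (w x))
  rw [Complex.exp_log (h0 x)]; simp

theorem LogInc.exp_eq {x y : X} {p : Path x y} {v : ℂ} (h : LogInc w p v) : w y = w x * Complex.exp v := by
  obtain ⟨a, l, hl⟩ := h
  have h1 := hl 1
  have h2 := hl 0
  simp only [Path.source, Path.target] at h1 h2
  rw [h1, h2, Complex.exp_add]

theorem logInc_of_ball (hw : Continuous w) (h0 : ∀ x, w x ≠ 0) {x y : X} {p : Path x y}
    (h : ∀ t, w (p t) / w x ∈ Complex.slitPlane) : LogInc w p (Complex.log (w y / w x)) := by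
  refine ⟨Complex.log (w x), ⟨⟨fun t => Complex.log (w (p t) / w x) + Complex.log (w x), ?_⟩, ?_, ?_⟩, fun t => ?_⟩
  · exact ((by fun_prop : Continuous fun t => w (p t) / w x).clog h).add continuous_const
  · simp [div_self (h0 x)]
  · simp [add_comm]
  · show _ = Complex.exp (Complex.log _ + Complex.log _)
    rw [Complex.exp_add, Complex.exp_log (div_ne_zero (h0 _) (h0 _)), Complex.exp_log (h0 _), div_mul_cancel₀ _ (h0 x)]

end LogIncrement

theorem hasLogOn_of_logInc_loop {X : Type*} [MetricSpace X] [PathConnectedSpace X] {P : ∀ x y : X, Path x y}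
    (hP : IsShortPaths P) {w : X → ℂ} (hw : Continuous w) (h0 : ∀ x, w x ≠ 0) {x₀ : X}
    (h : ∀ (q : Path x₀ x₀) v, LogInc w q v → v = 0) : HasLogOn w univ := by
  have hind : ∀ {y} (p q : Path x₀ y) (v v' : ℂ), LogInc w p v → LogInc w q v' → v = v' := by
    intro y p q v v' hv hv'
    obtain ⟨u, hu⟩ := exists_logInc hw h0 q.symm
    have h1 := h _ _ (hv.trans hu)
    have h2 := h _ _ (hv'.trans hu)
    linear_combination h1 - h2
  choose g hg using fun y => exists_logInc hw h0 (P x₀ y)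
  refine ⟨fun y => Complex.log (w x₀) + g y, continuousOn_const.add (continuous_iff_continuousAt.2 fun x => ?_).continuousOn,
    fun y _ => ?_⟩
  · have hU : {y | w y / w x ∈ Complex.slitPlane} ∈ 𝓝 x := by
      refine (Complex.isOpen_slitPlane.preimage (by fun_prop : Continuous fun y => w y / w x)).mem_nhds ?_
      simp [div_self (h0 x)]
    obtain ⟨ε, hε, hb⟩ := Metric.mem_nhds_iff.1 hU
    have he : ∀ᶠ y in 𝓝 x, g y = g x + Complex.log (w y / w x) := by
      filter_upwards [ball_mem_nhds x hε] with y hy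
      have := logInc_of_ball (p := P x y) hw h0 fun t => hb (mem_ball.2 ((hP x y t).trans_lt hy))
      exact hind _ _ _ _ (hg y) ((hg x).trans this)
    refine ContinuousAt.congr_of_eventuallyEq ?_ he
    refine continuousAt_const.add (ContinuousAt.clog (by fun_prop) ?_)
    simp [div_self (h0 x)]
  · rw [(hg y).exp_eq, Complex.exp_add, Complex.exp_log (h0 x₀)]

/-- On a compact surface whose first homology has rank zero, every nowhere vanishing function
has a logarithm. -/
theorem IsSurface.hasLogOn_of_h1Rank {X : Type*} [MetricSpace X] [CompactSpace X] [PathConnectedSpace X]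
    (hX : IsSurface X) (hgeo : HasGeods X) (hr : h1Rank X = 0) {w : X → ℂ} (hw : Continuous w) (h0 : ∀ x, w x ≠ 0) :
    HasLogOn w univ := by
  obtain ⟨R, hR0, hR⟩ := hX.exists_htpyScale
  obtain ⟨P, hP⟩ := hgeo.exists_shortPaths
  obtain ⟨x₀⟩ : Nonempty X := inferInstance
  have hfg := hR.group_fg (x₀ := x₀) hP hR0
  have hfgA : Group.FG (Abelianization (FundamentalGroup X x₀)) := QuotientGroup.fg _
  have hfin : Module.Finite ℤ (Additive (Abelianization (FundamentalGroup X x₀))) :=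
    Module.Finite.iff_addGroup_fg.2 (GroupFG.iff_add_fg.1 hfgA)
  have hbdd : BddAbove (range fun x : X =>
      (Module.rank ℤ (Additive (Abelianization (FundamentalGroup X x)))).toNat) := by
    refine ⟨(Module.rank ℤ (Additive (Abelianization (FundamentalGroup X x₀)))).toNat, ?_⟩
    rintro _ ⟨x, rfl⟩
    have e := (MulEquiv.toAdditive
      (FundamentalGroup.fundamentalGroupMulEquivOfPathConnected x x₀).abelianizationCongr).toIntLinearEquiv.rank_eq
    simp only [e, le_refl]
  have hrank : Module.rank ℤ (Additive (Abelianization (FundamentalGroup X x₀))) = 0 := by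
    have h1 : (Module.rank ℤ (Additive (Abelianization (FundamentalGroup X x₀)))).toNat ≤ h1Rank X := le_ciSup hbdd x₀
    rw [hr, Nat.le_zero, Cardinal.toNat_eq_zero] at h1
    exact h1.resolve_right (not_le.2 (Module.rank_lt_aleph0 _ _))
  choose rep hrep using exists_pathCls x₀
  choose L hL using fun g => exists_logInc hw h0 (rep g)
  have hLeq : ∀ (q : Path x₀ x₀) v, LogInc w q v → L (pathCls x₀ q) = v := fun q v hv =>
    (hL _).unique (hv.homotopic hw h0 ((pathCls_eq_iff x₀).1 (hrep _).symm))
  let Φ : FundamentalGroup X x₀ →* Multiplicative ℂ :=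
    { toFun := fun g => Multiplicative.ofAdd (L g)
      map_one' := by
        rw [← pathCls_refl x₀ x₀, hLeq _ _ (LogInc.refl h0 x₀)]; rfl
      map_mul' := fun a b => by
        have : a * b = pathCls x₀ ((rep b).trans (rep a)) := by rw [pathCls_trans, hrep, hrep]
        rw [this, hLeq _ _ ((hL b).trans (hL a)), add_comm]; rfl }
  have hΦ : ∀ g, L g = 0 := by
    intro g
    obtain ⟨n, hn, hng⟩ := rank_eq_zero_iff.1 hrank (Additive.ofMul (Abelianization.of g))
    have h1 : Abelianization.of g ^ n = 1 := hng
    have h2 : Φ g ^ n = 1 := by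
      rw [← Abelianization.lift_apply_of Φ g, ← map_zpow, h1, map_one]
    have h3 : n • L g = 0 := h2
    exact (smul_eq_zero.1 h3).resolve_left hn
  exact hasLogOn_of_logInc_loop hP hw h0 fun q v hv => (hLeq q v hv).symm.trans (hΦ _)

theorem h1Rank_eq_zero_of_subsingleton {X : Type*} [TopologicalSpace X]
    (h : ∀ (x : X) (a : FundamentalGroup X x), a = 1) : h1Rank X = 0 := by
  rw [h1Rank]
  have : ∀ x : X, (Module.rank ℤ (Additive (Abelianization (FundamentalGroup X x)))).toNat = 0 := by
    intro x
    have : Subsingleton (FundamentalGroup X x) := ⟨fun a b => (h x a).trans (h x b).symm⟩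
    have : Subsingleton (Additive (Abelianization (FundamentalGroup X x))) :=
      inferInstanceAs (Subsingleton (_ ⧸ _))
    rw [rank_subsingleton', map_zero]
  simp only [this]
  rcases isEmpty_or_nonempty X with _ | _ <;> simp

end

section

/-- If every nowhere vanishing function on a surface has a logarithm, then the boundary is
connected. -/
theorem IsSurface.isPreconnected_boundary {X : Type*} [TopologicalSpace X] [T2Space X] [CompactSpace X]
    [PreconnectedSpace X] (hX : IsSurface X)
    (hlog : ∀ w : X → ℂ, Continuous w → (∀ x, w x ≠ 0) → HasLogOn w univ) : IsPreconnected (surfaceBoundary X) := by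
  refine isPreconnected_of_forall_pair fun x hx y hy => ?_
  set b := connectedComponentIn (surfaceBoundary X) x with hb
  by_cases hyb : y ∈ b
  · exact ⟨b, connectedComponentIn_subset _ _, mem_connectedComponentIn hx, hyb, isPreconnected_connectedComponentIn⟩
  exfalso
  have hbc : b ∈ surfaceBoundaryComponents X := ⟨x, hx, rfl⟩
  obtain ⟨hbs, hbcl, -⟩ := boundary_component_clopen hX hbc
  obtain ⟨k₃, hk₃, hk₃x, -⟩ := exists_half_patch hX hx isOpen_univ (mem_univ x)
  obtain ⟨k₄, hk₄, hk₄y, hk₄b⟩ := exists_half_patch hX hy hbcl.isOpen_compl hyb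
  obtain ⟨w, hw, hw0, -, e, -, hwe⟩ := exists_twist hX isOpen_univ isPreconnected_univ hk₃ hk₄ (subset_univ _)
    (subset_univ _)
  obtain ⟨g, hg, hge⟩ := hlog w hw hw0
  obtain ⟨r, ρ, hr, hρ, hr2, hρ2, -, hrρ⟩ := exists_twist_root hk₃
  have hwb : ∀ z ∈ b, w z = patchExt cHalf k₃ cay z := by
    intro z hz
    rw [hwe z (hbs hz), patchExt_of_notMem _ fun h => hk₄b h hz, one_zpow, mul_one]
  set s : X → ℂ := fun z => Complex.exp (g z / 2) with hs
  have hgc : Continuous g := continuousOn_univ.1 hg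
  have hsc : Continuous s := by fun_prop
  have hs2 : ∀ z ∈ b, s z ^ 2 = patchExt cHalf k₃ cay z := by
    intro z hz
    rw [← hwb z hz, hge z trivial, hs, ← Complex.exp_nat_mul]
    congr 1; push_cast; ring
  have hne : ∀ z ∈ b, patchExt cHalf k₃ cay z ≠ 0 := fun z hz => patchExt_cay_ne_zero hk₃ (hbs hz)
  obtain ⟨c, hc, hcr, hce⟩ := exists_boundary_circle hX hbc
  obtain ⟨u₀, hu₀⟩ : x ∈ range c := hcr ▸ mem_connectedComponentIn hx
  have hpre : IsPreconnected (b \ {x}) := by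
    have : b \ {x} = c '' Ioo u₀ (u₀ + 1) := by
      ext z
      constructor
      · rintro ⟨hz, hzx⟩
        rw [← hcr] at hz
        obtain ⟨u, rfl⟩ := hz
        have f0 := Int.fract_nonneg (u - u₀)
        have f1 := Int.fract_lt_one (u - u₀)
        have hf := Int.self_sub_floor (u - u₀)
        refine ⟨u₀ + Int.fract (u - u₀), ⟨?_, by linarith⟩, (hce _ _).2 ⟨-⌊u - u₀⌋, by push_cast; linarith⟩⟩
        refine lt_of_le_of_ne (by linarith) fun h => hzx ?_
        rw [← hu₀]
        exact (hce _ _).2 ⟨⌊u - u₀⌋, by linarith⟩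
      · rintro ⟨u, hu, rfl⟩
        refine ⟨hcr ▸ mem_range_self u, fun h => ?_⟩
        rw [mem_singleton_iff, ← hu₀, hce] at h
        obtain ⟨n, hn⟩ := h
        have h1 : (n : ℝ) < 1 := by linarith [hu.2]
        have h2 : (0 : ℝ) < n := by linarith [hu.1]
        have h1' : n < 1 := by exact_mod_cast h1
        have h2' : 0 < n := by exact_mod_cast h2
        omega
    rw [this]
    exact isPreconnected_Ioo.image c hc.continuousOn
  have hball : ∀ t : ℝ, |t| < 1 → (t : ℂ) ∈ ball (0 : ℂ) 1 ∩ cHalf := fun t ht =>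
    ⟨by simpa using ht, by simp [cHalf]⟩
  have hkc : ContinuousOn (fun t : ℝ => k₃ t) (Ioo (-1) 1) :=
    hk₃.cont.comp Complex.continuous_ofReal.continuousOn fun t ht =>
      ⟨ball_subset_closedBall (hball t (abs_lt.2 ht)).1, (hball t (abs_lt.2 ht)).2⟩
  have hkb : ∀ t ∈ Ioo (-1 : ℝ) 1, k₃ t ∈ b := by
    have := (isPreconnected_Ioo.image _ hkc).subset_connectedComponentIn (x := x) (F := surfaceBoundary X)
      ⟨0, by norm_num, by simpa using hk₃x⟩ (by
        rintro _ ⟨t, ht, rfl⟩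
        exact mem_boundary_of_half hk₃ (abs_lt.2 ht))
    exact fun t ht => this ⟨t, ht, rfl⟩
  have hkx : ∀ t ∈ Ioo (-1 : ℝ) 1, t ≠ 0 → k₃ t ≠ x := by
    intro t ht h0 h
    rw [← hk₃x] at h
    have h1 := hball t (abs_lt.2 ht)
    have := hk₃.inj ⟨ball_subset_closedBall h1.1, h1.2⟩ ⟨by simp, by simp [cHalf]⟩ h
    exact h0 (by exact_mod_cast this)
  have hm1 : (1 / 2 : ℝ) ∈ Ioo (-1 : ℝ) 1 := by norm_num
  have hm2 : (-(1 / 2) : ℝ) ∈ Ioo (-1 : ℝ) 1 := by norm_num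
  have hr0 : ∀ z ∈ b \ {x}, r z ≠ 0 := fun z hz h => hne z hz.1 (by
    rw [← hr2 z (hbs hz.1) (by rw [hk₃x]; exact hz.2), h]; simp)
  have hρm : ∀ t ∈ Ioo (-1 : ℝ) 1, k₃ t ∈ surfaceBoundary X ∩ k₃ '' (ball 0 1 ∩ cHalf) := fun t ht =>
    ⟨hbs (hkb t ht), t, hball t (abs_lt.2 ht), rfl⟩
  have hρ0 : ∀ t ∈ Ioo (-1 : ℝ) 1, ρ (k₃ t) ≠ 0 := fun t ht h => hne _ (hkb t ht) (by
    rw [← hρ2 _ (hρm t ht), h]; simp)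
  have h1 := sign_const_of_preconnected hpre (τ := fun z => s z / r z)
    (hsc.continuousOn.div (hr.mono fun z hz => ⟨hbs hz.1, by rw [hk₃x]; exact hz.2⟩) hr0) (fun z hz => by
      rw [div_pow, hs2 z hz.1, hr2 z (hbs hz.1) (by rw [hk₃x]; exact hz.2), div_self (hne z hz.1)])
    ⟨hkb _ hm1, hkx _ hm1 (by norm_num)⟩ ⟨hkb _ hm2, hkx _ hm2 (by norm_num)⟩
  have h2 := sign_const_of_preconnected (isPreconnected_Ioo (a := (-1 : ℝ)) (b := 1))
    (τ := fun t => s (k₃ t) / ρ (k₃ t)) ((hsc.comp_continuousOn hkc).div (hρ.comp hkc hρm) hρ0) (fun t ht => by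
      rw [div_pow, hs2 _ (hkb t ht), hρ2 _ (hρm t ht), div_self (hne _ (hkb t ht))]) hm1 hm2
  obtain ⟨j1, j2⟩ := hrρ (1 / 2) (by norm_num) (by norm_num)
  rw [j1, j2, div_neg] at h1
  rw [h2] at h1
  have h3 : s (k₃ ((-(1 / 2) : ℝ) : ℂ)) / ρ (k₃ ((-(1 / 2) : ℝ) : ℂ)) ≠ 0 :=
    div_ne_zero (Complex.exp_ne_zero _) (hρ0 _ hm2)
  exact h3 (self_eq_neg.1 h1)

theorem IsSurface.goodHop_of_hasLogOn {X : Type*} [MetricSpace X] [CompactSpace X] [PreconnectedSpace X]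
    (hX : IsSurface X) (hlog : ∀ w : X → ℂ, Continuous w → (∀ x, w x ≠ 0) → HasLogOn w univ) (ε : ℝ) :
    GoodHop X ε := by
  intro w s hw h0 hs hsw d γ hγ _ hγ0 hγ1 hw1
  obtain ⟨g, hg, hge⟩ := hlog w hw h0
  have hgc : Continuous g := continuousOn_univ.1 hg
  have hs2 : ∀ z, Complex.exp (g z / 2) ^ 2 = w z := by
    intro z
    rw [hge z trivial, ← Complex.exp_nat_mul]
    congr 1; push_cast; ring
  have h1 := sign_const_of_preconnected (hX.isPreconnected_boundary hlog) (τ := fun z => s z / Complex.exp (g z / 2))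
    (hs.div (by fun_prop) fun _ _ => Complex.exp_ne_zero _) (fun z hz => by
      rw [div_pow, hs2, hsw z hz, div_self (h0 z)]) hγ0 hγ1
  have h2 := sign_const_of_preconnected (isPreconnected_Icc (a := 0) (b := d))
    (τ := fun t => Complex.exp (g (γ t) / 2))
    (((by fun_prop : Continuous fun z => Complex.exp (g z / 2))).comp_continuousOn hγ.continuousOn) (fun t ht => by
      rw [hs2, hw1 t ht]) hγ.left_mem hγ.right_mem
  rw [h2] at h1
  exact (div_left_inj' (Complex.exp_ne_zero _)).1 h1

end

section

theorem eventually_goodHop {q : ℕ} (hq : 0 < q) {c : ℤ} {S : ℕ → Type} [∀ n, MetricSpace (S n)]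
    (hsurf : ∀ n, IsCompactSurface (S n)) (hlen : ∀ n, IsLengthSpace (S n))
    (hnb : ∀ n, (surfaceBoundaryComponents (S n)).ncard = q) (hrc : ∀ n, redConnNum (S n) = c)
    {D : ℕ → Type} [∀ n, MetricSpace (D n)] {ip im : ∀ n, S n → D n}
    (hdouble : ∀ n, IsMetricDouble (S n) (surfaceBoundary (S n)) (D n) (ip n) (im n))
    (hreg : RegularDoubleSeq D) : ∃ ε > 0, ∀ᶠ n in atTop, GoodHop (S n) ε := by
  have hcpt : ∀ n, CompactSpace (S n) := fun n => (hsurf n).1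
  have hconn : ∀ n, ConnectedSpace (S n) := fun n => (hsurf n).2.1
  have hB : ∀ n, IsCompact (surfaceBoundary (S n)) := fun n => (isClosed_surfaceBoundary (S n)).isCompact
  have hne : ∀ n, (surfaceBoundary (S n)).Nonempty := by
    intro n
    have : (surfaceBoundaryComponents (S n)).Nonempty := Set.nonempty_of_ncard_ne_zero (by rw [hnb]; omega)
    obtain ⟨_, x, hx, -⟩ := this
    exact ⟨x, hx⟩
  by_cases hA : ∀ n, ∃ J : Set (D n), IsNonContractibleJordanCurve J
  · have hmin : ∀ n, ∃ J : Set (D n), IsNonContractibleJordanCurve J ∧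
        ∀ J' : Set (D n), IsNonContractibleJordanCurve J' → diam J ≤ diam J' + 1 / ((n : ℝ) + 1) := by
      intro n
      obtain ⟨J₀, hJ₀⟩ := hA n
      set A : Set ℝ := {d | ∃ J : Set (D n), IsNonContractibleJordanCurve J ∧ diam J = d} with hAdef
      have hbd : BddBelow A := ⟨0, by rintro _ ⟨J, -, rfl⟩; exact diam_nonneg⟩
      obtain ⟨_, ⟨J, hJ, rfl⟩, hlt⟩ := exists_lt_of_csInf_lt (⟨_, J₀, hJ₀, rfl⟩ : A.Nonempty)
        (lt_add_of_pos_right (sInf A) (by positivity : 0 < 1 / ((n : ℝ) + 1)))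
      exact ⟨J, hJ, fun J' hJ' => hlt.le.trans (add_le_add_left (csInf_le hbd ⟨J', hJ', rfl⟩) _)⟩
    choose J hJ hJmin using hmin
    set δ := ⨅ n, diam (J n) with hδ
    have hδ0 : 0 < δ := hreg J hJ
    refine ⟨δ / 4, by positivity, ?_⟩
    filter_upwards [tendsto_one_div_add_atTop_nhds_zero_nat.eventually_lt_const (half_pos hδ0)] with n hn
    refine (hdouble n).goodHop (hB n) fun J' hJ' => ?_
    have h1 : δ ≤ diam (J n) := ciInf_le ⟨0, by rintro _ ⟨n, rfl⟩; exact diam_nonneg⟩ n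
    have h2 := hJmin n J' hJ'
    linarith
  · push Not at hA
    obtain ⟨n₀, hn₀⟩ := hA
    have hgeo : ∀ n, HasGeods (S n) := fun n => (hlen n).hasGeods
    have hpath : ∀ n, PathConnectedSpace (S n) := fun n => (hgeo n).pathConnectedSpace
    have h0 : h1Rank (S n₀) = 0 := h1Rank_eq_zero_of_subsingleton fun x =>
      (hdouble n₀).fundamentalGroup_subsingleton (hsurf n₀).2.2.2 (hgeo n₀) (hB n₀) (hne n₀) hn₀ x
    have hcn : ∀ n, (connNum (S n) : ℤ) = h1Rank (S n) + 1 := by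
      intro n
      rw [connNum, if_neg fun h : surfaceBoundary (S n) = ∅ ∧ SurfOrientable (S n) => (hne n).ne_empty h.1]
      push_cast; rfl
    have hr : ∀ n, h1Rank (S n) = 0 := by
      intro n
      have h1 := (hrc n).trans (hrc n₀).symm
      rw [redConnNum, redConnNum, hcn, hcn, hnb, hnb, h0] at h1
      push_cast at h1
      omega
    exact ⟨1, one_pos, Eventually.of_forall fun n => (hsurf n).2.2.2.goodHop_of_hasLogOn
      (fun w hw hw0 => (hsurf n).2.2.2.hasLogOn_of_h1Rank (hgeo n) (hr n) hw hw0) 1⟩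

end

/-! ### Passing to the limit -/

/-- A short step in `B` such that everything close to a shortest curve between its ends lies in `U`. -/
def LimitHop {Z : Type*} [MetricSpace Z] (B : Set Z) (ε : ℝ) (U : Set Z) (a b : Z) : Prop :=
  a ∈ B ∧ b ∈ B ∧ dist a b < ε ∧ ∃ η > 0, {z | dist a z + dist z b ≤ dist a b + η} ⊆ U

/-- No point can be joined in `B` with three other ones in a planar-impossible way. -/
def NoTripod {Z : Type*} [MetricSpace Z] (B : Set Z) (ε : ℝ) : Prop :=
  ∀ (p : Z) (m : Fin 3 → Z), p ∈ B → (∀ k, m k ∈ B) → (∀ k, m k ≠ p) → Function.Injective m →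
    ¬ ∀ k i j, i ≠ j → i ≠ k → j ≠ k → ∃ U V, Disjoint U V ∧
      Relation.ReflTransGen (LimitHop B ε U) (m k) p ∧ Relation.ReflTransGen (LimitHop B ε V) (m i) (m j)

/-- A short geodesic between boundary points whose image under `e` lies in `U`. -/
def HopIn {S Z : Type*} [MetricSpace S] (e : S → Z) (ε : ℝ) (U : Set Z) (u v : S) : Prop :=
  u ∈ surfaceBoundary S ∧ v ∈ surfaceBoundary S ∧ ∃ (d : ℝ) (γ : ℝ → S), IsGeod γ d ∧ d < ε ∧
    γ 0 = u ∧ γ d = v ∧ ∀ t ∈ Icc 0 d, e (γ t) ∈ U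

section

variable {Z : Type*} [MetricSpace Z] {B : Set Z} {ε : ℝ}

theorem HopIn.chain_connected {S : Type*} [MetricSpace S] {e : S → Z} {U : Set Z} {u v : S}
    (h : Relation.ReflTransGen (HopIn e ε U) u v) :
    u = v ∨ ∃ Q, IsPreconnected Q ∧ u ∈ Q ∧ v ∈ Q ∧ Q ⊆ e ⁻¹' U := by
  induction h with
  | refl => exact Or.inl rfl
  | @tail b c _ hbc ih =>
    right
    obtain ⟨-, -, d, γ, hγ, -, h0, h1, hU⟩ := hbc
    have hpre : IsPreconnected (γ '' Icc 0 d) := isPreconnected_Icc.image _ hγ.continuousOn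
    have hb : b ∈ γ '' Icc 0 d := ⟨0, hγ.left_mem, h0⟩
    have hc : c ∈ γ '' Icc 0 d := ⟨d, hγ.right_mem, h1⟩
    have hsub : γ '' Icc 0 d ⊆ e ⁻¹' U := by
      rintro _ ⟨t, ht, rfl⟩
      exact hU t ht
    rcases ih with rfl | ⟨Q, hQ, huQ, hbQ, hQU⟩
    · exact ⟨_, hpre, hb, hc, hsub⟩
    · exact ⟨Q ∪ γ '' Icc 0 d, hQ.union b hbQ hb hpre, Or.inl huQ, Or.inr hc, union_subset hQU hsub⟩

section transfer

variable {S : ℕ → Type} [∀ n, MetricSpace (S n)] [∀ n, CompactSpace (S n)] {e : ∀ n, S n → Z}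
  {f : ∀ n, Z → S n}

theorem LimitHop.eventually_hopIn (hlen : ∀ n, IsLengthSpace (S n)) (hiso : ∀ n, Isometry (e n))
    (hf : ∀ n z, f n z ∈ surfaceBoundary (S n))
    (hlim : ∀ z ∈ B, Tendsto (fun n => e n (f n z)) atTop (𝓝 z)) {U : Set Z} {a b : Z}
    (h : LimitHop B ε U a b) : ∀ᶠ n in atTop, HopIn (e n) ε U (f n a) (f n b) := by
  obtain ⟨ha, hb, hd, η, hη, hU⟩ := h
  have hδ : 0 < min (η / 4) ((ε - dist a b) / 4) := lt_min (by linarith) (by linarith)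
  filter_upwards [(Metric.tendsto_nhds.1 (hlim a ha)) _ hδ, (Metric.tendsto_nhds.1 (hlim b hb)) _ hδ] with n h1 h2
  obtain ⟨h1a, h1b⟩ := lt_min_iff.1 h1
  obtain ⟨h2a, h2b⟩ := lt_min_iff.1 h2
  obtain ⟨γ, hγ, hγ0, hγ1⟩ := (hlen n).exists_geod (f n a) (f n b)
  have hdd : dist (f n a) (f n b) = dist (e n (f n a)) (e n (f n b)) := ((hiso n).dist_eq _ _).symm
  have h3 : dist (e n (f n a)) (e n (f n b)) ≤ dist (e n (f n a)) a + dist a b + dist b (e n (f n b)) :=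
    dist_triangle4 _ _ _ _
  rw [dist_comm b] at h3
  refine ⟨hf n a, hf n b, _, γ, hγ, by linarith, hγ0, hγ1, fun t ht => hU ?_⟩
  have h4 := hγ.2 0 hγ.left_mem t ht
  have h5 := hγ.2 t ht _ hγ.right_mem
  rw [hγ0, ← (hiso n).dist_eq] at h4
  rw [hγ1, ← (hiso n).dist_eq] at h5
  rw [abs_of_nonpos (by linarith [ht.1])] at h4
  rw [abs_of_nonpos (by linarith [ht.2])] at h5
  have h6 := dist_triangle a (e n (f n a)) (e n (γ t))
  have h7 := dist_triangle (e n (γ t)) (e n (f n b)) b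
  rw [dist_comm a (e n (f n a))] at h6
  simp only [mem_ofPred_eq]
  linarith

theorem LimitHop.eventually_chain (hlen : ∀ n, IsLengthSpace (S n)) (hiso : ∀ n, Isometry (e n))
    (hf : ∀ n z, f n z ∈ surfaceBoundary (S n))
    (hlim : ∀ z ∈ B, Tendsto (fun n => e n (f n z)) atTop (𝓝 z)) {U : Set Z} {a b : Z}
    (h : Relation.ReflTransGen (LimitHop B ε U) a b) :
    ∀ᶠ n in atTop, Relation.ReflTransGen (HopIn (e n) ε U) (f n a) (f n b) := by
  induction h with
  | refl => exact Eventually.of_forall fun _ => .refl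
  | tail _ hbc ih =>
    filter_upwards [ih, hbc.eventually_hopIn hlen hiso hf hlim] with n h1 h2
    exact h1.tail h2

theorem noTripod_of_goodHop (hsurf : ∀ n, IsSurface (S n)) (hlen : ∀ n, IsLengthSpace (S n))
    (hgood : ∀ᶠ n in atTop, GoodHop (S n) ε) (hiso : ∀ n, Isometry (e n))
    (hf : ∀ n z, f n z ∈ surfaceBoundary (S n))
    (hlim : ∀ z ∈ B, Tendsto (fun n => e n (f n z)) atTop (𝓝 z)) : NoTripod B ε := by
  intro p m hp hm hmp hinj H
  have hne : ∀ x ∈ B, ∀ y ∈ B, x ≠ y → ∀ᶠ n in atTop, f n x ≠ f n y := by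
    intro x hx y hy hxy
    filter_upwards [((hlim x hx).dist (hlim y hy)).eventually_const_lt (dist_pos.2 hxy)] with n hn h
    rw [h, dist_self] at hn
    exact hn.false
  have hall : ∀ k i j, ∀ᶠ n in atTop, i ≠ j → i ≠ k → j ≠ k →
      ∃ Q, IsPreconnected Q ∧ f n (m i) ∈ Q ∧ f n (m j) ∈ Q ∧
        Relation.ReflTransGen (HopAvoid ε Q) (f n (m k)) (f n p) := by
    intro k i j
    by_cases hij : i = j
    · exact Eventually.of_forall fun _ h => (h hij).elim
    by_cases hik : i = k
    · exact Eventually.of_forall fun _ _ h => (h hik).elim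
    by_cases hjk : j = k
    · exact Eventually.of_forall fun _ _ _ h => (h hjk).elim
    obtain ⟨U, V, hUV, hU, hV⟩ := H k i j hij hik hjk
    filter_upwards [LimitHop.eventually_chain hlen hiso hf hlim hU,
      LimitHop.eventually_chain hlen hiso hf hlim hV, hne _ (hm i) _ (hm j) (hinj.ne hij)] with n h1 h2 h3 _ _ _
    obtain h4 | ⟨Q, hQ, hi, hj, hQV⟩ := HopIn.chain_connected h2
    · exact (h3 h4).elim
    refine ⟨Q, hQ, hi, hj, Relation.ReflTransGen.mono (r := HopIn (e n) ε U) ?_ _ _ h1⟩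
    rintro u v ⟨hu, hv, d, γ, hγ, hd, h0, h1, hU⟩
    refine ⟨hu, hv, d, γ, hγ, hd, h0, h1, ?_⟩
    rw [disjoint_left]
    rintro _ ⟨t, ht, rfl⟩ hQt
    exact disjoint_left.1 hUV (hU t ht) (hQV hQt)
  have hev : ∀ᶠ n in atTop, ∀ k i j, i ≠ j → i ≠ k → j ≠ k →
      ∃ Q, IsPreconnected Q ∧ f n (m i) ∈ Q ∧ f n (m j) ∈ Q ∧
        Relation.ReflTransGen (HopAvoid ε Q) (f n (m k)) (f n p) := by
    refine eventually_all.2 fun k => eventually_all.2 fun i => eventually_all.2 fun j => hall k i j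
  have hne1 : ∀ᶠ n in atTop, ∀ k, f n (m k) ≠ f n p := by
    rw [eventually_all]
    exact fun k => hne _ (hm k) _ hp (hmp k)
  have hne2 : ∀ᶠ n in atTop, ∀ i j, f n (m i) = f n (m j) → i = j := by
    simp only [eventually_all]
    intro i j
    by_cases hij : i = j
    · exact Eventually.of_forall fun _ _ => hij
    filter_upwards [hne _ (hm i) _ (hm j) (hinj.ne hij)] with n hn h
    exact (hn h).elim
  obtain ⟨n, h1, h2, h3, h4⟩ := (hgood.and (hev.and (hne1.and hne2))).exists
  exact h1.planar (hsurf n) (m := fun k => f n (m k)) (fun k => hf n _) h3 h2 fun i j => h4 i j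

end transfer

theorem limitHop_chain_of_connected {K U : Set Z} (hε : 0 < ε) (hKB : K ⊆ B) (hK : IsCompact K)
    (hc : IsPreconnected K) (hU : IsOpen U) (hKU : K ⊆ U) {x y : Z} (hx : x ∈ K) (hy : y ∈ K) :
    Relation.ReflTransGen (LimitHop B ε U) x y := by
  obtain ⟨δ, hδ, hδU⟩ := hK.exists_thickening_subset_open hU hKU
  have step : ∀ u ∈ K, ∀ v ∈ K, dist u v < min ε (δ / 2) → LimitHop B ε U u v := by
    intro u hu v hv huv
    refine ⟨hKB hu, hKB hv, huv.trans_le (min_le_left _ _), δ / 2, by positivity, fun z hz => hδU ?_⟩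
    simp only [mem_ofPred_eq] at hz
    have := huv.trans_le (min_le_right _ _)
    exact mem_thickening_iff.2 ⟨u, hu, by rw [dist_comm]; linarith [dist_nonneg (x := z) (y := v)]⟩
  refine hc.induction₂' (fun a b => Relation.ReflTransGen (LimitHop B ε U) a b) ?_ ?_ hx hy
  · intro u hu
    filter_upwards [inter_mem_nhdsWithin K (ball_mem_nhds u (lt_min hε (half_pos hδ)))] with v hv
    have h := hv.2
    rw [mem_ball] at h
    exact ⟨.single (step u hu v hv.1 (by rwa [dist_comm])), .single (step v hv.1 u hu h)⟩
  · intro a b c _ _ _ h1 h2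
    exact h1.trans h2

end

/-! ### Cyclicly connected sets without tripods -/

/-- Disjoint continua joining `p` with `a`, and `b` with `c`. -/
def JoinedApart {Y : Type*} [TopologicalSpace Y] (p a b c : Y) : Prop :=
  ∃ K L : Set Y, IsCompact K ∧ IsCompact L ∧ IsPreconnected K ∧ IsPreconnected L ∧ Disjoint K L ∧
    p ∈ K ∧ a ∈ K ∧ b ∈ L ∧ c ∈ L

section

variable {Y : Type*} [TopologicalSpace Y]

theorem IsJordanCurve.exists_param {K : Set Y} (hK : IsJordanCurve K) :
    ∃ c : ℝ → Y, Continuous c ∧ range c = K ∧ ∀ u v, c u = c v ↔ ∃ k : ℤ, u - v = k := by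
  obtain ⟨φ⟩ := hK
  refine ⟨fun u => φ.symm (circTurn u), continuous_subtype_val.comp (φ.symm.continuous.comp continuous_circTurn), ?_, fun u v => ?_⟩
  · ext y
    constructor
    · rintro ⟨u, rfl⟩
      exact (φ.symm _).2
    · intro hy
      obtain ⟨u, hu⟩ := exists_circTurn (φ ⟨y, hy⟩)
      exact ⟨u, by simp [hu]⟩
  · rw [Subtype.coe_inj, φ.symm.injective.eq_iff, circTurn_eq_iff]

theorem IsJordanCurve.exists_param_Ico {c : ℝ → Y} (hcc : ∀ u v, c u = c v ↔ ∃ k : ℤ, u - v = k) {y : Y}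
    (hy : y ∈ range c) (a : ℝ) : ∃ u ∈ Ico a (a + 1), c u = y := by
  obtain ⟨u, rfl⟩ := hy
  refine ⟨a + Int.fract (u - a), ⟨by linarith [Int.fract_nonneg (u - a)], by linarith [Int.fract_lt_one (u - a)]⟩,
    (hcc _ _).2 ⟨-⌊u - a⌋, ?_⟩⟩
  have := Int.self_sub_floor (u - a)
  push_cast
  linarith

theorem param_eq_of_abs_lt {c : ℝ → Y} (hcc : ∀ u v, c u = c v ↔ ∃ k : ℤ, u - v = k) {u v : ℝ} (h : c u = c v)
    (h1 : u - v < 1) (h2 : v - u < 1) : u = v := by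
  obtain ⟨k, hk⟩ := (hcc u v).1 h
  have h3 : k < 1 := by exact_mod_cast (by rw [← hk]; exact h1 : (k : ℝ) < 1)
  have h4 : -1 < k := by exact_mod_cast (by rw [← hk]; linarith : (-1 : ℝ) < k)
  obtain rfl : k = 0 := by omega
  push_cast at hk
  linarith

/-- Following a Jordan curve from `t` to the set `J` without meeting `y`. -/
theorem IsJordanCurve.exists_ear {K J : Set Y} (hK : IsJordanCurve K) (hJ : IsClosed J) {t x y : Y} (ht : t ∈ K)
    (htJ : t ∉ J) (hx : x ∈ K) (hxJ : x ∈ J) (hyt : y ≠ t) (hyx : y ≠ x) :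
    ∃ (E : Set Y) (j : Y), IsCompact E ∧ IsPreconnected E ∧ t ∈ E ∧ j ∈ E ∧ j ∈ J ∧ j ≠ y ∧
      ∀ z ∈ E, z ∈ J → z = j := by
  obtain ⟨c, hc, rfl, hcc⟩ := hK.exists_param
  obtain ⟨u, v, rfl, rfl, huv⟩ : ∃ u v, c u = t ∧ c v = x ∧ ∀ r ∈ uIcc u v, c r ≠ y := by
    by_cases hy : y ∈ range c
    · obtain ⟨a, rfl⟩ := hy
      obtain ⟨u, hu, rfl⟩ := IsJordanCurve.exists_param_Ico hcc ht a
      obtain ⟨v, hv, rfl⟩ := IsJordanCurve.exists_param_Ico hcc hx a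
      have hu' : a < u := lt_of_le_of_ne hu.1 fun h => hyt (by rw [h])
      have hv' : a < v := lt_of_le_of_ne hv.1 fun h => hyx (by rw [h])
      refine ⟨u, v, rfl, rfl, fun r hr h => ?_⟩
      have h1 : a < r := (lt_min hu' hv').trans_le hr.1
      have h2 : r < a + 1 := hr.2.trans_lt (max_lt hu.2 hv.2)
      exact h1.ne' (param_eq_of_abs_lt hcc h (by linarith) (by linarith))
    · obtain ⟨u, hu⟩ := ht
      obtain ⟨v, hv⟩ := hx
      exact ⟨u, v, hu, hv, fun r _ h => hy ⟨r, h⟩⟩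
  let g : ℝ → ℝ := fun r => u + r * (v - u)
  have hg : Continuous g := by fun_prop
  have hgm : ∀ r ∈ Icc (0 : ℝ) 1, g r ∈ uIcc u v := by
    intro r hr
    rw [← segment_eq_uIcc]
    exact ⟨1 - r, r, by linarith [hr.2], hr.1, by ring, by simp [g]; ring⟩
  have hcpt : IsCompact (Icc (0 : ℝ) 1 ∩ (fun r => c (g r)) ⁻¹' J) :=
    isCompact_Icc.inter_right (hJ.preimage (hc.comp hg))
  obtain ⟨s, ⟨hs, hsJ⟩, hmin⟩ := hcpt.exists_isLeast ⟨1, right_mem_Icc.2 zero_le_one, by simpa [g] using hxJ⟩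
  have hcont : ContinuousOn (fun r => c (g r)) (Icc 0 s) := (hc.comp hg).continuousOn
  refine ⟨(fun r => c (g r)) '' Icc 0 s, c (g s), isCompact_Icc.image_of_continuousOn hcont,
    isPreconnected_Icc.image _ hcont, ⟨0, left_mem_Icc.2 hs.1, by simp [g]⟩, ⟨s, right_mem_Icc.2 hs.1, rfl⟩, hsJ,
    huv _ (hgm s hs), ?_⟩
  rintro _ ⟨r, hr, rfl⟩ hrJ
  have : s ≤ r := hmin ⟨⟨hr.1, hr.2.trans hs.2⟩, hrJ⟩
  rw [le_antisymm hr.2 this]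

/-- In a space without tripods, nondegenerate cyclicly connected sets are Jordan curves. -/
theorem CycliclyConnected.isJordanCurve [T2Space Y]
    (hY : ∀ p a b c : Y, p ≠ a → p ≠ b → p ≠ c → a ≠ b → a ≠ c → b ≠ c →
      JoinedApart p a b c → JoinedApart p b a c → ¬ JoinedApart p c a b)
    {T : Set Y} (hT : CycliclyConnected T) (hnt : T.Nontrivial) : IsJordanCurve T := by
  obtain ⟨x, hx, y, hy, hxy⟩ := hnt
  obtain ⟨J, hJT, hJ, hxJ, hyJ⟩ := hT x hx y hy hxy
  suffices T ⊆ J by rwa [this.antisymm hJT]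
  intro t htT
  by_contra htJ
  have hJcl : IsClosed J := by
    obtain ⟨φ⟩ := hJ
    have : CompactSpace J := φ.symm.compactSpace
    exact (isCompact_iff_compactSpace.2 this).isClosed
  have hnet : ∀ z ∈ J, z ≠ t := fun z hz h => htJ (h ▸ hz)
  obtain ⟨K, -, hK, htK, hxK⟩ := hT t htT x hx (hnet x hxJ).symm
  obtain ⟨E₁, j, hE₁c, hE₁p, htE₁, hjE₁, hjJ, -, hE₁J⟩ :=
    hK.exists_ear hJcl htK htJ hxK hxJ (hnet y hyJ) hxy.symm
  obtain ⟨x', hx'J, hx'j⟩ : ∃ x' ∈ J, x' ≠ j := by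
    by_cases h : x = j
    · exact ⟨y, hyJ, fun h' => hxy (h.trans h'.symm)⟩
    · exact ⟨x, hxJ, h⟩
  obtain ⟨K', -, hK', htK', hxK'⟩ := hT t htT x' (hJT hx'J) (hnet x' hx'J).symm
  obtain ⟨E₂, j', hE₂c, hE₂p, htE₂, hjE₂, hj'J, hj'j, hE₂J⟩ :=
    hK'.exists_ear hJcl htK' htJ hxK' hx'J (hnet j hjJ) hx'j.symm
  obtain ⟨c, hc, rfl, hcc⟩ := hJ.exists_param
  obtain ⟨a, rfl⟩ := hjJ
  obtain ⟨b, hb, rfl⟩ := IsJordanCurve.exists_param_Ico hcc hj'J a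
  have hab : a < b := lt_of_le_of_ne hb.1 fun h => hj'j (by rw [h])
  have hb1 : b < a + 1 := hb.2
  have hca : c (a + 1) = c a := (hcc _ _).2 ⟨1, by push_cast; ring⟩
  have hinj : ∀ {u v}, c u = c v → u - v < 1 → v - u < 1 → u = v := param_eq_of_abs_lt hcc
  have hkc : ∀ u v, IsCompact (c '' Icc u v) := fun u v => isCompact_Icc.image hc
  have hkp : ∀ u v, IsPreconnected (c '' Icc u v) := fun u v => isPreconnected_Icc.image c hc.continuousOn
  have hE₂dis : ∀ u v, (∀ r ∈ Icc u v, c r ≠ c b) → Disjoint (c '' Icc u v) E₂ := by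
    intro u v h
    rw [disjoint_left]
    rintro _ ⟨r, hr, rfl⟩ hE
    exact h r hr (hE₂J _ hE ⟨r, rfl⟩)
  have hdis : ∀ u v u' v', (∀ r ∈ Icc u v, ∀ r' ∈ Icc u' v', c r ≠ c r') →
      Disjoint (c '' Icc u v) (c '' Icc u' v') := by
    intro u v u' v' h
    rw [disjoint_left]
    rintro _ ⟨r, hr, rfl⟩ ⟨r', hr', h'⟩
    exact h r hr r' hr' h'.symm
  have hne : ∀ u v, u < v → v < u + 1 → c u ≠ c v := fun u v h1 h2 h =>
    h1.ne (hinj h (by linarith) (by linarith))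
  refine hY (c a) (c ((a + b) / 2)) (c ((a + 1 + b) / 2)) t (hne _ _ (by linarith) (by linarith))
    (hne _ _ (by linarith) (by linarith)) (hnet _ ⟨a, rfl⟩) (hne _ _ (by linarith) (by linarith))
    (hnet _ ⟨_, rfl⟩) (hnet _ ⟨_, rfl⟩) ?_ ?_ ?_
  · refine ⟨c '' Icc a ((a + b) / 2), c '' Icc b ((a + 1 + b) / 2) ∪ E₂, hkc _ _, (hkc _ _).union hE₂c, hkp _ _,
      (hkp _ _).union (c b) ⟨b, ⟨le_rfl, by linarith⟩, rfl⟩ hjE₂ hE₂p, ?_, ⟨a, ⟨le_rfl, by linarith⟩, rfl⟩,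
      ⟨_, ⟨by linarith, le_rfl⟩, rfl⟩, Or.inl ⟨_, ⟨by linarith, le_rfl⟩, rfl⟩, Or.inr htE₂⟩
    refine Disjoint.union_right (hdis _ _ _ _ ?_) (hE₂dis _ _ ?_)
    · rintro r ⟨h1, h2⟩ r' ⟨h3, h4⟩
      exact hne _ _ (by linarith) (by linarith)
    · rintro r ⟨h1, h2⟩
      exact hne _ _ (by linarith) (by linarith)
  · refine ⟨c '' Icc ((a + 1 + b) / 2) (a + 1), c '' Icc ((a + b) / 2) b ∪ E₂, hkc _ _, (hkc _ _).union hE₂c,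
      hkp _ _, (hkp _ _).union (c b) ⟨b, ⟨by linarith, le_rfl⟩, rfl⟩ hjE₂ hE₂p, ?_,
      ⟨a + 1, ⟨by linarith, le_rfl⟩, hca⟩,
      ⟨_, ⟨le_rfl, by linarith⟩, rfl⟩, Or.inl ⟨_, ⟨le_rfl, by linarith⟩, rfl⟩, Or.inr htE₂⟩
    refine Disjoint.union_right (hdis _ _ _ _ ?_) (hE₂dis _ _ ?_)
    · rintro r ⟨h1, h2⟩ r' ⟨h3, h4⟩
      exact (hne _ _ (by linarith) (by linarith)).symm
    · rintro r ⟨h1, h2⟩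
      exact (hne _ _ (by linarith) (by linarith)).symm
  · refine ⟨E₁, c '' Icc ((a + b) / 2) ((a + 1 + b) / 2), hE₁c, hkc _ _, hE₁p, hkp _ _, ?_, hjE₁, htE₁,
      ⟨_, ⟨le_rfl, by linarith⟩, rfl⟩, ⟨_, ⟨by linarith, le_rfl⟩, rfl⟩⟩
    rw [disjoint_right]
    rintro _ ⟨r, ⟨h1, h2⟩, rfl⟩ hE
    exact hne a r (by linarith) (by linarith) (hE₁J _ hE ⟨r, rfl⟩).symm

end

/-! ### Local connectedness of continua without tripods -/

section

theorem IsCompact.connectedComponentIn {Z : Type*} [TopologicalSpace Z] {F : Set Z} (hF : IsCompact F)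
    (x : Z) : IsCompact (connectedComponentIn F x) := by
  by_cases hx : x ∈ F
  · have : CompactSpace F := isCompact_iff_compactSpace.1 hF
    rw [connectedComponentIn_eq_image hx]
    exact isClosed_connectedComponent.isCompact.image continuous_subtype_val
  · rw [connectedComponentIn_eq_empty hx]
    exact isCompact_empty

theorem connectedComponentIn_disjoint_or_eq {Z : Type*} [TopologicalSpace Z] (F : Set Z) (x y : Z) :
    Disjoint (connectedComponentIn F x) (connectedComponentIn F y) ∨
      connectedComponentIn F x = connectedComponentIn F y := by
  rw [or_iff_not_imp_left, not_disjoint_iff]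
  rintro ⟨z, hz1, hz2⟩
  rw [connectedComponentIn_eq hz1, connectedComponentIn_eq hz2]

/-- Boundary bumping. -/
theorem exists_mem_connectedComponentIn_notMem {Z : Type*} [TopologicalSpace Z] [T2Space Z] {K G O : Set Z}
    (hK : IsCompact K) (hc : IsPreconnected K) (hG : IsClosed G) (hO : IsOpen O) (hOG : O ⊆ G) {x : Z} (hxK : x ∈ K)
    (hxG : x ∈ G) (hKO : ¬ K ⊆ O) : ∃ y ∈ connectedComponentIn (K ∩ G) x, y ∉ O := by
  by_contra! hcon
  have hF : IsCompact (K ∩ G) := hK.inter_right hG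
  have : CompactSpace ↥(K ∩ G) := isCompact_iff_compactSpace.1 hF
  have hx : x ∈ K ∩ G := ⟨hxK, hxG⟩
  rw [connectedComponentIn_eq_image hx, connectedComponent_eq_iInter_isClopen] at hcon
  have : Nonempty { s : Set ↥(K ∩ G) // IsClopen s ∧ (⟨x, hx⟩ : ↥(K ∩ G)) ∈ s } := ⟨⟨univ, isClopen_univ, trivial⟩⟩
  obtain ⟨⟨W, hW, hxW⟩, hWO⟩ := exists_subset_nhds_of_compactSpace
    (V := fun s : { s : Set ↥(K ∩ G) // IsClopen s ∧ (⟨x, hx⟩ : ↥(K ∩ G)) ∈ s } => s.1)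
    (fun a b => ⟨⟨a.1 ∩ b.1, a.2.1.inter b.2.1, a.2.2, b.2.2⟩, inter_subset_left, inter_subset_right⟩)
    (fun s => s.2.1.1) (U := Subtype.val ⁻¹' O)
    (fun z hz => (hO.preimage continuous_subtype_val).mem_nhds (hcon z ⟨z, hz, rfl⟩))
  have h1 : IsClosed (Subtype.val '' W) := (hW.1.isCompact.image continuous_subtype_val).isClosed
  have h2 : IsClosed (Subtype.val '' Wᶜ) := (hW.compl.1.isCompact.image continuous_subtype_val).isClosed
  have h3 : IsClosed (K ∩ Oᶜ) := hK.isClosed.inter hO.isClosed_compl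
  obtain ⟨w, hw, hwO⟩ := not_subset.1 hKO
  obtain ⟨z, hzK, ⟨z', hz', rfl⟩, hz2⟩ := isPreconnected_closed_iff.1 hc _ _ h1 (h2.union h3) (fun z hz => by
    by_cases hzO : z ∈ O
    · by_cases hzW : (⟨z, hz, hOG hzO⟩ : ↥(K ∩ G)) ∈ W
      · exact Or.inl ⟨_, hzW, rfl⟩
      · exact Or.inr (Or.inl ⟨_, hzW, rfl⟩)
    · exact Or.inr (Or.inr ⟨hz, hzO⟩)) ⟨x, hxK, ⟨x, hx⟩, hxW, rfl⟩ ⟨w, hw, Or.inr ⟨hw, hwO⟩⟩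
  rcases hz2 with ⟨z'', hz'', h⟩ | ⟨-, h⟩
  · rw [Subtype.coe_inj] at h
    subst h
    exact hz'' hz'
  · exact h (hWO hz')

variable {Z : Type*} [MetricSpace Z]

/-- Where a continuum is not connected im kleinen, three components of a small ball run close to
each other. -/
theorem exists_three_components {K : Set Z} (hK : IsCompact K) (hc : IsPreconnected K) {p : Z} (hp : p ∈ K) {r ρ τ : ℝ}
    (hρ : 0 < ρ) (hρr : ρ < r) (hτ : 0 < τ) (hn : connectedComponentIn (K ∩ closedBall p r) p ∉ 𝓝[K] p) :
    ∃ (C : Fin 3 → Set Z) (x y : Fin 3 → Z), (∀ i j, i ≠ j → Disjoint (C i) (C j)) ∧ (∀ i, IsCompact (C i)) ∧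
      (∀ i, IsPreconnected (C i)) ∧ (∀ i, C i ⊆ K) ∧ (∀ i, x i ∈ C i) ∧ (∀ i, y i ∈ C i) ∧
      (∀ i, dist (x i) p < ρ) ∧ (∀ i, dist (y i) p = r) ∧ ∀ i j, dist (y i) (y j) < τ := by
  classical
  set F := K ∩ closedBall p r with hF
  have hFc : IsCompact F := hK.inter_right isClosed_closedBall
  have hpF : p ∈ F := ⟨hp, mem_closedBall_self (hρ.le.trans hρr.le)⟩
  have hKO : ¬ K ⊆ ball p r := by
    intro h
    have h' : K ⊆ F := fun z hz => ⟨hz, ball_subset_closedBall (h hz)⟩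
    exact hn (mem_of_superset self_mem_nhdsWithin (hc.subset_connectedComponentIn hp h'))
  let 𝒞 : Set (Set Z) := {C | ∃ x ∈ F, dist x p < ρ ∧ C = _root_.connectedComponentIn F x}
  have hinf : 𝒞.Infinite := by
    intro hfin
    let 𝒜 : Set (Set Z) := 𝒞 ∩ {C | p ∉ C}
    have hA : IsClosed (⋃ C ∈ 𝒜, C) := (hfin.inter_of_left _).isClosed_biUnion fun C hC => by
      obtain ⟨⟨x, -, -, rfl⟩, -⟩ := hC
      exact (hFc.connectedComponentIn x).isClosed
    have hpA : p ∉ ⋃ C ∈ 𝒜, C := by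
      simp only [mem_iUnion, not_exists]
      exact fun C hC => hC.2
    refine hn ?_
    filter_upwards [self_mem_nhdsWithin, mem_nhdsWithin_of_mem_nhds (hA.isOpen_compl.mem_nhds hpA),
      mem_nhdsWithin_of_mem_nhds (ball_mem_nhds p hρ)] with z hzK hzA hzρ
    have hzF : z ∈ F := ⟨hzK, ball_subset_closedBall (ball_subset_ball hρr.le hzρ)⟩
    have hzz := mem_connectedComponentIn hzF
    have : p ∈ connectedComponentIn F z := by
      by_contra h
      exact hzA (mem_biUnion (x := connectedComponentIn F z) ⟨⟨z, hzF, hzρ, rfl⟩, h⟩ hzz)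
    rwa [← connectedComponentIn_eq this]
  have hex : ∀ C : 𝒞, ∃ y ∈ C.1, dist y p = r := by
    rintro ⟨_, x, hx, -, rfl⟩
    obtain ⟨y, hy, hyO⟩ := exists_mem_connectedComponentIn_notMem hK hc isClosed_closedBall isOpen_ball
      ball_subset_closedBall hx.1 hx.2 hKO
    refine ⟨y, hy, le_antisymm (connectedComponentIn_subset _ _ hy).2 ?_⟩
    simpa using hyO
  choose y hyC hyr using hex
  have hCF : ∀ C : 𝒞, C.1 ⊆ F := by
    rintro ⟨_, x, hx, -, rfl⟩
    exact connectedComponentIn_subset _ _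
  obtain ⟨t, -, htf, ht⟩ := finite_cover_balls_of_compact hFc (half_pos hτ)
  have hcen : ∀ C : 𝒞, ∃ z : t, dist (y C) z < τ / 2 := by
    intro C
    obtain ⟨z, hz, hz'⟩ := mem_iUnion₂.1 (ht (hCF C (hyC C)))
    exact ⟨⟨z, hz⟩, hz'⟩
  choose cen hcen using hcen
  have : Infinite 𝒞 := hinf.to_subtype
  have : Finite t := htf
  obtain ⟨z, hz⟩ := Finite.exists_infinite_fiber cen
  obtain ⟨s, hs⟩ := Infinite.exists_subset_card_eq (cen ⁻¹' {z}) 3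
  let g : Fin 3 ≃ s := (s.equivFinOfCardEq hs).symm
  have hgc : ∀ i, cen (g i).1.1 = z := fun i => (g i).1.2
  have hgi : ∀ i j, i ≠ j → (g i).1.1.1 ≠ (g j).1.1.1 := fun i j hij h =>
    hij (g.injective (Subtype.ext (Subtype.ext (Subtype.ext h))))
  have hx : ∀ C : 𝒞, ∃ x ∈ F, dist x p < ρ ∧ C.1 = _root_.connectedComponentIn F x := fun C => C.2
  choose x hxF hxρ hxC using hx
  refine ⟨fun i => (g i).1.1.1, fun i => x (g i).1.1, fun i => y (g i).1.1, fun i j hij => ?_, fun i => ?_, fun i => ?_,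
    fun i => (hCF _).trans inter_subset_left, fun i => ?_, fun i => hyC _, fun i => hxρ _, fun i => hyr _,
    fun i j => ?_⟩
  · have h := hgi i j hij
    dsimp only
    rw [hxC, hxC] at h ⊢
    exact (connectedComponentIn_disjoint_or_eq _ _ _).resolve_right h
  · dsimp only
    rw [hxC]
    exact hFc.connectedComponentIn _
  · dsimp only
    rw [hxC]
    exact isPreconnected_connectedComponentIn
  · dsimp only
    rw [hxC]
    exact mem_connectedComponentIn (hxF _)
  · have h1 := hcen (g i).1.1
    have h2 := hcen (g j).1.1
    rw [hgc] at h1 h2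
    have := dist_triangle_right (y (g i).1.1) (y (g j).1.1) z
    dsimp only
    linarith

variable {B : Set Z} {ε : ℝ}

theorem LimitHop.symm {U : Set Z} {a b : Z} (h : LimitHop B ε U a b) : LimitHop B ε U b a := by
  obtain ⟨ha, hb, hd, η, hη, hU⟩ := h
  refine ⟨hb, ha, by rwa [dist_comm], η, hη, fun z hz => hU ?_⟩
  simp only [mem_ofPred_eq] at hz ⊢
  rw [dist_comm a z, dist_comm z b, dist_comm a b]
  linarith

theorem LimitHop.chain_symm {U : Set Z} {a b : Z} (h : Relation.ReflTransGen (LimitHop B ε U) a b) :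
    Relation.ReflTransGen (LimitHop B ε U) b a := by
  induction h with
  | refl => exact .refl
  | tail _ hbc ih => exact .head hbc.symm ih

theorem NoTripod.connectedComponentIn_mem_nhds (hB : NoTripod B ε) {K : Set Z} (hKB : K ⊆ B) (hK : IsCompact K)
    (hc : IsPreconnected K) {p : Z} (hp : p ∈ K) {ρ : ℝ} (hρ : 0 < ρ) (hρε : ρ < ε) :
    connectedComponentIn (K ∩ closedBall p (2 * ρ)) p ∈ 𝓝[K] p := by
  by_contra hn
  obtain ⟨C, x, y, hdis, hcpt, hpre, hCK, hx, hy, hxρ, hyr, hyy⟩ :=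
    exists_three_components hK hc hp hρ (by linarith) (τ := ρ / 4) (by positivity) hn
  have hbump : ∀ i, ∃ m ∈ connectedComponentIn (C i ∩ {z | ρ ≤ dist z p}) (y i), dist m p = ρ := by
    intro i
    obtain ⟨m, hm, hmO⟩ := exists_mem_connectedComponentIn_notMem (hcpt i) (hpre i)
      (isClosed_le continuous_const (continuous_id.dist continuous_const) : IsClosed {z : Z | ρ ≤ dist z p})
      (isOpen_lt continuous_const (continuous_id.dist continuous_const) : IsOpen {z : Z | ρ < dist z p})
      (fun z (hz : ρ < dist z p) => show ρ ≤ dist z p from hz.le) (hy i) (by simp only [mem_ofPred_eq, hyr]; linarith)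
      (fun h => (hxρ i).not_gt (h (hx i)))
    exact ⟨m, hm, le_antisymm (not_lt.1 hmO) (connectedComponentIn_subset _ _ hm).2⟩
  choose m hmO hmρ using hbump
  have hOsub : ∀ i, connectedComponentIn (C i ∩ {z | ρ ≤ dist z p}) (y i) ⊆ C i ∩ {z | ρ ≤ dist z p} :=
    fun i => connectedComponentIn_subset _ _
  have hOc : ∀ i, IsCompact (connectedComponentIn (C i ∩ {z | ρ ≤ dist z p}) (y i)) := fun i =>
    ((hcpt i).inter_right (isClosed_le continuous_const (continuous_id.dist continuous_const))).connectedComponentIn _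
  have hyO : ∀ i, y i ∈ connectedComponentIn (C i ∩ {z | ρ ≤ dist z p}) (y i) := fun i =>
    mem_connectedComponentIn ⟨hy i, by simp only [mem_ofPred_eq, hyr]; linarith⟩
  have hmC : ∀ i, m i ∈ C i := fun i => (hOsub i (hmO i)).1
  refine hB p m (hKB hp) (fun k => hKB (hCK k (hmC k))) (fun k h => ?_) (fun i j hij => ?_) fun k i j hij hik hjk => ?_
  · have := hmρ k
    rw [h, dist_self] at this
    exact hρ.ne this
  · by_contra h
    exact disjoint_left.1 (hdis i j h) (hmC i) (hij ▸ hmC j)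
  · obtain ⟨η₁, hη₁, hball⟩ := Metric.isOpen_iff.1 ((hcpt i).union (hcpt j)).isClosed.isOpen_compl (m k)
      (by
        rintro (h | h)
        · exact disjoint_left.1 (hdis i k hik) h (hmC k)
        · exact disjoint_left.1 (hdis j k hjk) h (hmC k))
    set η := min (η₁ / 2) (ρ / 4) with hη
    have hη0 : 0 < η := lt_min (by positivity) (by positivity)
    have hηη₁ : η < η₁ := (min_le_left _ _).trans_lt (by linarith)
    have hηρ : η ≤ ρ / 4 := min_le_right _ _
    let U : Set Z := {z | dist (m k) z + dist z p ≤ dist (m k) p + η}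
    have hUcl : IsClosed U := isClosed_le (by fun_prop) continuous_const
    have hOU : ∀ l, (l = i ∨ l = j) → connectedComponentIn (C l ∩ {z | ρ ≤ dist z p}) (y l) ⊆ Uᶜ := by
      intro l hl z hz hzU
      obtain ⟨h1, h2⟩ := hOsub l hz
      simp only [mem_ofPred_eq, U, hmρ] at h2 hzU
      have h3 : z ∈ ball (m k) η₁ := by
        rw [mem_ball, dist_comm]
        linarith
      refine hball h3 ?_
      rcases hl with rfl | rfl
      · exact Or.inl h1
      · exact Or.inr h1
    refine ⟨U, Uᶜ, disjoint_compl_right, .single ⟨hKB (hCK k (hmC k)), hKB hp, by rwa [hmρ], η, hη0, subset_rfl⟩, ?_⟩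
    have hchain : ∀ l, (l = i ∨ l = j) → Relation.ReflTransGen (LimitHop B ε Uᶜ) (m l) (y l) := fun l hl =>
      limitHop_chain_of_connected (hρ.trans hρε) (((hOsub l).trans inter_subset_left).trans ((hCK l).trans hKB))
        (hOc l) isPreconnected_connectedComponentIn hUcl.isOpen_compl (hOU l hl) (hmO l) (hyO l)
    refine ((hchain i (Or.inl rfl)).tail ⟨hKB (hCK i (hy i)), hKB (hCK j (hy j)), (hyy i j).trans (by linarith), ρ / 4,
      by positivity, fun z hz hzU => ?_⟩).trans (LimitHop.chain_symm (hchain j (Or.inr rfl)))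
    simp only [mem_ofPred_eq, U, hmρ] at hz hzU
    have h1 := hyy i j
    have h2 := dist_triangle (y i) z p
    rw [hyr] at h2
    have h3 := dist_triangle_left z p (m k)
    rw [hmρ] at h3
    have h4 := dist_nonneg (x := z) (y := y j)
    linarith

end

/-! ### Continua without tripods are 1-cactoids -/

section

variable {Z : Type*} [MetricSpace Z] {B K : Set Z} {ε : ℝ}

theorem NoTripod.locallyConnectedSpace (hB : NoTripod B ε) (hε : 0 < ε) (hKB : K ⊆ B) (hK : IsCompact K)
    (hc : IsPreconnected K) : LocallyConnectedSpace K := by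
  refine locallyConnectedSpace_iff_connected_subsets.2 fun x U hU => ?_
  rw [nhds_subtype_eq_comap] at hU
  obtain ⟨U', hU', hsub⟩ := hU
  obtain ⟨r, hr, hrU⟩ := Metric.nhds_basis_closedBall.mem_iff.1 hU'
  set ρ := min (r / 2) (ε / 2) with hρ
  have hρ0 : 0 < ρ := lt_min (half_pos hr) (half_pos hε)
  have hmem := hB.connectedComponentIn_mem_nhds hKB hK hc x.2 hρ0 ((min_le_right _ _).trans_lt (half_lt_self hε))
  have hCsub := connectedComponentIn_subset (K ∩ closedBall (x : Z) (2 * ρ)) x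
  refine ⟨_, preimage_coe_mem_nhds_subtype.2 hmem, ?_, fun z hz => hsub (hrU ?_)⟩
  · rw [← Topology.IsInducing.subtypeVal.isPreconnected_image, Subtype.image_preimage_coe,
      inter_eq_right.2 (hCsub.trans inter_subset_left)]
    exact isPreconnected_connectedComponentIn
  · exact closedBall_subset_closedBall (by linarith [min_le_left (r / 2) (ε / 2)]) (hCsub hz).2

theorem JoinedApart.limitHop (hε : 0 < ε) (hKB : K ⊆ B) {p a b c : K} (h : JoinedApart p a b c) :
    ∃ U V, Disjoint U V ∧ Relation.ReflTransGen (LimitHop B ε U) (a : Z) p ∧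
      Relation.ReflTransGen (LimitHop B ε V) (b : Z) c := by
  obtain ⟨L, M, hL, hM, hLc, hMc, hLM, hp, ha, hb, hc⟩ := h
  have hL' : IsCompact (Subtype.val '' L : Set Z) := hL.image continuous_subtype_val
  have hM' : IsCompact (Subtype.val '' M : Set Z) := hM.image continuous_subtype_val
  obtain ⟨U, V, hU, hV, hLU, hMV, hUV⟩ := SeparatedNhds.of_isCompact_isCompact hL' hM'
    ((disjoint_image_iff Subtype.val_injective).2 hLM)
  have hsub : ∀ N : Set K, (Subtype.val '' N : Set Z) ⊆ B := by
    rintro N _ ⟨z, -, rfl⟩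
    exact hKB z.2
  exact ⟨U, V, hUV,
    limitHop_chain_of_connected hε (hsub L) hL' (hLc.image _ continuous_subtype_val.continuousOn) hU hLU
      (mem_image_of_mem _ ha) (mem_image_of_mem _ hp),
    limitHop_chain_of_connected hε (hsub M) hM' (hMc.image _ continuous_subtype_val.continuousOn) hV hMV
      (mem_image_of_mem _ hb) (mem_image_of_mem _ hc)⟩

theorem JoinedApart.symm {Y : Type*} [TopologicalSpace Y] {p a b c : Y} (h : JoinedApart p a b c) :
    JoinedApart p a c b := by
  obtain ⟨L, M, hL, hM, hLc, hMc, hLM, hp, ha, hb, hc⟩ := h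
  exact ⟨L, M, hL, hM, hLc, hMc, hLM, hp, ha, hc, hb⟩

theorem NoTripod.not_joinedApart (hB : NoTripod B ε) (hε : 0 < ε) (hKB : K ⊆ B) {p a b c : K} (hpa : p ≠ a)
    (hpb : p ≠ b) (hpc : p ≠ c) (hab : a ≠ b) (hac : a ≠ c) (hbc : b ≠ c) (ha : JoinedApart p a b c)
    (hb : JoinedApart p b a c) : ¬ JoinedApart p c a b := by
  intro hc
  let m : Fin 3 → K := ![a, b, c]
  have hinj : Function.Injective m := by
    intro i j hij
    fin_cases i <;> fin_cases j <;> simp_all [m]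
  refine hB p (fun k => m k) (hKB p.2) (fun k => hKB (m k).2) (fun k h => ?_)
    (Subtype.val_injective.comp hinj) fun k i j hij hik hjk => JoinedApart.limitHop hε hKB ?_
  · have h' := Subtype.ext h
    fin_cases k
    · exact hpa h'.symm
    · exact hpb h'.symm
    · exact hpc h'.symm
  · fin_cases k <;> fin_cases i <;> fin_cases j <;> simp_all [m, JoinedApart.symm]

theorem NoTripod.isOneCactoid (hB : NoTripod B ε) (hε : 0 < ε) (hKB : K ⊆ B) (hK : IsCompact K)
    (hc : IsConnected K) : IsOneCactoid K :=
  ⟨⟨isCompact_iff_compactSpace.1 hK, isConnected_iff_connectedSpace.1 hc,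
    hB.locallyConnectedSpace hε hKB hK hc.isPreconnected⟩,
    fun _ hT => hT.2.1.isJordanCurve (fun _ _ _ _ => hB.not_joinedApart hε hKB) hT.1⟩

theorem exists_approximating_points {S : ℕ → Type*} {e : ∀ n, S n → Z} {A : ∀ n, Set (S n)}
    (hA : ∀ n, (A n).Nonempty) (h : Tendsto (fun n => hausdorffEDist (e n '' A n) B) atTop (𝓝 0)) :
    ∃ f : ∀ n, Z → S n, (∀ n z, f n z ∈ A n) ∧ ∀ z ∈ B, Tendsto (fun n => e n (f n z)) atTop (𝓝 z) := by
  have hex : ∀ n z, ∃ u ∈ A n, z ∈ B → hausdorffEDist (e n '' A n) B ≠ ⊤ →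
      edist (e n u) z ≤ hausdorffEDist (e n '' A n) B + (n : ℝ≥0∞)⁻¹ := by
    intro n z
    by_cases hz : z ∈ B ∧ hausdorffEDist (e n '' A n) B ≠ ⊤
    · have hlt : hausdorffEDist B (e n '' A n) < hausdorffEDist (e n '' A n) B + (n : ℝ≥0∞)⁻¹ := by
        rw [hausdorffEDist_comm]
        exact ENNReal.lt_add_right hz.2 (by simp)
      obtain ⟨_, ⟨u, hu, rfl⟩, huz⟩ := exists_edist_lt_of_hausdorffEDist_lt hz.1 hlt
      exact ⟨u, hu, fun _ _ => by rw [edist_comm]; exact huz.le⟩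
    · exact ⟨_, (hA n).some_mem, fun h1 h2 => (hz ⟨h1, h2⟩).elim⟩
  choose f hfA hf using hex
  refine ⟨f, hfA, fun z hz => tendsto_iff_edist_tendsto_0.2 ?_⟩
  refine tendsto_of_tendsto_of_tendsto_of_le_of_le' tendsto_const_nhds
    (by simpa using h.add ENNReal.tendsto_inv_nat_nhds_zero) (Eventually.of_forall fun _ => zero_le) ?_
  filter_upwards [h.eventually_lt_const ENNReal.zero_lt_top] with n hn
  exact hf n z hz hn.ne

end

/-! ## STATEMENT 14 -/

theorem stmt14 (c : ℤ) (q : ℕ) (hq : 0 < q)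
    (Xs : ℕ → Type) [∀ n, MetricSpace (Xs n)]
    (hsurf : ∀ n, IsCompactSurface (Xs n)) (hlen : ∀ n, IsLengthSpace (Xs n))
    (hnb : ∀ n, (surfaceBoundaryComponents (Xs n)).ncard = q)
    (hrc : ∀ n, redConnNum (Xs n) = c)
    (D : ℕ → Type) [∀ n, MetricSpace (D n)]
    (ip im : ∀ n, Xs n → D n)
    (hdouble : ∀ n, IsMetricDouble (Xs n) (surfaceBoundary (Xs n)) (D n) (ip n) (im n))
    (hreg : RegularDoubleSeq D)
    (Z : Type) [MetricSpace Z] [CompactSpace Z]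
    (e : ∀ n, Xs n → Z) (hiso : ∀ n, Isometry (e n))
    (X : Set Z) (hXcl : IsClosed X) (hXne : X.Nonempty)
    (hconv : Filter.Tendsto (fun n => EMetric.hausdorffEdist (Set.range (e n)) X)
      Filter.atTop (nhds 0))
    (Binf : Set Z) (hBcl : IsClosed Binf) (hBsub : Binf ⊆ X)
    (hBconv : Filter.Tendsto
      (fun n => EMetric.hausdorffEdist (e n '' surfaceBoundary (Xs n)) Binf)
      Filter.atTop (nhds 0))
    (bcomp : Set Z) (hbc : ∃ z ∈ Binf, bcomp = connectedComponentIn Binf z) :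
    IsOneCactoid ↥bcomp := by
  obtain ⟨z, hz, rfl⟩ := hbc
  have hcpt : ∀ n, CompactSpace (Xs n) := fun n => (hsurf n).1
  have hne : ∀ n, (surfaceBoundary (Xs n)).Nonempty := by
    intro n
    have h : (surfaceBoundaryComponents (Xs n)).ncard ≠ 0 := by
      rw [hnb]
      exact hq.ne'
    obtain ⟨_, x, hx, -⟩ := nonempty_of_ncard_ne_zero h
    exact ⟨x, hx⟩
  obtain ⟨ε, hε, hgood⟩ := eventually_goodHop hq hsurf hlen hnb hrc hdouble hreg
  obtain ⟨f, hf, hlim⟩ := exists_approximating_points hne hBconv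
  have hB := noTripod_of_goodHop (fun n => (hsurf n).2.2.2) hlen hgood hiso hf hlim
  exact hB.isOneCactoid hε (connectedComponentIn_subset _ _) (hBcl.isCompact.connectedComponentIn z)
    (isConnected_connectedComponentIn_iff.2 hz)
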